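/- Let n ≥ 2 and p ≥ 1, and let conjugacy classes c_1,…,c_{p+1} ⊂ gl(n,ℂ) be given, where c_1 has n distinct eigenvalues. Assume the eigenvalues satisfy the trace condition Σ_{j=1}^{p+1} Σ_{k=1}^{n} λ_{k,j} = 0, that they are 2-generic, and that the index of rigidity κ := 2n² − (d_1 + ⋯ + d_{p+1}) satisfies κ ≤ 0. Then there exists an irreducible tuple (A_1,…,A_{p+1}) with A_j ∈ c_j and A_1 + ⋯ + A_{p+1} = 0 if and only if conditions (α_n) and (β_n) hold. -/

import Mathlib

open Polynomial BigOperators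

noncomputable def rk {n : ℕ} (Y : Matrix (Fin n) (Fin n) ℂ) : ℕ :=
  ⨅ μ : ℂ, (Y - μ • (1 : Matrix (Fin n) (Fin n) ℂ)).rank

/-- The submodule of matrices commuting with `Y`. -/
noncomputable def centSub {n : ℕ} (Y : Matrix (Fin n) (Fin n) ℂ) : Submodule ℂ (Matrix (Fin n) (Fin n) ℂ) where
  carrier := {Z | Y * Z = Z * Y}
  add_mem' := by
    intro a b ha hb
    simp only [Set.mem_setOf_eq] at *
    rw [Matrix.mul_add, Matrix.add_mul, ha, hb]
  zero_mem' := by simp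
  smul_mem' := by
    intro c a ha
    simp only [Set.mem_setOf_eq] at *
    rw [Matrix.mul_smul, Matrix.smul_mul, ha]

/-- `d(Y) = n² - dim of centralizer of Y`, the dimension of the conjugacy class. -/
noncomputable def dd {n : ℕ} (Y : Matrix (Fin n) (Fin n) ℂ) : ℕ :=
  n ^ 2 - Module.finrank ℂ (centSub Y)

def SameClass {n : ℕ} (A B : Matrix (Fin n) (Fin n) ℂ) : Prop :=
  ∃ S : Matrix (Fin n) (Fin n) ℂ, IsUnit S ∧ A = S * B * S⁻¹

def IrreducibleTuple {n q : ℕ} (A : Fin q → Matrix (Fin n) (Fin n) ℂ) : Prop :=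
  ∀ W : Submodule ℂ (Fin n → ℂ), (∀ j, ∀ v ∈ W, (A j).mulVec v ∈ W) → W = ⊥ ∨ W = ⊤

def TrivialCentralizer {n q : ℕ} (A : Fin q → Matrix (Fin n) (Fin n) ℂ) : Prop :=
  ∀ Z : Matrix (Fin n) (Fin n) ℂ, (∀ j, Z * A j = A j * Z) →
    ∃ c : ℂ, Z = c • (1 : Matrix (Fin n) (Fin n) ℂ)

def HasDistinctEigenvalues {n : ℕ} (Y : Matrix (Fin n) (Fin n) ℂ) : Prop :=
  ∃ μ : Fin n → ℂ, Function.Injective μ ∧ Y.charpoly = ∏ k, (Polynomial.X - Polynomial.C (μ k))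

def IsDiagble {n : ℕ} (Y : Matrix (Fin n) (Fin n) ℂ) : Prop :=
  ∃ S : Matrix (Fin n) (Fin n) ℂ, IsUnit S ∧ ∃ d : Fin n → ℂ, Y = S * Matrix.diagonal d * S⁻¹

noncomputable def multOf {n : ℕ} (Y : Matrix (Fin n) (Fin n) ℂ) (μ : ℂ) : ℕ :=
  Module.finrank ℂ (LinearMap.ker (Y - μ • (1 : Matrix (Fin n) (Fin n) ℂ)).mulVecLin)

/-- The Sylvester map `X ↦ P X - X R`. -/
noncomputable def sylv {l m : ℕ} (P : Matrix (Fin l) (Fin l) ℂ) (R : Matrix (Fin m) (Fin m) ℂ) :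
    Matrix (Fin l) (Fin m) ℂ →ₗ[ℂ] Matrix (Fin l) (Fin m) ℂ where
  toFun Z := P * Z - Z * R
  map_add' Z W := by
    show P * (Z + W) - (Z + W) * R = (P * Z - Z * R) + (P * W - W * R)
    rw [Matrix.mul_add, Matrix.add_mul]; abel
  map_smul' c Z := by
    show P * (c • Z) - (c • Z) * R = c • (P * Z - Z * R)
    rw [Matrix.mul_smul, Matrix.smul_mul, smul_sub]

noncomputable def sDim {l m : ℕ} (P : Matrix (Fin l) (Fin l) ℂ) (R : Matrix (Fin m) (Fin m) ℂ) : ℕ :=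
  Module.finrank ℂ (LinearMap.range (sylv P R))

section

section
structure CF (n N N' x d r u v z D : ℤ) : Prop where
  hu : 0 ≤ u
  hv : 0 ≤ v
  hr : r = u + v
  hrn : r ≤ n - 1
  hz : z ≤ u * v
  hx : x = N * v + N' * u - u * v - z
  hd : d = 2 * n * r - 2 * r ^ 2 + D
  h6 : 1 ≤ u → 1 ≤ v → D ≤ 2 * (u * v - z) * (r - 1)
  h7 : D ≤ r ^ 2 - 4 * z
  h7' : D ≤ r ^ 2
  h8 : ∀ u' v' : ℤ, 0 ≤ u' → 0 ≤ v' → u' + v' = n - r → (n - r) * z ≤ v' ^ 2 * u + u' ^ 2 * v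
  h9 : u ≤ (n - r) * u - z
  h9' : v ≤ (n - r) * v - z
  h10 : r * (N * N') ≤ n * x

lemma blk (a b R p q : ℤ) (ha : 0 ≤ a) (hb : 0 ≤ b) (hp : 0 ≤ p) (hq : 0 ≤ q) (hab : a + b ≤ R) :
    (p + q) ^ 2 * (a * b) ≤ R * (q ^ 2 * a + p ^ 2 * b) := by
  have h1 : (q ^ 2 * a + p ^ 2 * b) * (a + b) - (p + q) ^ 2 * (a * b) = (q * a - p * b) ^ 2 := by ring
  have h2 : 0 ≤ q ^ 2 * a + p ^ 2 * b := by positivity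
  nlinarith [sq_nonneg (q * a - p * b), mul_le_mul_of_nonneg_left hab h2]

/-- pair count -/
lemma pairD {K : Type*} [DecidableEq K] (s : Finset K) (a b : K → ℤ) (ha : ∀ k, 0 ≤ a k) (hb : ∀ k, 0 ≤ b k)
    (hv : 1 ≤ ∑ k ∈ s, b k) :
    (∑ k ∈ s, a k) ^ 2 - ∑ k ∈ s, a k ^ 2 ≤
      2 * ((∑ k ∈ s, a k) * (∑ k ∈ s, b k) - ∑ k ∈ s, a k * b k) * ((∑ k ∈ s, a k) - 1) := by
  set u := ∑ k ∈ s, a k with hu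
  set v := ∑ k ∈ s, b k with hvd
  -- D = ∑ a_k (u - a_k)
  have hak : ∀ k ∈ s, a k ≤ u := fun k hk => Finset.single_le_sum (fun i _ => ha i) hk
  have hbk : ∀ k ∈ s, b k ≤ v := fun k hk => Finset.single_le_sum (fun i _ => hb i) hk
  have hD : u ^ 2 - ∑ k ∈ s, a k ^ 2 = ∑ k ∈ s, a k * (u - a k) := by
    simp only [mul_sub, Finset.sum_sub_distrib, ← Finset.sum_mul, ← hu]
    congr 1
    · ring
    · exact Finset.sum_congr rfl fun k _ => by ring
  have hy : u * v - ∑ k ∈ s, a k * b k = ∑ k ∈ s, a k * (v - b k) := by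
    simp only [mul_sub, Finset.sum_sub_distrib, ← Finset.sum_mul, ← hu]
  rw [hD, hy]
  set D := ∑ k ∈ s, a k * (u - a k) with hDD
  have hD0 : 0 ≤ D := Finset.sum_nonneg fun k hk => mul_nonneg (ha k) (by linarith [hak k hk])
  -- v * D ≤ 2 ∑_k a_k (v-b_k)(u - a_k)
  have key : v * D ≤ 2 * ∑ k ∈ s, a k * (v - b k) * (u - a k) := by
    -- need ∑ a_k b_k (u - a_k) *2 ≤ v D
    have : 2 * ∑ k ∈ s, a k * (u - a k) * b k ≤ v * D := by
      -- 2 a_k (u-a_k) ≤ D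
      have h2 : ∀ k ∈ s, 2 * (a k * (u - a k)) ≤ D := by
        intro k hk
        have e1 : D = a k * (u - a k) + ∑ l ∈ s.erase k, a l * (u - a l) := by
          rw [hDD, Finset.add_sum_erase s (fun l => a l * (u - a l)) hk]
        have e2 : u - a k = ∑ l ∈ s.erase k, a l := by
          rw [hu, ← Finset.add_sum_erase s a hk]; ring
        have e3 : (∑ l ∈ s.erase k, a l) * a k ≤ ∑ l ∈ s.erase k, a l * (u - a l) := by
          rw [Finset.sum_mul]
          refine Finset.sum_le_sum fun l hl => mul_le_mul_of_nonneg_left ?_ (ha l)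
          have : a l ≤ ∑ l ∈ s.erase k, a l := Finset.single_le_sum (fun i _ => ha i) hl
          linarith
        rw [← e2] at e3
        linarith
      calc 2 * ∑ k ∈ s, a k * (u - a k) * b k = ∑ k ∈ s, 2 * (a k * (u - a k)) * b k := by
            rw [Finset.mul_sum]; exact Finset.sum_congr rfl fun k _ => by ring
        _ ≤ ∑ k ∈ s, D * b k := Finset.sum_le_sum fun k hk => mul_le_mul_of_nonneg_right (h2 k hk) (hb k)
        _ = v * D := by rw [← Finset.mul_sum]; ring
    have e : ∑ k ∈ s, a k * (v - b k) * (u - a k) = v * D - ∑ k ∈ s, a k * (u - a k) * b k := by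
      rw [hDD, Finset.mul_sum, ← Finset.sum_sub_distrib]
      exact Finset.sum_congr rfl fun k _ => by ring
    linarith
  have k2 : ∑ k ∈ s, a k * (v - b k) * (u - a k) ≤ (∑ k ∈ s, a k * (v - b k)) * (u - 1) := by
    rw [Finset.sum_mul]
    refine Finset.sum_le_sum fun k hk => ?_
    rcases (ha k).eq_or_lt with h | h
    · rw [← h]; simp
    · exact mul_le_mul_of_nonneg_left (by linarith) (mul_nonneg (ha k) (by linarith [hbk k hk]))
  nlinarith

lemma cf_of {K : Type*} [Fintype K] [DecidableEq K] (n N N' : ℤ) (hN : 0 ≤ N) (hN' : 0 ≤ N')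
    (hn : 1 ≤ n) (hNN : N + N' = n)
    (a b : K → ℤ) (ha : ∀ k, 0 ≤ a k) (hb : ∀ k, 0 ≤ b k) (sa : ∑ k, a k = N) (sb : ∑ k, b k = N')
    (k0 : K) (hk0 : ∀ k, a k + b k ≤ a k0 + b k0) :
    ∃ u v z D, CF n N N' (N * N' - ∑ k, a k * b k) (n ^ 2 - ∑ k, (a k + b k) ^ 2)
      (n - (a k0 + b k0)) u v z D := by
  set s := Finset.univ.erase k0 with hs
  have ea : ∑ k ∈ s, a k = N - a k0 := by
    rw [← sa, ← Finset.add_sum_erase _ a (Finset.mem_univ k0)]; ring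
  have eb : ∑ k ∈ s, b k = N' - b k0 := by
    rw [← sb, ← Finset.add_sum_erase _ b (Finset.mem_univ k0)]; ring
  set z := ∑ k ∈ s, a k * b k with hz
  have eab : ∑ k, a k * b k = a k0 * b k0 + z := by
    rw [hz, Finset.add_sum_erase _ (fun k => a k * b k) (Finset.mem_univ k0)]
  set q := ∑ k ∈ s, (a k + b k) ^ 2 with hq
  have eq : ∑ k, (a k + b k) ^ 2 = (a k0 + b k0) ^ 2 + q := by
    rw [hq, Finset.add_sum_erase _ (fun k => (a k + b k) ^ 2) (Finset.mem_univ k0)]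
  set M := a k0 + b k0 with hM
  have hbk : ∀ k ∈ s, b k ≤ ∑ k ∈ s, b k := fun k hk => Finset.single_le_sum (fun i _ => hb i) hk
  have hak : ∀ k ∈ s, a k ≤ ∑ k ∈ s, a k := fun k hk => Finset.single_le_sum (fun i _ => ha i) hk
  have hzuv : z ≤ (∑ k ∈ s, a k) * (∑ k ∈ s, b k) := by
    rw [hz, Finset.sum_mul]
    exact Finset.sum_le_sum fun k hk => mul_le_mul_of_nonneg_left (hbk k hk) (ha k)
  have hu0 : 0 ≤ ∑ k ∈ s, a k := Finset.sum_nonneg fun k _ => ha k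
  have hv0 : 0 ≤ ∑ k ∈ s, b k := Finset.sum_nonneg fun k _ => hb k
  have hq4 : 4 * z ≤ q := by
    rw [hq, hz, Finset.mul_sum]
    exact Finset.sum_le_sum fun k _ => by nlinarith [sq_nonneg (a k - b k)]
  have hq0 : 0 ≤ q := Finset.sum_nonneg fun k _ => sq_nonneg _
  have hM1 : 1 ≤ M := by
    by_contra hcon
    have h0 : ∀ k, a k + b k ≤ 0 := fun k => by have := hk0 k; omega
    have : ∑ k, (a k + b k) ≤ 0 := Finset.sum_nonpos fun k _ => h0 k
    rw [Finset.sum_add_distrib, sa, sb] at this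
    omega
  refine ⟨∑ k ∈ s, a k, ∑ k ∈ s, b k, z, (n - M) ^ 2 - q, ?_⟩
  have hrr : n - M = ∑ k ∈ s, a k + ∑ k ∈ s, b k := by rw [ea, eb, hM, ← hNN]; ring
  refine ⟨hu0, hv0, hrr, by linarith, hzuv, ?_, ?_, ?_, ?_, ?_, ?_, ?_, ?_, ?_⟩
  · rw [eab, ea, eb]; ring
  · rw [eq]; ring
  · intro h1 h2
    have p1 := pairD s a b ha hb h2
    have p2 := pairD s b a hb ha h1
    have e3 : ∑ k ∈ s, b k * a k = z := by rw [hz]; exact Finset.sum_congr rfl fun k _ => by ring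
    have e4 : q = ∑ k ∈ s, a k ^ 2 + ∑ k ∈ s, b k ^ 2 + 2 * z := by
      rw [hq, hz, Finset.mul_sum, ← Finset.sum_add_distrib, ← Finset.sum_add_distrib]
      exact Finset.sum_congr rfl fun k _ => by ring
    rw [e3] at p2
    rw [← hz] at p1
    rw [hrr, e4]
    nlinarith
  · linarith
  · linarith
  · intro u' v' hu' hv' huv
    have hMe : n - (n - M) = M := by ring
    rw [hMe] at huv ⊢
    have : M ^ 2 * z ≤ M * (v' ^ 2 * (∑ k ∈ s, a k) + u' ^ 2 * (∑ k ∈ s, b k)) := by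
      rw [hz, Finset.mul_sum, Finset.mul_sum, Finset.mul_sum, ← Finset.sum_add_distrib, Finset.mul_sum]
      refine Finset.sum_le_sum fun k _ => ?_
      have := blk (a k) (b k) M u' v' (ha k) (hb k) hu' hv' (hk0 k)
      rwa [huv] at this
    have h3 : M * (M * z) ≤ M * (v' ^ 2 * (∑ k ∈ s, a k) + u' ^ 2 * (∑ k ∈ s, b k)) := by
      calc _ = M ^ 2 * z := by ring
        _ ≤ _ := this
    exact le_of_mul_le_mul_left h3 (by linarith)
  · have : ∑ k ∈ s, a k ≤ ∑ k ∈ s, (M * a k - a k * b k) := by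
      refine Finset.sum_le_sum fun k _ => ?_
      have h1 := hk0 k
      rcases (ha k).eq_or_lt with h | h
      · rw [← h]; simp
      · nlinarith [ha k]
    rw [Finset.sum_sub_distrib, ← Finset.mul_sum] at this
    have hMe : n - (n - M) = M := by ring
    rw [hMe]; exact this
  · have : ∑ k ∈ s, b k ≤ ∑ k ∈ s, (M * b k - a k * b k) := by
      refine Finset.sum_le_sum fun k _ => ?_
      have h1 := hk0 k
      rcases (hb k).eq_or_lt with h | h
      · rw [← h]; simp
      · nlinarith [hb k]
    rw [Finset.sum_sub_distrib, ← Finset.mul_sum] at this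
    have hMe : n - (n - M) = M := by ring
    rw [hMe]; exact this
  · have h1 : n ^ 2 * ∑ k, a k * b k ≤ M * (N' ^ 2 * N + N ^ 2 * N') := by
      rw [← sa, ← sb, Finset.mul_sum]
      conv_rhs => rw [sa, sb]
      rw [← sa, ← sb, Finset.mul_sum, Finset.mul_sum, ← Finset.sum_add_distrib, Finset.mul_sum]
      rw [sa, sb]
      refine Finset.sum_le_sum fun k _ => ?_
      have := blk (a k) (b k) M N N' (ha k) (hb k) hN hN' (hk0 k)
      rwa [hNN] at this
    have h2 : n * (n * ∑ k, a k * b k) ≤ n * (M * (N * N')) := by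
      calc n * (n * ∑ k, a k * b k) = n ^ 2 * ∑ k, a k * b k := by ring
        _ ≤ _ := h1
        _ = n * (M * (N * N')) := by rw [← hNN]; ring
    have h3 := le_of_mul_le_mul_left h2 (by linarith)
    nlinarith
end

section
lemma numA1 {I : Type*} [Fintype I] [DecidableEq I] (n : ℤ) (u v : I → ℤ) (hu : ∀ i, 0 ≤ u i) (hv : ∀ i, 0 ≤ v i)
    (hn : ∑ i, u i + ∑ i, v i = n) (hl : ∀ i, 2 * (u i + v i) < n) (j : I) (hj : ∑ i, v i < 2 * v j) :
    2 ≤ ∑ i, u i * (∑ i, v i - 2 * v i) := by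
  set U := ∑ i, u i with hU
  set V := ∑ i, v i with hV
  have h1 : ∑ i, u i * (V - 2 * v i) = u j * (V - 2 * v j) + ∑ i ∈ Finset.univ.erase j, u i * (V - 2 * v i) :=
    (Finset.add_sum_erase _ (fun i => u i * (V - 2 * v i)) (Finset.mem_univ j)).symm
  have h2 : U = u j + ∑ i ∈ Finset.univ.erase j, u i := (Finset.add_sum_erase _ u (Finset.mem_univ j)).symm
  have h3 : V = v j + ∑ i ∈ Finset.univ.erase j, v i := (Finset.add_sum_erase _ v (Finset.mem_univ j)).symm
  have h4 : (∑ i ∈ Finset.univ.erase j, u i) * (2 * v j - V) ≤ ∑ i ∈ Finset.univ.erase j, u i * (V - 2 * v i) := by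
    rw [Finset.sum_mul]
    refine Finset.sum_le_sum fun i hi => mul_le_mul_of_nonneg_left ?_ (hu i)
    have : v i ≤ ∑ i ∈ Finset.univ.erase j, v i := Finset.single_le_sum (fun i _ => hv i) hi
    linarith
  have h5 := hl j
  rw [h1]
  nlinarith

lemma numA {I : Type*} [Fintype I] [DecidableEq I] (n s : ℤ) (u v : I → ℤ) (hu : ∀ i, 0 ≤ u i) (hv : ∀ i, 0 ≤ v i)
    (hn : ∑ i, u i + ∑ i, v i = n) (hl : ∀ i, 2 * (u i + v i) < n)
    (h1 : 2 ≤ ∑ i, u i - s) (h2 : 2 ≤ ∑ i, v i + s) :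
    2 ≤ s ^ 2 + ∑ i, u i * (∑ i, v i - 2 * v i) := by
  by_cases ha : ∃ j, ∑ i, v i < 2 * v j
  · obtain ⟨j, hj⟩ := ha
    nlinarith [numA1 n u v hu hv hn hl j hj]
  have sym : ∑ i, u i * (∑ i, v i - 2 * v i) = ∑ i, v i * (∑ i, u i - 2 * u i) := by
    simp only [mul_sub, Finset.sum_sub_distrib, ← Finset.sum_mul]
    rw [mul_comm]
    congr 1
    exact Finset.sum_congr rfl fun i _ => by ring
  by_cases hb : ∃ j, ∑ i, u i < 2 * u j
  · obtain ⟨j, hj⟩ := hb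
    rw [sym]
    nlinarith [numA1 n v u hv hu (by rw [add_comm]; exact hn) (fun i => by linarith [hl i]) j hj]
  push Not at ha hb
  have nn : ∀ i, 0 ≤ u i * (∑ i, v i - 2 * v i) := fun i => mul_nonneg (hu i) (by linarith [ha i])
  have nn' : ∀ i, 0 ≤ v i * (∑ i, u i - 2 * u i) := fun i => mul_nonneg (hv i) (by linarith [hb i])
  set E0 := ∑ i, u i * (∑ i, v i - 2 * v i) with hE0
  have E00 : 0 ≤ E0 := Finset.sum_nonneg fun i _ => nn i
  have U0 : 0 ≤ ∑ i, u i := Finset.sum_nonneg fun i _ => hu i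
  have V0 : 0 ≤ ∑ i, v i := Finset.sum_nonneg fun i _ => hv i
  by_cases hU : ∑ i, u i = 0
  · nlinarith
  by_cases hV : ∑ i, v i = 0
  · nlinarith
  have hE1 : E0 ≠ 0 := by
    intro h
    have hz := (Finset.sum_eq_zero_iff_of_nonneg (fun i _ => nn i)).1 (hE0 ▸ h)
    have hz' := (Finset.sum_eq_zero_iff_of_nonneg (fun i _ => nn' i)).1 (by rw [← sym]; exact h)
    apply hV
    obtain ⟨i, -, hi⟩ := Finset.exists_ne_zero_of_sum_ne_zero hU
    have e1 : ∑ i, v i = 2 * v i := by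
      have := hz i (Finset.mem_univ i)
      rcases mul_eq_zero.1 this with h | h
      · exact absurd h hi
      · linarith
    have e2 := hl i
    have := hz' i (Finset.mem_univ i)
    rcases mul_eq_zero.1 this with h | h
    · rw [e1, h]; ring
    · linarith
  by_cases hs : s = 0
  · subst hs
    by_cases hc : ∀ i, u i = 0 ∨ 1 ≤ ∑ i, v i - 2 * v i
    · have : ∑ i, u i ≤ E0 := by
        refine Finset.sum_le_sum fun i _ => ?_
        rcases hc i with h | h
        · rw [h]; simp
        · nlinarith [hu i]
      linarith
    · push Not at hc
      obtain ⟨i, hi, hi2⟩ := hc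
      have e : ∑ i, v i = 2 * v i := by linarith [ha i]
      have : (2:ℤ) ∣ E0 := by
        refine Finset.dvd_sum fun k _ => ?_
        rw [e]
        exact ⟨u k * (v i - v k), by ring⟩
      obtain ⟨c, hc⟩ := this
      have : E0 ≠ 0 := hE1
      omega
  · have : 1 ≤ s ^ 2 := by
      have : 0 < s ^ 2 := by positivity
      linarith
    have : 1 ≤ E0 := by omega
    linarith

lemma nh1 (a b R : ℤ) (ha : 1 ≤ a) (hb : 1 ≤ b) (h : a + b = R) : R - 1 ≤ a * b := by nlinarith
lemma nh2 (t ρ R P : ℤ) (h1 : 1 ≤ ρ) (hP : 1 ≤ P) (h : ρ * P ≤ 0) : False := by nlinarith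
lemma nh3 (ρ R P : ℤ) (h3 : 3 ≤ ρ) (hR : 2 ≤ R) (hP : R - 1 ≤ P) (h : ρ * P ≤ R) : False := by nlinarith
lemma nh4 (t ρ : ℤ) (hρ : 0 ≤ ρ) (h : 0 ≤ 1 + t * (ρ - t)) : t ≤ ρ + 1 ∧ -1 ≤ t := by
  constructor <;> nlinarith
lemma nh5 (R P : ℤ) (hP : R - 1 ≤ P) (h : 2 * P ≤ R) : R ≤ 2 := by linarith

set_option maxHeartbeats 1600000 in
lemma numBs (n N N' x d r u v z D u' v' s R Y Dt : ℤ) (h : CF n N N' x d r u v z D)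
    (hN : 2 ≤ N) (hN' : 2 ≤ N') (hNN : N + N' = n)
    (hu' : 0 ≤ u') (hv' : 0 ≤ v') (hR : u' + v' = R) (hnr : n = r + R) (hρ : R ≤ r)
    (hs : u + u' = N + s) (hs' : v + v' = N' - s) (hY : 0 ≤ Y)
    (hDt : 1 ≤ u' → 1 ≤ v' → Y ≤ 1 → Dt ≤ 2 * Y * (R - 1) ∧ (r - R) ^ 2 + n ≤ D + Dt) :
    2 ≤ s ^ 2 + ((u * v - z) - (u - u') * (v - v')) + Y := by
  obtain ⟨hu, hv, hr, hrn, hz, hx, hd, h6, h7, h7', h8, h9, h9', h10⟩ := h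
  have hR1 : 1 ≤ R := by linarith
  have hnR : n - r = R := by linarith
  rw [hnR] at h8 h9 h9'
  have s0 : 0 ≤ s ^ 2 := sq_nonneg s
  have ss : s ≤ s ^ 2 := Int.le_self_sq s
  have ss' : -s ≤ s ^ 2 := by
    have := Int.le_self_sq (-s)
    rwa [neg_sq] at this
  rcases hu'.eq_or_lt with h0 | hu1
  · have : v' = R := by linarith
    subst this
    rw [← h0]
    have hu2 : u = N + s := by linarith
    have e : u * v - z - (u - 0) * (v - v') = v' * u - z := by ring
    rw [e]; linarith
  rcases hv'.eq_or_lt with h0 | hv1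
  · have : u' = R := by linarith
    subst this
    rw [← h0]
    have hu2 : v = N' - s := by linarith
    have e : u * v - z - (u - u') * (v - 0) = u' * v - z := by ring
    rw [e]; linarith
  have h8' := h8 u' v' hu' hv' hR
  -- R * X1 ≥ ρ u' v'
  set X1 := (u * v - z) - (u - u') * (v - v') with hX1
  have hRX : (r - R) * (u' * v') ≤ R * X1 := by
    have : R * X1 = R * (u * v' + u' * v - u' * v') - R * z := by rw [hX1]; ring
    rw [this, hr, ← hR]
    rw [← hR] at h8'
    linarith
  have huv1 : R - 1 ≤ u' * v' := nh1 u' v' R hu1 hv1 hR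
  have hP1 : 1 ≤ u' * v' := mul_pos hu1 hv1
  have hX0 : 0 ≤ X1 := by
    have : 0 ≤ R * X1 := le_trans (mul_nonneg (by linarith) (by linarith)) hRX
    exact (mul_nonneg_iff_of_pos_left (by linarith)).1 this
  by_contra hcon
  push Not at hcon
  have hY1 : Y ≤ 1 := by linarith
  obtain ⟨d1, d2⟩ := hDt hu1 hv1 hY1
  have hs0 : s ^ 2 ≤ 1 := by linarith
  -- X1 = 0 impossible
  have hX0' : X1 ≠ 0 := by
    intro hX
    rw [hX] at hRX
    have hρ0 : r - R = 0 := by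
      by_contra hne
      have : 1 ≤ r - R := by
        rcases lt_or_gt_of_ne hne with h | h
        · linarith
        · linarith
      exact nh2 0 _ 0 _ this hP1 (by linarith)
    have ht : v - v' = -(u - u') := by linarith
    have hy0 : u * v - z = - (u - u') ^ 2 := by
      have : X1 = (u * v - z) + (u - u') ^ 2 := by rw [hX1, ht]; ring
      linarith
    have hsq : (u - u') ^ 2 = 0 := by linarith [sq_nonneg (u - u')]
    have hz0 : u * v - z = 0 := by rw [hy0, hsq]; simp
    have hut : u = u' := by
      have := pow_eq_zero_iff (two_ne_zero) |>.1 hsq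
      linarith
    have hvt : v = v' := by linarith
    have := h6 (by linarith) (by linarith)
    rw [hz0] at this
    have hrR : r = R := by linarith
    rw [hρ0] at d2
    have : 2 * Y * (R - 1) ≤ 2 * (R - 1) := by
      have := mul_le_mul_of_nonneg_right hY1 (show 0 ≤ 2 * (R - 1) by linarith)
      linarith
    linarith
  have hX1' : X1 = 1 := by
    have : 1 ≤ X1 := by omega
    linarith
  have hY0 : Y = 0 := by linarith
  have hs00 : s = 0 := by
    have : s ^ 2 = 0 := by linarith
    exact pow_eq_zero_iff (two_ne_zero) |>.1 this
  rw [hY0] at d1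
  rw [hX1'] at hRX
  subst hs00
  simp only [mul_zero, zero_mul] at d1
  -- ρ
  obtain ⟨ρ, hρe⟩ : ∃ ρ, r = R + ρ := ⟨r - R, by ring⟩
  have hρ0 : 0 ≤ ρ := by linarith
  have e1 : r - R = ρ := by linarith
  rw [e1] at hRX d2
  obtain ⟨t, ht⟩ : ∃ t, u = u' + t := ⟨u - u', by ring⟩
  have hw : v = v' + (ρ - t) := by linarith
  obtain ⟨y, hy⟩ : ∃ y, y = u * v - z := ⟨_, rfl⟩
  rw [← hy] at h6
  have hy0 : 0 ≤ y := by linarith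
  have hyt : y = 1 + t * (ρ - t) := by
    have e : u - u' = t := by linarith
    have e' : v - v' = ρ - t := by linarith
    rw [e, e', ← hy] at hX1
    linarith
  have hρ3 : ρ ≤ 2 := by
    by_contra hc
    have hc3 : 3 ≤ ρ := by omega
    have hR2 : 2 ≤ R := by linarith
    exact nh3 ρ R _ hc3 hR2 huv1 (by linarith)
  have hcase : ρ = 0 ∨ ρ = 1 ∨ ρ = 2 := by omega
  rcases hcase with rfl | rfl | rfl
  · have ht2 : t = 0 ∨ t = 1 ∨ t = -1 := by
      have := nh4 t 0 le_rfl (by linarith)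
      omega
    rcases ht2 with rfl | rfl | rfl
    · have := h6 (by linarith) (by linarith)
      rw [hyt] at this
      linarith
    · rcases hv.eq_or_lt with h0 | h0
      · linarith
      · have := h6 (by linarith) (by linarith)
        rw [hyt] at this
        linarith
    · rcases hu.eq_or_lt with h0 | h0
      · linarith
      · have := h6 (by linarith) (by linarith)
        rw [hyt] at this
        linarith
  · have ht2 : t = 0 ∨ t = 1 := by
      have h1 := nh4 t 1 (by norm_num) (by linarith)
      have h2 : t ≠ -1 := by rintro rfl; linarith
      have h3 : t ≠ 2 := by rintro rfl; linarith
      omega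
    rcases ht2 with rfl | rfl
    · have := h6 (by linarith) (by linarith)
      rw [hyt] at this
      linarith
    · have := h6 (by linarith) (by linarith)
      rw [hyt] at this
      linarith
  · have hR2 : R = 2 := le_antisymm (nh5 R _ huv1 (by linarith)) (by linarith)
    have hu1' : u' = 1 := by linarith
    have hv1' : v' = 1 := by linarith
    have ht2 : t = 0 ∨ t = 1 ∨ t = 2 := by
      have h1 := nh4 t 2 (by norm_num) (by linarith)
      have h2 : t ≠ -1 := by rintro rfl; linarith
      have h3 : t ≠ 3 := by rintro rfl; linarith
      omega
    rcases ht2 with rfl | rfl | rfl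
    · have := h6 (by linarith) (by linarith)
      rw [hyt] at this
      linarith
    · have hz2 : z = 2 := by
        have e2 : u = 2 := by linarith
        have e3 : v = 2 := by linarith
        rw [e2, e3] at hy
        linarith
      rw [hz2, hρe, hR2] at h7
      linarith
    · have := h6 (by linarith) (by linarith)
      rw [hyt] at this
      linarith

theorem num {I : Type*} [Fintype I] [DecidableEq I] (n N N' : ℤ) (hN : 1 ≤ N) (hN' : 1 ≤ N') (hNN : N + N' = n)
    (x d r u v z D : I → ℤ) (h : ∀ i, CF n N N' (x i) (d i) (r i) (u i) (v i) (z i) (D i))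
    (hr : n ≤ ∑ i, r i) (hd : n ^ 2 + n ≤ ∑ i, d i) :
    N * N' + 1 ≤ ∑ i, x i ∧ (2 ≤ N → 2 ≤ N' → N * N' + 2 ≤ ∑ i, x i) := by
  have r0 : ∀ i, 0 ≤ r i := fun i => by rw [(h i).hr]; linarith [(h i).hu, (h i).hv]
  have h10 : (∑ i, r i) * (N * N') ≤ n * ∑ i, x i := by
    rw [Finset.sum_mul, Finset.mul_sum]
    exact Finset.sum_le_sum fun i _ => (h i).h10
  have main : 2 ≤ N → 2 ≤ N' → N * N' + 2 ≤ ∑ i, x i := by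
    intro h2 h2'
    rcases hr.eq_or_lt with heq | hlt
    · -- Σ r = n
      have hUV : ∑ i, u i + ∑ i, v i = n := by
        rw [heq, ← Finset.sum_add_distrib]
        exact Finset.sum_congr rfl fun i _ => (h i).hr.symm
      set U := ∑ i, u i with hU
      set V := ∑ i, v i with hV
      have hE : ∑ i, x i - N * N' = (U - N) ^ 2 + ∑ i, u i * (V - 2 * v i) + ∑ i, (u i * v i - z i) := by
        have : ∑ i, x i = N * V + N' * U - 2 * ∑ i, u i * v i + ∑ i, (u i * v i - z i) := by
          rw [hU, hV, Finset.mul_sum, Finset.mul_sum, Finset.mul_sum, ← Finset.sum_add_distrib, ← Finset.sum_sub_distrib,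
            ← Finset.sum_add_distrib]
          exact Finset.sum_congr rfl fun i _ => by rw [(h i).hx]; ring
        have e2 : ∑ i, u i * (V - 2 * v i) = U * V - 2 * ∑ i, u i * v i := by
          rw [hU, Finset.sum_mul, Finset.mul_sum, ← Finset.sum_sub_distrib]
          exact Finset.sum_congr rfl fun i _ => by ring
        have e3 : V = n - U := by linarith
        rw [this, e2, e3, ← hNN]
        ring
      by_cases hA : ∀ i, 2 * r i < n
      · have := numA n (U - N) u v (fun i => (h i).hu) (fun i => (h i).hv) hUV
          (fun i => by rw [← (h i).hr]; exact hA i) (by linarith) (by linarith)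
        have hy0 : 0 ≤ ∑ i, (u i * v i - z i) := Finset.sum_nonneg fun i _ => by linarith [(h i).hz]
        linarith
      · push Not at hA
        obtain ⟨j, hj⟩ := hA
        set T := Finset.univ.erase j with hT
        have sp : ∀ f : I → ℤ, ∑ i, f i = f j + ∑ i ∈ T, f i := fun f =>
          (Finset.add_sum_erase _ f (Finset.mem_univ j)).symm
        set u' := ∑ i ∈ T, u i with hu'
        set v' := ∑ i ∈ T, v i with hv'
        have hu0 : ∀ i, 0 ≤ u i := fun i => (h i).hu
        have hv0 : ∀ i, 0 ≤ v i := fun i => (h i).hv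
        have eU : U = u j + u' := sp u
        have eV : V = v j + v' := sp v
        have vle : ∀ i ∈ T, v i ≤ v' := fun i hi => Finset.single_le_sum (fun i _ => hv0 i) hi
        set cross := ∑ i ∈ T, u i * (v' - v i) with hcr
        have hcross0 : ∀ i ∈ T, 0 ≤ u i * (v' - v i) := fun i hi => mul_nonneg (hu0 i) (by linarith [vle i hi])
        have hcross : 0 ≤ cross := Finset.sum_nonneg hcross0
        have hcr2 : cross = u' * v' - ∑ i ∈ T, u i * v i := by
          rw [hcr, hu', Finset.sum_mul, ← Finset.sum_sub_distrib]
          exact Finset.sum_congr rfl fun i _ => by ring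
        set Yt := ∑ i ∈ T, (u i * v i - z i) with hYt
        have hY0 : ∀ i ∈ T, 0 ≤ u i * v i - z i := fun i _ => by linarith [(h i).hz]
        have hYt0 : 0 ≤ Yt := Finset.sum_nonneg hY0
        have e2 : ∑ i, u i * (V - 2 * v i) = -((u j - u') * (v j - v')) + 2 * cross := by
          rw [sp (fun i => u i * (V - 2 * v i))]
          have : ∑ i ∈ T, u i * (V - 2 * v i) = u' * V - 2 * ∑ i ∈ T, u i * v i := by
            rw [hu', Finset.sum_mul, Finset.mul_sum, ← Finset.sum_sub_distrib]
            exact Finset.sum_congr rfl fun i _ => by ring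
          rw [this, hcr2, eV]
          ring
        have e3 := sp (fun i => u i * v i - z i)
        have hrj := (h j).hr
        have := numBs n N N' (x j) (d j) (r j) (u j) (v j) (z j) (D j) u' v' (U - N) (u' + v') (Yt + 2 * cross)
          (∑ i ∈ T, D i) (h j) h2 h2' hNN (Finset.sum_nonneg fun i _ => hu0 i) (Finset.sum_nonneg fun i _ => hv0 i)
          rfl (by linarith) (by linarith) (by linarith) (by linarith) (by linarith) ?_
        · linarith
        · intro hu1 hv1 hYle
          have hc0 : cross = 0 := by omega
          have hz := (Finset.sum_eq_zero_iff_of_nonneg hcross0).1 hc0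
          obtain ⟨l, hlT, hl⟩ : ∃ l ∈ T, u l ≠ 0 := by
            by_contra hcon
            push Not at hcon
            have : u' = 0 := Finset.sum_eq_zero hcon
            linarith
          have hvl : v l = v' := by
            rcases mul_eq_zero.1 (hz l hlT) with h | h
            · exact absurd h hl
            · linarith
          have spl : ∀ f : I → ℤ, ∑ i ∈ T, f i = f l + ∑ i ∈ T.erase l, f i := fun f =>
            (Finset.add_sum_erase _ f hlT).symm
          have hvo : ∀ i ∈ T.erase l, v i = 0 := by
            have : ∑ i ∈ T.erase l, v i = 0 := by
              have := spl v
              linarith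
            exact (Finset.sum_eq_zero_iff_of_nonneg (fun i _ => hv0 i)).1 this
          have huo : ∀ i ∈ T.erase l, u i = 0 := by
            intro i hi
            rcases mul_eq_zero.1 (hz i (Finset.mem_of_mem_erase hi)) with h | h
            · exact h
            · rw [hvo i hi] at h; linarith
          have hul : u l = u' := by
            have := spl u
            rw [Finset.sum_eq_zero huo] at this
            linarith
          have hro : ∀ i ∈ T.erase l, r i = 0 := fun i hi => by rw [(h i).hr, huo i hi, hvo i hi]; rfl
          have hDo : ∑ i ∈ T.erase l, D i ≤ 0 := Finset.sum_nonpos fun i hi => by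
            have := (h i).h7'
            rw [hro i hi] at this
            linarith
          have hDl := (h l).h6 (by linarith) (by linarith)
          have hrl : r l = u' + v' := by rw [(h l).hr, hul, hvl]
          have hyl : u l * v l - z l ≤ Yt := Finset.single_le_sum hY0 hlT
          have hyl0 : 0 ≤ u l * v l - z l := hY0 l hlT
          have hDs := spl D
          constructor
          · rw [hrl] at hDl
            have : 2 * (u l * v l - z l) * (u' + v' - 1) ≤ 2 * Yt * (u' + v' - 1) :=
              mul_le_mul_of_nonneg_right (by linarith) (by linarith)
            rw [hc0]
            linarith
          · have hsd : ∑ i, d i = 2 * n * ∑ i, r i - 2 * ∑ i, r i ^ 2 + ∑ i, D i := by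
              rw [Finset.mul_sum, Finset.mul_sum, ← Finset.sum_sub_distrib, ← Finset.sum_add_distrib]
              exact Finset.sum_congr rfl fun i _ => (h i).hd
            have hr2 : ∑ i, r i ^ 2 = r j ^ 2 + (u' + v') ^ 2 := by
              rw [sp (fun i => r i ^ 2), spl (fun i => r i ^ 2), hrl,
                Finset.sum_eq_zero (fun i hi => by rw [hro i hi]; rfl)]
              ring
            have hDsp := sp D
            have hnj : n = r j + (u' + v') := by linarith
            rw [hsd, ← heq, hr2, hDsp] at hd
            have : 2 * n * n - 2 * (r j ^ 2 + (u' + v') ^ 2) - n ^ 2 = - (r j - (u' + v')) ^ 2 := by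
              rw [hnj]; ring
            linarith
    · -- Σ r ≥ n+1
      have hNN0 : 0 < N * N' := by positivity
      have hlt' : n + 1 ≤ ∑ i, r i := hlt
      have h11 : (n + 1) * (N * N') ≤ n * ∑ i, x i :=
        le_trans (mul_le_mul_of_nonneg_right hlt' hNN0.le) h10
      by_cases hn5 : 5 ≤ n
      · have : 2 * (n - 2) ≤ N * N' := by nlinarith
        by_contra hc
        push Not at hc
        have : ∑ i, x i ≤ N * N' + 1 := by linarith
        nlinarith
      · have hN2 : N = 2 := by omega
        have hN2' : N' = 2 := by omega
        subst hN2 hN2'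
        have hn4 : n = 4 := by linarith
        subst hn4
        have hxr : ∀ i, r i ≤ x i := fun i => by have := (h i).h10; linarith
        by_contra hc
        push Not at hc
        have hsx : ∑ i, r i ≤ ∑ i, x i := Finset.sum_le_sum fun i _ => hxr i
        have hs5 : ∑ i, r i = 5 := by linarith
        have hsx5 : ∑ i, r i = ∑ i, x i := by linarith
        have heq := (Finset.sum_eq_sum_iff_of_le (fun i _ => hxr i)).1 hsx5
        have : (2:ℤ) ∣ ∑ i, r i := by
          refine Finset.dvd_sum fun i _ => ?_
          have e := heq i (Finset.mem_univ i)
          obtain ⟨hu, hv, hr, hrn, hz, hx, hd, h6, h7, h7', h8, h9, h9', h10⟩ := h i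
          have hu3 : u i ≤ 3 := by linarith
          have hv3 : v i ≤ 3 := by linarith
          generalize u i = a at *
          generalize v i = b at *
          generalize z i = c at *
          generalize r i = rr at *
          interval_cases a <;> interval_cases b <;> omega
        omega
  refine ⟨?_, main⟩
  by_cases hc : 2 ≤ N ∧ 2 ≤ N'
  · linarith [main hc.1 hc.2]
  have hNe : N * N' = n - 1 := by
    rcases not_and_or.1 hc with h1 | h1
    · have : N = 1 := by omega
      subst this; linarith
    · have : N' = 1 := by omega
      subst this; linarith
  have hxr : ∀ i, r i ≤ x i := fun i => by
    have h1 := (h i).h10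
    have h2 := (h i).hrn
    have h3 := r0 i
    rw [hNe] at h1
    by_contra hcon
    have : x i ≤ r i - 1 := by omega
    nlinarith
  have := Finset.sum_le_sum fun i (_ : i ∈ Finset.univ) => hxr i
  rw [hNe]
  linarith
end

section
abbrev Mt (n : ℕ) := Matrix (Fin n) (Fin n) ℂ
abbrev Vc (n : ℕ) := Fin n → ℂ

def pS {n : ℕ} (F : ℕ → Submodule ℂ (Vc n)) : Submodule ℂ (Mt n) where
  carrier := {x | ∀ k, ∀ v ∈ F k, x.mulVec v ∈ F k}
  add_mem' := fun ha hb k v hv => by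
    rw [Matrix.add_mulVec]; exact (F k).add_mem (ha k v hv) (hb k v hv)
  zero_mem' := fun k v _ => by rw [Matrix.zero_mulVec]; exact (F k).zero_mem
  smul_mem' := fun c x hx k v hv => by
    rw [Matrix.smul_mulVec]; exact (F k).smul_mem c (hx k v hv)

def nS {n : ℕ} (F : ℕ → Submodule ℂ (Vc n)) : Submodule ℂ (Mt n) where
  carrier := {x | ∀ k, ∀ v ∈ F (k + 1), x.mulVec v ∈ F k}
  add_mem' := fun ha hb k v hv => by
    rw [Matrix.add_mulVec]; exact (F k).add_mem (ha k v hv) (hb k v hv)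
  zero_mem' := fun k v _ => by rw [Matrix.zero_mulVec]; exact (F k).zero_mem
  smul_mem' := fun c x hx k v hv => by
    rw [Matrix.smul_mulVec]; exact (F k).smul_mem c (hx k v hv)

lemma mem_pS {n : ℕ} {F : ℕ → Submodule ℂ (Vc n)} {x : Mt n} :
    x ∈ pS F ↔ ∀ k, ∀ v ∈ F k, x.mulVec v ∈ F k := Iff.rfl
lemma mem_nS {n : ℕ} {F : ℕ → Submodule ℂ (Vc n)} {x : Mt n} :
    x ∈ nS F ↔ ∀ k, ∀ v ∈ F (k + 1), x.mulVec v ∈ F k := Iff.rfl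

structure IsFlag {n : ℕ} (F : ℕ → Submodule ℂ (Vc n)) : Prop where
  mono : Monotone F
  bot : F 0 = ⊥
  top : F n = ⊤

def gF {n : ℕ} (g : Mt n) (F : ℕ → Submodule ℂ (Vc n)) (k : ℕ) : Submodule ℂ (Vc n) :=
  (F k).map g.mulVecLin

lemma nS_le_pS {n : ℕ} {F : ℕ → Submodule ℂ (Vc n)} (hF : IsFlag F) {x : Mt n} (hx : x ∈ nS F) : x ∈ pS F :=
  fun k v hv => hx k v (hF.mono k.le_succ hv)

lemma pS_mul {n : ℕ} {F : ℕ → Submodule ℂ (Vc n)} {x y : Mt n} (hx : x ∈ pS F) (hy : y ∈ pS F) : x * y ∈ pS F :=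
  fun k v hv => by rw [← Matrix.mulVec_mulVec]; exact hx k _ (hy k v hv)

lemma pS_one {n : ℕ} {F : ℕ → Submodule ℂ (Vc n)} : (1 : Mt n) ∈ pS F :=
  fun k v hv => by rwa [Matrix.one_mulVec]

lemma pS_nS_mul {n : ℕ} {F : ℕ → Submodule ℂ (Vc n)} {x y : Mt n} (hx : x ∈ pS F) (hy : y ∈ nS F) : x * y ∈ nS F :=
  fun k v hv => by rw [← Matrix.mulVec_mulVec]; exact hx k _ (hy k v hv)

lemma nS_pS_mul {n : ℕ} {F : ℕ → Submodule ℂ (Vc n)} {x y : Mt n} (hx : x ∈ nS F) (hy : y ∈ pS F) : x * y ∈ nS F :=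
  fun k v hv => by rw [← Matrix.mulVec_mulVec]; exact hx k _ (hy _ v hv)

lemma nS_pow {n : ℕ} {F : ℕ → Submodule ℂ (Vc n)} {x : Mt n} (hx : x ∈ nS F) (m k : ℕ) (v : Vc n)
    (hv : v ∈ F (k + m)) : (x ^ m).mulVec v ∈ F k := by
  induction m generalizing v with
  | zero => simpa using hv
  | succ m ih =>
    rw [pow_succ, ← Matrix.mulVec_mulVec]
    exact ih _ (hx _ _ hv)

lemma nS_nilp {n : ℕ} {F : ℕ → Submodule ℂ (Vc n)} (hF : IsFlag F) {x : Mt n} (hx : x ∈ nS F) : IsNilpotent x := by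
  refine ⟨n, ?_⟩
  ext1 i j
  have h : (x ^ n).mulVec (Pi.single j 1) ∈ F 0 :=
    nS_pow hx n 0 _ (by rw [zero_add, hF.top]; trivial)
  rw [hF.bot, Submodule.mem_bot, Matrix.mulVec_single_one] at h
  exact congrFun h i

lemma nilp_trace {n : ℕ} {x : Mt n} (hx : IsNilpotent x) : x.trace = 0 :=
  (Matrix.isNilpotent_trace_of_isNilpotent hx).eq_zero

lemma tr_pn {n : ℕ} {F : ℕ → Submodule ℂ (Vc n)} (hF : IsFlag F) {x y : Mt n} (hx : x ∈ pS F) (hy : y ∈ nS F) :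
    (x * y).trace = 0 := nilp_trace (nS_nilp hF (pS_nS_mul hx hy))

/-- every functional is a trace -/
lemma exists_tr {n : ℕ} (f : Mt n →ₗ[ℂ] ℂ) : ∃ θ : Mt n, ∀ x, f x = (θ * x).trace := by
  refine ⟨Matrix.of fun i j => f (Matrix.single j i 1), fun x => ?_⟩
  conv_lhs => rw [Matrix.matrix_eq_sum_single x]
  simp only [map_sum, Matrix.trace, Matrix.diag, Matrix.mul_apply, Matrix.of_apply]
  rw [Finset.sum_comm]
  refine Finset.sum_congr rfl fun i _ => Finset.sum_congr rfl fun j _ => ?_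
  have : Matrix.single j i (x j i) = x j i • Matrix.single j i (1:ℂ) := by
    rw [Matrix.smul_single]; simp
  rw [this, map_smul, smul_eq_mul, mul_comm]

lemma tr_nondeg {n : ℕ} {θ : Mt n} (h : ∀ x, (θ * x).trace = 0) : θ = 0 := by
  ext1 i j
  have := h (Matrix.single j i 1)
  rw [Matrix.trace_mul_comm, Matrix.trace_single_mul] at this
  simpa using this

/-- duality for subspaces of a vector space: containing vector. -/
lemma mem_of_dual {E : Type*} [AddCommGroup E] [Module ℂ E] (U : Submodule ℂ E) (x : E)
    (h : ∀ f : E →ₗ[ℂ] ℂ, (∀ u ∈ U, f u = 0) → f x = 0) : x ∈ U := by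
  by_contra hx
  obtain ⟨f, hf, hU⟩ := Submodule.exists_le_ker_of_notMem hx
  exact hf (h f fun u hu => hU hu)

lemma mem_of_tr {n : ℕ} (U : Submodule ℂ (Mt n)) (x : Mt n)
    (h : ∀ θ : Mt n, (∀ u ∈ U, (θ * u).trace = 0) → (θ * x).trace = 0) : x ∈ U := by
  refine mem_of_dual U x fun f hf => ?_
  obtain ⟨θ, hθ⟩ := exists_tr f
  rw [hθ]
  exact h θ fun u hu => by rw [← hθ]; exact hf u hu

lemma exists_dot {n : ℕ} (f : Vc n →ₗ[ℂ] ℂ) : ∃ φ : Vc n, ∀ v, f v = φ ⬝ᵥ v := by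
  refine ⟨fun i => f (Pi.single i 1), fun v => ?_⟩
  conv_lhs => rw [← Finset.univ_sum_single v]
  rw [map_sum, dotProduct]
  refine Finset.sum_congr rfl fun i _ => ?_
  have : (Pi.single i (v i) : Vc n) = v i • Pi.single i 1 := by
    rw [← Pi.single_smul]; simp
  rw [this, map_smul, smul_eq_mul, mul_comm]

/-- the annihilator of the nilradical lies in the parabolic -/
lemma pS_of_tr {n : ℕ} {F : ℕ → Submodule ℂ (Vc n)} (hF : IsFlag F) {θ : Mt n}
    (h : ∀ y ∈ nS F, (θ * y).trace = 0) : θ ∈ pS F := by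
  intro k v hv
  refine mem_of_dual _ _ fun f hf => ?_
  obtain ⟨φ, hφ⟩ := exists_dot f
  have h1 : Matrix.vecMulVec v φ ∈ nS F := by
    intro j w hw
    rw [Matrix.vecMulVec_mulVec]
    rcases le_or_gt (j + 1) k with hj | hj
    · have : φ ⬝ᵥ w = 0 := by rw [← hφ]; exact hf w (hF.mono hj hw)
      rw [this]; simp
    · have := (F j).smul_mem (φ ⬝ᵥ w) (hF.mono (by omega : k ≤ j) hv)
      convert this using 1
      ext i; simp [mul_comm]
  have h2 := h _ h1
  rw [Matrix.mul_vecMulVec, Matrix.trace_vecMulVec] at h2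
  rw [hφ, dotProduct_comm]; exact h2

lemma gF_flag {n : ℕ} {g : Mt n} (hg : IsUnit g) {F : ℕ → Submodule ℂ (Vc n)} (hF : IsFlag F) : IsFlag (gF g F) := by
  refine ⟨fun a b h => Submodule.map_mono (hF.mono h), ?_, ?_⟩
  · simp [gF, hF.bot]
  · have : Function.Surjective g.mulVecLin := Matrix.mulVec_surjective_iff_isUnit.2 hg
    simp only [gF, hF.top, Submodule.map_top]
    exact LinearMap.range_eq_top.2 this

lemma mem_gF {n : ℕ} {g : Mt n} (hg : IsUnit g) {F : ℕ → Submodule ℂ (Vc n)} {k : ℕ} {v : Vc n} :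
    v ∈ gF g F k ↔ (g⁻¹).mulVec v ∈ F k := by
  have hd := (Matrix.isUnit_iff_isUnit_det g).1 hg
  constructor
  · rintro ⟨w, hw, rfl⟩
    rw [Matrix.mulVecLin_apply, Matrix.mulVec_mulVec, Matrix.nonsing_inv_mul g hd, Matrix.one_mulVec]
    exact hw
  · intro h
    exact ⟨_, h, by rw [Matrix.mulVecLin_apply, Matrix.mulVec_mulVec, Matrix.mul_nonsing_inv g hd, Matrix.one_mulVec]⟩

lemma gF_nS {n : ℕ} {g : Mt n} (hg : IsUnit g) {F : ℕ → Submodule ℂ (Vc n)} {x : Mt n} :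
    x ∈ nS (gF g F) ↔ g⁻¹ * x * g ∈ nS F := by
  have hd := (Matrix.isUnit_iff_isUnit_det g).1 hg
  constructor
  · intro h k v hv
    have := h k (g.mulVec v) ⟨v, hv, rfl⟩
    rw [mem_gF hg] at this
    simpa [Matrix.mulVec_mulVec, mul_assoc] using this
  · rintro h k _ ⟨v, hv, rfl⟩
    rw [mem_gF hg]
    simpa [Matrix.mulVec_mulVec, mul_assoc] using h k v hv

lemma gF_pS {n : ℕ} {g : Mt n} (hg : IsUnit g) {F : ℕ → Submodule ℂ (Vc n)} {x : Mt n} :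
    x ∈ pS (gF g F) ↔ g⁻¹ * x * g ∈ pS F := by
  have hd := (Matrix.isUnit_iff_isUnit_det g).1 hg
  constructor
  · intro h k v hv
    have := h k (g.mulVec v) ⟨v, hv, rfl⟩
    rw [mem_gF hg] at this
    simpa [Matrix.mulVec_mulVec, mul_assoc] using this
  · rintro h k _ ⟨v, hv, rfl⟩
    rw [mem_gF hg]
    simpa [Matrix.mulVec_mulVec, mul_assoc] using h k v hv

lemma gF_fin {n : ℕ} {g : Mt n} (hg : IsUnit g) (F : ℕ → Submodule ℂ (Vc n)) (k : ℕ) :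
    Module.finrank ℂ (gF g F k) = Module.finrank ℂ (F k) := by
  have hi : Function.Injective g.mulVecLin := Matrix.mulVec_injective_iff_isUnit.2 hg
  exact (Submodule.equivMapOfInjective g.mulVecLin hi (F k)).symm.finrank_eq

lemma gF_mul {n : ℕ} (g h : Mt n) (F : ℕ → Submodule ℂ (Vc n)) : gF (g * h) F = gF g (gF h F) := by
  funext k
  simp only [gF, Matrix.mulVecLin_mul, Submodule.map_comp]
end

section
open Module
def kS {n : ℕ} (G T : Submodule ℂ (Vc n)) : Submodule ℂ (Mt n) where
  carrier := {x | ∀ v ∈ G, x.mulVec v ∈ T}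
  add_mem' := fun ha hb v hv => by
    rw [Matrix.add_mulVec]; exact T.add_mem (ha v hv) (hb v hv)
  zero_mem' := fun v _ => by rw [Matrix.zero_mulVec]; exact T.zero_mem
  smul_mem' := fun c x hx v hv => by
    rw [Matrix.smul_mulVec]; exact T.smul_mem c (hx v hv)

lemma hom_bound {n : ℕ} (P : Submodule ℂ (Mt n)) (G T T' : Submodule ℂ (Vc n)) (hT : T' ≤ T)
    (h : ∀ x ∈ P, ∀ v ∈ G, x.mulVec v ∈ T) :
    finrank ℂ P + finrank ℂ G * finrank ℂ T' ≤ finrank ℂ (P ⊓ kS G T' : Submodule ℂ (Mt n)) + finrank ℂ G * finrank ℂ T := by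
  let Ψ : P →ₗ[ℂ] (G →ₗ[ℂ] (T ⧸ T'.submoduleOf T)) :=
    { toFun := fun x => (T'.submoduleOf T).mkQ ∘ₗ
        LinearMap.codRestrict T (x.1.mulVecLin ∘ₗ G.subtype) (fun v => h x.1 x.2 v.1 v.2)
      map_add' := fun x y => by
        refine LinearMap.ext fun v => ?_
        refine Eq.trans ?_ ((T'.submoduleOf T).mkQ.map_add _ _)
        refine congrArg (T'.submoduleOf T).mkQ ?_
        exact Subtype.ext (Matrix.add_mulVec x.1 y.1 v.1)
      map_smul' := fun c x => by
        refine LinearMap.ext fun v => ?_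
        refine Eq.trans ?_ ((T'.submoduleOf T).mkQ.map_smul _ _)
        refine congrArg (T'.submoduleOf T).mkQ ?_
        exact Subtype.ext (Matrix.smul_mulVec c x.1 v.1) }
  have h1 := LinearMap.finrank_range_add_finrank_ker Ψ
  have h2 : finrank ℂ (LinearMap.range Ψ) ≤ finrank ℂ G * finrank ℂ (T ⧸ T'.submoduleOf T) := by
    rw [← Module.finrank_linearMap]
    exact Submodule.finrank_le _
  have h3 := Submodule.finrank_quotient_add_finrank (T'.submoduleOf T)
  have h4 : finrank ℂ (T'.submoduleOf T) = finrank ℂ T' := (Submodule.submoduleOfEquivOfLe hT).finrank_eq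
  have h5 : finrank ℂ (LinearMap.ker Ψ) ≤ finrank ℂ (P ⊓ kS G T' : Submodule ℂ (Mt n)) := by
    rw [← Submodule.finrank_map_subtype_eq P (LinearMap.ker Ψ)]
    apply Submodule.finrank_mono
    rintro _ ⟨x, hx, rfl⟩
    refine ⟨x.2, fun v hv => ?_⟩
    have := LinearMap.congr_fun (LinearMap.mem_ker.1 hx) ⟨v, hv⟩
    simp only [Ψ, LinearMap.coe_mk, AddHom.coe_mk, LinearMap.comp_apply, LinearMap.zero_apply, Submodule.mkQ_apply,
      Submodule.Quotient.mk_eq_zero] at this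
    exact this
  rw [h4] at h3
  nlinarith

def kkS {n : ℕ} (P : Submodule ℂ (Mt n)) (G T : ℕ → Submodule ℂ (Vc n)) : ℕ → Submodule ℂ (Mt n)
  | 0 => P
  | (m+1) => kkS P G T m ⊓ kS (G m) (T m)

lemma kkS_le {n : ℕ} (P : Submodule ℂ (Mt n)) (G T : ℕ → Submodule ℂ (Vc n)) (m : ℕ) : kkS P G T m ≤ P := by
  induction m with
  | zero => exact le_rfl
  | succ m ih => exact inf_le_left.trans ih

lemma kkS_mem {n : ℕ} (P : Submodule ℂ (Mt n)) (G T : ℕ → Submodule ℂ (Vc n)) (m : ℕ) {x : Mt n} (hx : x ∈ kkS P G T m) :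
    ∀ k < m, ∀ v ∈ G k, x.mulVec v ∈ T k := by
  induction m with
  | zero => intro k hk; omega
  | succ m ih =>
    intro k hk
    rcases Nat.lt_succ_iff_lt_or_eq.1 hk with h | rfl
    · exact ih hx.1 k h
    · exact hx.2

lemma seq_bound {n : ℕ} (P : Submodule ℂ (Mt n)) (G T T' : ℕ → Submodule ℂ (Vc n)) (hT : ∀ k, T' k ≤ T k)
    (h : ∀ x ∈ P, ∀ k, ∀ v ∈ G k, x.mulVec v ∈ T k) (m : ℕ) :
    (finrank ℂ P : ℤ) ≤ finrank ℂ (kkS P G T' m) +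
      ∑ k ∈ Finset.range m, (finrank ℂ (G k) : ℤ) * ((finrank ℂ (T k) : ℤ) - finrank ℂ (T' k)) := by
  induction m with
  | zero => rw [Finset.sum_range_zero, add_zero]; exact le_rfl
  | succ m ih =>
    rw [Finset.sum_range_succ]
    have := hom_bound (kkS P G T' m) (G m) (T m) (T' m) (hT m)
      (fun x hx v hv => h x (kkS_le P G T' m hx) m v hv)
    have e : kkS P G T' (m+1) = kkS P G T' m ⊓ kS (G m) (T' m) := rfl
    rw [e]
    zify at this
    linarith

lemma rel_compl {n : ℕ} (A F : Submodule ℂ (Vc n)) (h : A ≤ F) :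
    ∃ G : Submodule ℂ (Vc n), G ≤ F ∧ A ⊔ G = F ∧ (finrank ℂ G : ℤ) = finrank ℂ F - finrank ℂ A := by
  obtain ⟨C, hC⟩ := Submodule.exists_isCompl A
  have h1 : A ⊔ C ⊓ F = F := by
    rw [← sup_inf_assoc_of_le C h, hC.sup_eq_top, top_inf_eq]
  refine ⟨C ⊓ F, inf_le_right, h1, ?_⟩
  have h2 := Submodule.finrank_sup_add_finrank_inf_eq A (C ⊓ F)
  have h3 : A ⊓ (C ⊓ F) = ⊥ := by rw [← inf_assoc, hC.inf_eq_bot, bot_inf_eq]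
  rw [h1, h3, finrank_bot] at h2
  omega

noncomputable def mF {n : ℕ} (F : ℕ → Submodule ℂ (Vc n)) (k : ℕ) : ℤ := (finrank ℂ (F (k+1)) : ℤ) - finrank ℂ (F k)
noncomputable def aW {n : ℕ} (W : Submodule ℂ (Vc n)) (F : ℕ → Submodule ℂ (Vc n)) (k : ℕ) : ℤ :=
  (finrank ℂ (W ⊓ F (k+1) : Submodule ℂ (Vc n)) : ℤ) - finrank ℂ (W ⊓ F k : Submodule ℂ (Vc n))

lemma fin_aux {n : ℕ} (W : Submodule ℂ (Vc n)) {F : ℕ → Submodule ℂ (Vc n)} (hF : IsFlag F) (k : ℕ) :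
    (finrank ℂ (F k ⊔ W ⊓ F (k+1) : Submodule ℂ (Vc n)) : ℤ) = finrank ℂ (F k) + aW W F k := by
  have h2 := Submodule.finrank_sup_add_finrank_inf_eq (F k) (W ⊓ F (k+1))
  have h3 : F k ⊓ (W ⊓ F (k+1)) = W ⊓ F k := by
    rw [inf_left_comm, inf_eq_left.2 (hF.mono k.le_succ)]
  rw [h3] at h2
  unfold aW
  omega

lemma aW_nonneg {n : ℕ} (W : Submodule ℂ (Vc n)) {F : ℕ → Submodule ℂ (Vc n)} (hF : IsFlag F) (k : ℕ) : 0 ≤ aW W F k := by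
  have : finrank ℂ (W ⊓ F k : Submodule ℂ (Vc n)) ≤ finrank ℂ (W ⊓ F (k+1) : Submodule ℂ (Vc n)) :=
    Submodule.finrank_mono (inf_le_inf_left W (hF.mono k.le_succ))
  unfold aW; omega

lemma aW_le {n : ℕ} (W : Submodule ℂ (Vc n)) {F : ℕ → Submodule ℂ (Vc n)} (hF : IsFlag F) (k : ℕ) : aW W F k ≤ mF F k := by
  have h1 := fin_aux W hF k
  have h2 := Submodule.finrank_mono (sup_le (hF.mono k.le_succ) inf_le_right : F k ⊔ W ⊓ F (k+1) ≤ F (k+1))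
  unfold mF; omega

lemma mF_nonneg {n : ℕ} {F : ℕ → Submodule ℂ (Vc n)} (hF : IsFlag F) (k : ℕ) : 0 ≤ mF F k :=
  (aW_nonneg ⊤ hF k).trans (aW_le ⊤ hF k)

lemma aW_sum {n : ℕ} (W : Submodule ℂ (Vc n)) {F : ℕ → Submodule ℂ (Vc n)} (hF : IsFlag F) :
    ∑ k ∈ Finset.range n, aW W F k = finrank ℂ W := by
  unfold aW
  rw [Finset.sum_range_sub (fun k => (finrank ℂ (W ⊓ F k : Submodule ℂ (Vc n)) : ℤ))]
  rw [hF.bot, hF.top, inf_top_eq, inf_bot_eq, finrank_bot]; simp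

lemma mF_sum {n : ℕ} {F : ℕ → Submodule ℂ (Vc n)} (hF : IsFlag F) :
    ∑ k ∈ Finset.range n, mF F k = n := by
  unfold mF
  rw [Finset.sum_range_sub (fun k => (finrank ℂ (F k) : ℤ))]
  rw [hF.bot, hF.top, finrank_top, finrank_bot]; simp

def HS {n : ℕ} (e : Mt n) : Submodule ℂ (Mt n) where
  carrier := {x | e * x = x ∧ x * e = 0}
  add_mem' := fun {a b} ha hb => by
    refine ⟨?_, ?_⟩
    · rw [mul_add, ha.1, hb.1]
    · rw [add_mul, ha.2, hb.2, add_zero]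
  zero_mem' := by simp
  smul_mem' := fun c x hx => by
    refine ⟨?_, ?_⟩
    · rw [mul_smul_comm, hx.1]
    · rw [smul_mul_assoc, hx.2, smul_zero]

lemma mem_HS {n : ℕ} {e x : Mt n} : x ∈ HS e ↔ e * x = x ∧ x * e = 0 := Iff.rfl

lemma range_idem {n : ℕ} {e : Mt n} (he : e * e = e) {v : Vc n} (hv : v ∈ LinearMap.range e.mulVecLin) : e.mulVec v = v := by
  obtain ⟨w, rfl⟩ := hv
  rw [Matrix.mulVecLin_apply, Matrix.mulVec_mulVec, he]

lemma HS_mulVec_mem {n : ℕ} {e x : Mt n} (hx : x ∈ HS e) (v : Vc n) : x.mulVec v ∈ LinearMap.range e.mulVecLin :=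
  ⟨x.mulVec v, by rw [Matrix.mulVecLin_apply, Matrix.mulVec_mulVec, hx.1]⟩

lemma HS_kill {n : ℕ} {e x : Mt n} (hx : x ∈ HS e) {v : Vc n} (hv : v ∈ LinearMap.range e.mulVecLin) : x.mulVec v = 0 := by
  obtain ⟨w, rfl⟩ := hv
  rw [Matrix.mulVecLin_apply, Matrix.mulVec_mulVec, hx.2, Matrix.zero_mulVec]

lemma D1 {n : ℕ} (e : Mt n) {F : ℕ → Submodule ℂ (Vc n)} (hF : IsFlag F) :
    (finrank ℂ (HS e ⊓ pS F : Submodule ℂ (Mt n)) : ℤ) ≤ finrank ℂ (HS e ⊓ nS F : Submodule ℂ (Mt n)) +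
      ∑ k ∈ Finset.range n, aW (LinearMap.range e.mulVecLin) F k * (mF F k - aW (LinearMap.range e.mulVecLin) F k) := by
  set W := LinearMap.range e.mulVecLin with hW
  choose G hG1 hG2 hG3 using fun k => rel_compl (F k ⊔ W ⊓ F (k+1)) (F (k+1)) (sup_le (hF.mono k.le_succ) inf_le_right)
  have h1 := seq_bound (HS e ⊓ pS F) G (fun k => W ⊓ F (k+1)) (fun k => W ⊓ F k)
    (fun k => inf_le_inf_left W (hF.mono k.le_succ))
    (fun x hx k v hv => ⟨HS_mulVec_mem hx.1 v, hx.2 (k+1) v (hG1 k hv)⟩) n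
  have h2 : kkS (HS e ⊓ pS F) G (fun k => W ⊓ F k) n ≤ HS e ⊓ nS F := by
    intro x hx
    have hx1 := kkS_le _ _ _ _ hx
    refine ⟨hx1.1, fun k v hv => ?_⟩
    rcases le_or_gt n k with hk | hk
    · have : F k = ⊤ := top_le_iff.1 (hF.top ▸ hF.mono hk)
      rw [this]; trivial
    · rw [← hG2 k] at hv
      obtain ⟨y, hy, g, hg, rfl⟩ := Submodule.mem_sup.1 hv
      obtain ⟨f, hf, w, hw, rfl⟩ := Submodule.mem_sup.1 hy
      rw [Matrix.mulVec_add, Matrix.mulVec_add, HS_kill hx1.1 hw.1, add_zero]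
      exact (F k).add_mem (hx1.2 k f hf) (kkS_mem _ _ _ _ hx k hk g hg).2
  have h3 := Submodule.finrank_mono h2
  refine h1.trans ?_
  refine add_le_add (by exact_mod_cast h3) (le_of_eq (Finset.sum_congr rfl fun k _ => ?_))
  rw [hG3, fin_aux W hF k]
  unfold mF
  change _ * aW W F k = _
  ring

lemma nS_fin {n : ℕ} {F : ℕ → Submodule ℂ (Vc n)} (hF : IsFlag F) :
    (finrank ℂ (nS F) : ℤ) ≤ ∑ k ∈ Finset.range n, mF F k * finrank ℂ (F k) := by
  choose G hG1 hG2 hG3 using fun k => rel_compl (F k) (F (k+1)) (hF.mono k.le_succ)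
  have h1 := seq_bound (nS F) G F (fun k => ⊥) (fun k => bot_le)
    (fun x hx k v hv => hx k v (hG1 k hv)) n
  have h2 : kkS (nS F) G (fun k => ⊥) n = ⊥ := by
    rw [eq_bot_iff]
    intro x hx
    have hk := kkS_mem _ _ _ _ hx
    have : ∀ m ≤ n, ∀ v ∈ F m, x.mulVec v = 0 := by
      intro m
      induction m with
      | zero => intro _ v hv; rw [hF.bot, Submodule.mem_bot] at hv; rw [hv, Matrix.mulVec_zero]
      | succ m ih =>
        intro hm v hv
        rw [← hG2 m] at hv
        obtain ⟨f, hf, g, hg, rfl⟩ := Submodule.mem_sup.1 hv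
        rw [Matrix.mulVec_add, ih (by omega) f hf, (hk m (by omega) g hg : _ ∈ (⊥ : Submodule ℂ (Vc n))), add_zero]
    rw [Submodule.mem_bot]
    ext1 i j
    have := this n le_rfl (Pi.single j 1) (by rw [hF.top]; trivial)
    rw [Matrix.mulVec_single_one] at this
    exact congrFun this i
  rw [h2, finrank_bot] at h1
  refine h1.trans (le_of_eq ?_)
  rw [Nat.cast_zero, zero_add]
  refine Finset.sum_congr rfl fun k _ => ?_
  rw [hG3, finrank_bot]; unfold mF; simp

def trD {n : ℕ} (U : Submodule ℂ (Mt n)) : Mt n →ₗ[ℂ] (U →ₗ[ℂ] ℂ) where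
  toFun x := (Matrix.traceLinearMap (Fin n) ℂ ℂ) ∘ₗ (LinearMap.mulLeft ℂ x) ∘ₗ U.subtype
  map_add' x y := by ext u; simp [add_mul, Matrix.trace_add]
  map_smul' c x := by ext u; simp [Matrix.trace_smul]

lemma trD_apply {n : ℕ} (U : Submodule ℂ (Mt n)) (x : Mt n) (u : U) : trD U x u = (x * u.1).trace := rfl

lemma pS_fin {n : ℕ} {F : ℕ → Submodule ℂ (Vc n)} (hF : IsFlag F) :
    n ^ 2 ≤ finrank ℂ (nS F) + finrank ℂ (pS F) := by
  have h1 := LinearMap.finrank_range_add_finrank_ker (trD (nS F))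
  have h2 : finrank ℂ (LinearMap.range (trD (nS F))) ≤ finrank ℂ (nS F) := by
    refine (Submodule.finrank_le _).trans ?_
    rw [Module.finrank_linearMap, Module.finrank_self, mul_one]
  have h3 : LinearMap.ker (trD (nS F)) ≤ pS F := by
    intro x hx
    refine pS_of_tr hF fun y hy => ?_
    exact LinearMap.congr_fun (LinearMap.mem_ker.1 hx) ⟨y, hy⟩
  have h4 := Submodule.finrank_mono h3
  have h5 : finrank ℂ (Mt n) = n ^ 2 := by
    rw [Module.finrank_matrix]; simp [sq]
  rw [h5] at h1
  omega

lemma comm_nS {n : ℕ} {F : ℕ → Submodule ℂ (Vc n)} (ξ : ℕ → ℂ) {B : Mt n}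
    (hB : ∀ k, ∀ v ∈ F (k+1), B.mulVec v - ξ k • v ∈ F k) {x : Mt n} (hx : x ∈ pS F) : x * B - B * x ∈ nS F := by
  intro k v hv
  have e : (x * B - B * x).mulVec v = x.mulVec (B.mulVec v - ξ k • v) - (B.mulVec (x.mulVec v) - ξ k • x.mulVec v) := by
    rw [Matrix.sub_mulVec, ← Matrix.mulVec_mulVec, ← Matrix.mulVec_mulVec, Matrix.mulVec_sub, Matrix.mulVec_smul]
    abel
  rw [e]
  exact (F k).sub_mem (hx k _ (hB k v hv)) (hB k _ (hx (k+1) v hv))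

lemma cent_fin {n : ℕ} {F : ℕ → Submodule ℂ (Vc n)} (hF : IsFlag F) (ξ : ℕ → ℂ) (B : Mt n)
    (hB : ∀ k, ∀ v ∈ F (k+1), B.mulVec v - ξ k • v ∈ F k) (Z : Submodule ℂ (Mt n)) (hZ : ∀ x, B * x = x * B → x ∈ Z) :
    ∑ k ∈ Finset.range n, mF F k ^ 2 ≤ (finrank ℂ Z : ℤ) := by
  have h1 := nS_fin hF
  have h2 := pS_fin hF
  let Ψ : pS F →ₗ[ℂ] nS F := LinearMap.codRestrict (nS F)
    ((LinearMap.mulRight ℂ B - LinearMap.mulLeft ℂ B) ∘ₗ (pS F).subtype) (fun x => comm_nS ξ hB x.2)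
  have h3 := LinearMap.finrank_range_add_finrank_ker Ψ
  have h4 := Submodule.finrank_le (LinearMap.range Ψ)
  have h5 : finrank ℂ (LinearMap.ker Ψ) ≤ finrank ℂ Z := by
    rw [← Submodule.finrank_map_subtype_eq (pS F) (LinearMap.ker Ψ)]
    apply Submodule.finrank_mono
    rintro _ ⟨x, hx, rfl⟩
    apply hZ
    have : x.1 * B - B * x.1 = 0 := congrArg Subtype.val (LinearMap.mem_ker.1 hx)
    exact (sub_eq_zero.1 this).symm
  have h6 : (n:ℤ) ^ 2 = ∑ k ∈ Finset.range n, mF F k ^ 2 + 2 * ∑ k ∈ Finset.range n, mF F k * finrank ℂ (F k) := by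
    have : ∀ k, (finrank ℂ (F (k+1)) : ℤ) ^ 2 - (finrank ℂ (F k) : ℤ) ^ 2 = mF F k ^ 2 + 2 * (mF F k * finrank ℂ (F k)) := by
      intro k; unfold mF; ring
    rw [Finset.mul_sum, ← Finset.sum_add_distrib, ← Finset.sum_congr rfl (fun k _ => this k),
      Finset.sum_range_sub (fun k => (finrank ℂ (F k) : ℤ) ^ 2)]
    rw [hF.bot, hF.top, finrank_top, finrank_bot]; simp
  zify at h2 h3 h4 h5
  linarith

lemma HS_fin {n : ℕ} {e : Mt n} (he : e * e = e) : finrank ℂ (HS e) = e.rank * (n - e.rank) := by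
  set W := LinearMap.range e.mulVecLin with hW
  set K := LinearMap.ker e.mulVecLin with hK
  have h2 : finrank ℂ W = e.rank := rfl
  have h1 : finrank ℂ K = n - e.rank := by
    have h3 : finrank ℂ W + finrank ℂ K = finrank ℂ (Vc n) := LinearMap.finrank_range_add_finrank_ker e.mulVecLin
    rw [Module.finrank_fin_fun, h2] at h3
    omega
  rw [← h1, ← h2, mul_comm, ← Module.finrank_linearMap]
  have hproj : ∀ v : Vc n, ((LinearMap.id : Vc n →ₗ[ℂ] Vc n) - e.mulVecLin) v ∈ K := by
    intro v
    rw [hK, LinearMap.mem_ker, LinearMap.sub_apply, Matrix.mulVecLin_apply, Matrix.mulVecLin_apply, LinearMap.id_apply,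
      Matrix.mulVec_sub, Matrix.mulVec_mulVec, he, sub_self]
  let π : Vc n →ₗ[ℂ] K := LinearMap.codRestrict K ((LinearMap.id : Vc n →ₗ[ℂ] Vc n) - e.mulVecLin) hproj
  have hπ : ∀ v : Vc n, (π v : Vc n) = v - e.mulVec v := fun v => rfl
  have hπK : ∀ v : K, π v = v := by
    intro v
    ext1
    rw [hπ]
    have : e.mulVec v.1 = 0 := LinearMap.mem_ker.1 v.2
    rw [this, sub_zero]
  let Φ : (K →ₗ[ℂ] W) →ₗ[ℂ] (Vc n →ₗ[ℂ] Vc n) :=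
    { toFun := fun f => W.subtype ∘ₗ f ∘ₗ π
      map_add' := fun f g => by ext1; rfl
      map_smul' := fun c f => by ext1; rfl }
  have hΦ : ∀ f v, Φ f v = (f (π v) : Vc n) := fun f v => rfl
  let Ψ : (K →ₗ[ℂ] W) →ₗ[ℂ] Mt n := LinearMap.toMatrix'.toLinearMap ∘ₗ Φ
  have hΨ : ∀ f v, (Ψ f).mulVec v = (f (π v) : Vc n) := fun f v => by
    change (LinearMap.toMatrix' (Φ f)).mulVec v = _
    rw [LinearMap.toMatrix'_mulVec, hΦ]
  have hinj : Function.Injective Ψ := by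
    intro f g h
    apply LinearMap.ext
    intro v
    have h1 := hΨ f v
    rw [h, hΨ, hπK] at h1
    exact Subtype.ext h1.symm
  have hmat : ∀ x y : Mt n, (∀ v, x.mulVec v = y.mulVec v) → x = y := fun x y h => by
    ext1 i j
    have := h (Pi.single j 1)
    rw [Matrix.mulVec_single_one, Matrix.mulVec_single_one] at this
    exact congrFun this i
  have hr : LinearMap.range Ψ = HS e := by
    apply le_antisymm
    · rintro _ ⟨f, rfl⟩
      refine ⟨hmat _ _ fun v => ?_, hmat _ _ fun v => ?_⟩
      · rw [← Matrix.mulVec_mulVec, hΨ]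
        exact range_idem he (f _).2
      · rw [← Matrix.mulVec_mulVec, hΨ]
        have : π (e.mulVec v) = 0 := by
          ext1
          rw [hπ, Matrix.mulVec_mulVec, he, sub_self]; rfl
        rw [this, map_zero, Matrix.zero_mulVec]; rfl
    · intro x hx
      refine ⟨LinearMap.codRestrict W (x.mulVecLin ∘ₗ K.subtype) (fun v => HS_mulVec_mem hx v.1), ?_⟩
      refine hmat _ _ fun v => ?_
      rw [hΨ]
      change x.mulVec (v - e.mulVec v) = _
      rw [Matrix.mulVec_sub, Matrix.mulVec_mulVec, hx.2, Matrix.zero_mulVec, sub_zero]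
  rw [← hr, LinearMap.finrank_range_of_inj hinj]

lemma isotropy {n : ℕ} {e : Mt n} (he : e * e = e) {F : ℕ → Submodule ℂ (Vc n)} (hF : IsFlag F) :
    finrank ℂ (HS e ⊓ nS F : Submodule ℂ (Mt n)) + finrank ℂ (HS (1 - e) ⊓ pS F : Submodule ℂ (Mt n)) ≤ finrank ℂ (HS (1 - e)) := by
  let Ψ := (trD (HS (1-e))) ∘ₗ (HS e ⊓ nS F).subtype
  have hinj : Function.Injective Ψ := by
    rw [injective_iff_map_eq_zero]
    intro x hx
    ext1
    apply tr_nondeg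
    intro y
    have hx1 := x.2.1.1
    have hx2 := x.2.1.2
    have hm : (1 - e) * y * e ∈ HS (1 - e) := by
      refine ⟨?_, ?_⟩
      · simp only [← mul_assoc]; simp [sub_mul, mul_sub, he]
      · simp only [mul_assoc]; simp [sub_mul, mul_sub, he]
    have := LinearMap.congr_fun hx ⟨_, hm⟩
    have h3 : (x.1 * ((1 - e) * y * e)).trace = 0 := this
    have h4 : x.1 * ((1 - e) * y * e) = x.1 * y * e := by
      rw [sub_mul, sub_mul, one_mul, mul_sub, mul_assoc e, ← mul_assoc x.1 e, hx2, zero_mul, sub_zero, mul_assoc]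
    rw [h4, Matrix.trace_mul_comm, ← mul_assoc, hx1] at h3
    exact h3
  set U := (HS (1-e) ⊓ pS F).submoduleOf (HS (1-e)) with hU
  have h1 : LinearMap.range Ψ ≤ U.dualAnnihilator := by
    rintro _ ⟨x, rfl⟩
    rw [Submodule.mem_dualAnnihilator]
    intro u hu
    have := tr_pn hF hu.2 x.2.2
    rw [Matrix.trace_mul_comm] at this
    exact this
  have h2 := Submodule.finrank_mono h1
  rw [LinearMap.finrank_range_of_inj hinj] at h2
  have h3 := Subspace.finrank_add_finrank_dualAnnihilator_eq U
  have h4 : finrank ℂ U = finrank ℂ (HS (1-e) ⊓ pS F : Submodule ℂ (Mt n)) :=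
    (Submodule.submoduleOfEquivOfLe (inf_le_left : HS (1-e) ⊓ pS F ≤ HS (1-e))).finrank_eq
  linarith [h2, h3, h4]
end

section
open Module Filter Topology
lemma LI_open {G : Type*} [AddCommGroup G] [Module ℂ G] [TopologicalSpace G] [IsTopologicalAddGroup G] [ContinuousSMul ℂ G]
    [T2Space G] [FiniteDimensional ℂ G] {ι τ : Type*} [Finite ι] {l : Filter τ} (f : τ → ι → G) (f0 : ι → G)
    (h : ∀ i, Tendsto (fun t => f t i) l (𝓝 (f0 i))) (h0 : LinearIndependent ℂ f0) :
    ∀ᶠ t in l, LinearIndependent ℂ (f t) := by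
  let e : G ≃L[ℂ] (Fin (finrank ℂ G) → ℂ) := ContinuousLinearEquiv.ofFinrankEq (by simp)
  have h1 : LinearIndependent ℂ (e.toLinearMap ∘ f0) := h0.map' _ (LinearMap.ker_eq_bot.2 e.injective)
  have h2 : Tendsto (fun t => e.toLinearMap ∘ f t) l (𝓝 (e.toLinearMap ∘ f0)) := by
    rw [tendsto_pi_nhds]
    intro i
    exact (e.continuous.tendsto _).comp (h i)
  have h3 := h2.eventually (isOpen_setOfPred_linearIndependent.mem_nhds h1)
  filter_upwards [h3] with t ht
  exact LinearIndependent.of_comp _ ht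

lemma LSC {E G : Type*} [AddCommGroup E] [Module ℂ E] [FiniteDimensional ℂ E] [AddCommGroup G] [Module ℂ G] [TopologicalSpace G] [IsTopologicalAddGroup G] [ContinuousSMul ℂ G]
    [T2Space G] [FiniteDimensional ℂ G] {τ : Type*} {l : Filter τ} (L : τ → E →ₗ[ℂ] G) (L0 : E →ₗ[ℂ] G)
    (h : ∀ e, Tendsto (fun t => L t e) l (𝓝 (L0 e))) :
    ∀ᶠ t in l, finrank ℂ (LinearMap.range L0) ≤ finrank ℂ (LinearMap.range (L t)) := by
  let b := Module.finBasis ℂ (LinearMap.range L0)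
  choose x hx using fun i => (b i).2
  have h0 : LinearIndependent ℂ (fun i => L0 (x i)) := by
    have := b.linearIndependent.map' _ (Submodule.ker_subtype _)
    have e : (fun i => L0 (x i)) = (LinearMap.range L0).subtype ∘ b := funext hx
    rw [e]; exact this
  filter_upwards [LI_open (fun t i => L t (x i)) _ (fun i => h (x i)) h0] with t ht
  have h4 : LinearIndependent ℂ (fun i => (⟨L t (x i), x i, rfl⟩ : LinearMap.range (L t))) :=
    LinearIndependent.of_comp (LinearMap.range (L t)).subtype ht
  simpa using h4.fintype_card_le_finrank

lemma CR {E G : Type*} [AddCommGroup E] [Module ℂ E] [FiniteDimensional ℂ E] [AddCommGroup G] [Module ℂ G] [TopologicalSpace G] [IsTopologicalAddGroup G] [ContinuousSMul ℂ G]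
    [T2Space G] [FiniteDimensional ℂ G] {τ : Type*} {l : Filter τ} [l.NeBot] (L : τ → E →ₗ[ℂ] G) (L0 : E →ₗ[ℂ] G)
    (h : ∀ e, Tendsto (fun t => L t e) l (𝓝 (L0 e))) (y : τ → G) (y0 : G) (hy : Tendsto y l (𝓝 y0))
    (hyL : ∀ᶠ t in l, y t ∈ LinearMap.range (L t))
    (hr : ∀ᶠ t in l, finrank ℂ (LinearMap.range (L t)) ≤ finrank ℂ (LinearMap.range L0)) :
    y0 ∈ LinearMap.range L0 := by
  by_contra hn
  let b := Module.finBasis ℂ (LinearMap.range L0)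
  choose x hx using fun i => (b i).2
  have h0 : LinearIndependent ℂ (fun i => L0 (x i)) := by
    have := b.linearIndependent.map' _ (Submodule.ker_subtype _)
    have e : (fun i => L0 (x i)) = (LinearMap.range L0).subtype ∘ b := funext hx
    rw [e]; exact this
  have h1 : LinearIndependent ℂ (fun o : Option (Fin (finrank ℂ (LinearMap.range L0))) => o.elim y0 (fun i => L0 (x i))) := by
    rw [linearIndependent_option]
    refine ⟨h0, fun hs => hn ?_⟩
    refine (Submodule.span_le.2 ?_) hs
    rintro _ ⟨i, rfl⟩
    exact ⟨x i, rfl⟩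
  have h2 := LI_open (l := l) (fun t (o : Option (Fin (finrank ℂ (LinearMap.range L0)))) => o.elim (y t) (fun i => L t (x i))) _
    (by rintro (_ | i); exacts [hy, h (x i)]) h1
  obtain ⟨t, ht, hyt, hrt⟩ := (h2.and (hyL.and hr)).exists
  have h4 : LinearIndependent ℂ (fun o : Option (Fin (finrank ℂ (LinearMap.range L0))) => (⟨o.elim (y t) (fun i => L t (x i)), by
      rcases o with _ | i
      exacts [hyt, ⟨x i, rfl⟩]⟩ : LinearMap.range (L t))) :=
    LinearIndependent.of_comp (LinearMap.range (L t)).subtype ht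
  have := h4.fintype_card_le_finrank
  simp at this
  omega

/-- matrices with prescribed kernel and range -/
lemma exists_kerMat {n : ℕ} (F : Submodule ℂ (Vc n)) : ∃ c : Mt n, ∀ v, c.mulVec v = 0 ↔ v ∈ F := by
  obtain ⟨C, hC⟩ := Submodule.exists_isCompl F
  refine ⟨LinearMap.toMatrix' (C.subtype ∘ₗ C.projectionOnto F hC.symm), fun v => ?_⟩
  rw [LinearMap.toMatrix'_mulVec]
  simp

lemma exists_ranMat {n : ℕ} (F : Submodule ℂ (Vc n)) : ∃ c : Mt n, ∀ v, v ∈ F ↔ ∃ w, c.mulVec w = v := by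
  obtain ⟨C, hC⟩ := Submodule.exists_isCompl F
  refine ⟨LinearMap.toMatrix' (F.subtype ∘ₗ F.projectionOnto C hC), fun v => ?_⟩
  simp only [LinearMap.toMatrix'_mulVec]
  constructor
  · intro h; exact ⟨v, by simp [Submodule.projectionOnto_apply_left hC ⟨v, h⟩]⟩
  · rintro ⟨w, rfl⟩; simp
end

section
open Module Filter Topology
lemma mat_ext {n : ℕ} {x y : Mt n} (h : ∀ v, x.mulVec v = y.mulVec v) : x = y := by
  ext1 i j
  have := h (Pi.single j 1)
  rw [Matrix.mulVec_single_one, Matrix.mulVec_single_one] at this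
  exact congrFun this i

lemma rank_zero {n : ℕ} {x : Mt n} (h : x.rank = 0) : x = 0 := by
  have h1 : LinearMap.range x.mulVecLin = ⊥ := Submodule.finrank_eq_zero.1 h
  apply mat_ext
  intro v
  have : x.mulVecLin v ∈ LinearMap.range x.mulVecLin := ⟨v, rfl⟩
  rw [h1, Submodule.mem_bot] at this
  rw [Matrix.zero_mulVec]; exact this

lemma gF_one {n : ℕ} (F : ℕ → Submodule ℂ (Vc n)) : gF 1 F = F := by
  funext k
  simp [gF]

lemma rank_compl {n : ℕ} {e : Mt n} (he : e * e = e) : (1 - e).rank + e.rank = n := by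
  have h := LinearMap.finrank_range_add_finrank_ker e.mulVecLin
  have h1 : LinearMap.ker e.mulVecLin = LinearMap.range (1 - e).mulVecLin := by
    ext v
    constructor
    · intro hv
      refine ⟨v, ?_⟩
      have : e.mulVec v = 0 := hv
      rw [Matrix.mulVecLin_apply, Matrix.sub_mulVec, Matrix.one_mulVec, this, sub_zero]
    · rintro ⟨w, rfl⟩
      rw [LinearMap.mem_ker, Matrix.mulVecLin_apply, Matrix.mulVecLin_apply, Matrix.mulVec_mulVec, mul_sub, mul_one, he, sub_self, Matrix.zero_mulVec]
  rw [h1, Module.finrank_fin_fun] at h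
  unfold Matrix.rank
  omega

lemma idem_compl {n : ℕ} {e : Mt n} (he : e * e = e) : (1 - e) * (1 - e) = 1 - e := by
  rw [mul_sub, sub_mul, one_mul, mul_one, sub_mul, he]; simp

lemma aeval_pS {n : ℕ} {F : ℕ → Submodule ℂ (Vc n)} {x : Mt n} (hx : x ∈ pS F) (q : ℂ[X]) : aeval x q ∈ pS F := by
  induction q using Polynomial.induction_on' with
  | add p q hp hq => rw [map_add]; exact (pS F).add_mem hp hq
  | monomial m a =>
    rw [aeval_monomial, ← Algebra.smul_def]
    refine (pS F).smul_mem _ ?_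
    induction m with
    | zero => rw [pow_zero]; exact pS_one
    | succ m ih => rw [pow_succ]; exact pS_mul ih hx

lemma idem_exists {n : ℕ} (hn : 1 ≤ n) (θ : Mt n) : (∃ c : ℂ, IsNilpotent (θ - c • (1 : Mt n))) ∨
    ∃ q : ℂ[X], aeval θ q * aeval θ q = aeval θ q ∧ aeval θ q ≠ 0 ∧ aeval θ q ≠ 1 := by
  have : Nonempty (Fin n) := ⟨⟨0, hn⟩⟩
  obtain ⟨a, ha⟩ := IsAlgClosed.exists_root θ.charpoly (by
    rw [Matrix.charpoly_degree_eq_dim]; simp; omega)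
  have hne : θ.charpoly ≠ 0 := (Matrix.charpoly_monic θ).ne_zero
  obtain ⟨q, hq, hqa⟩ := Polynomial.exists_eq_pow_rootMultiplicity_mul_and_not_dvd θ.charpoly hne a
  set m := θ.charpoly.rootMultiplicity a with hm
  have hmpos : 0 < m := (Polynomial.rootMultiplicity_pos hne).2 ha
  have hcop : IsCoprime ((X - C a) ^ m) q := by
    apply IsCoprime.pow_left
    exact (Polynomial.irreducible_X_sub_C a).coprime_iff_not_dvd.2 hqa
  obtain ⟨u, v, huv⟩ := hcop
  have hCH : aeval θ ((X - C a) ^ m * q) = 0 := by rw [← hq]; exact Matrix.aeval_self_charpoly θ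
  have h1 : aeval θ (u * (X - C a) ^ m) = 1 - aeval θ (v * q) := by
    rw [eq_sub_iff_add_eq, ← map_add, huv, map_one]
  by_cases h : aeval θ (v * q) = 1
  · left
    refine ⟨a, m, ?_⟩
    have e : aeval θ ((X - C a) ^ m) = (θ - a • (1 : Mt n)) ^ m := by
      rw [map_pow, map_sub, aeval_X, aeval_C, Algebra.algebraMap_eq_smul_one]
    rw [← e, ← mul_one (aeval θ ((X - C a) ^ m)), ← h, mul_comm v q, ← map_mul, ← mul_assoc, map_mul, hCH, zero_mul]
  · right
    refine ⟨v * q, ?_, ?_, h⟩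
    · have : aeval θ (v * q) * (1 - aeval θ (v * q)) = 0 := by
        rw [← h1, ← map_mul]
        have e : v * q * (u * (X - C a) ^ m) = ((X - C a) ^ m * q) * (u * v) := by ring
        rw [e, map_mul, hCH, zero_mul]
      rw [mul_sub, mul_one, sub_eq_zero] at this
      exact this.symm
    · intro h0
      rw [h0, sub_zero] at h1
      have ev : Module.End.HasEigenvalue θ.toLin' a := by
        rw [Module.End.hasEigenvalue_iff_isRoot_charpoly, Matrix.charpoly_toLin']; exact ha
      obtain ⟨w, hw⟩ := ev.exists_hasEigenvector
      have hw1 : θ.mulVec w = a • w := by simpa using hw.apply_eq_smul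
      have h2 : (aeval θ ((X - C a) ^ m)).mulVec w = 0 := by
        obtain ⟨k, hk⟩ : ∃ k, m = k + 1 := ⟨m - 1, by omega⟩
        rw [hk, pow_succ, map_mul, ← Matrix.mulVec_mulVec, map_sub, aeval_X, aeval_C, Algebra.algebraMap_eq_smul_one,
          Matrix.sub_mulVec, hw1, Matrix.smul_mulVec, Matrix.one_mulVec, sub_self, Matrix.mulVec_zero]
      have h3 := congrArg (fun z : Mt n => z.mulVec w) h1
      simp only [map_mul, ← Matrix.mulVec_mulVec, h2, Matrix.mulVec_zero, Matrix.one_mulVec] at h3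
      exact hw.2 h3.symm

section step2
variable {n : ℕ} {ι : Type*} [Fintype ι]

def ES (F : ι → ℕ → Submodule ℂ (Vc n)) : Submodule ℂ (Mt n) := ⨅ i, pS (F i)

lemma mem_ES {F : ι → ℕ → Submodule ℂ (Vc n)} {x : Mt n} : x ∈ ES F ↔ ∀ i, x ∈ pS (F i) := by
  simp [ES]

def cadM (c h k d : ι → Fin (n+1) → Mt n) : Mt n →ₗ[ℂ] (ι → Fin (n+1) → Mt n) where
  toFun x := fun i j => c i j * (h i j * x * k i j) * d i j
  map_add' x y := by ext1 i; ext1 j; simp [mul_add, add_mul]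
  map_smul' a x := by ext1 i; ext1 j; simp

lemma pS_iff_cd {F : ℕ → Submodule ℂ (Vc n)} (hF : IsFlag F) (c d : Fin (n+1) → Mt n)
    (hc : ∀ (j : Fin (n+1)) v, (c j).mulVec v = 0 ↔ v ∈ F (j:ℕ)) (hd : ∀ (j : Fin (n+1)) v, v ∈ F (j:ℕ) ↔ ∃ w, (d j).mulVec w = v) (x : Mt n) :
    x ∈ pS F ↔ ∀ j, c j * x * d j = 0 := by
  constructor
  · intro hx j
    apply mat_ext
    intro v
    rw [← Matrix.mulVec_mulVec, ← Matrix.mulVec_mulVec, Matrix.zero_mulVec, hc]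
    exact hx _ _ ((hd j _).2 ⟨v, rfl⟩)
  · intro h k v hv
    rcases le_or_gt n k with hk | hk
    · have : F k = ⊤ := top_le_iff.1 (hF.top ▸ hF.mono hk)
      rw [this]; trivial
    · obtain ⟨w, rfl⟩ := (hd ⟨k, by omega⟩ v).1 hv
      have := congrArg (fun z : Mt n => z.mulVec w) (h ⟨k, by omega⟩)
      simp only [← Matrix.mulVec_mulVec, Matrix.zero_mulVec] at this
      exact (hc ⟨k, by omega⟩ _).1 this

lemma gF_pS_adj {h : Mt n} (hh : IsUnit h) {F : ℕ → Submodule ℂ (Vc n)} (x : Mt n) :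
    x ∈ pS (gF h F) ↔ h.adjugate * x * h ∈ pS F := by
  have hd := (Matrix.isUnit_iff_isUnit_det h).1 hh
  have : h.adjugate = h.det • h⁻¹ := by
    rw [Matrix.inv_def, smul_smul, Ring.mul_inverse_cancel _ hd, one_smul]
  rw [gF_pS hh, this, smul_mul_assoc, smul_mul_assoc, (pS F).smul_mem_iff hd.ne_zero]

lemma tan_surj (F : ι → ℕ → Submodule ℂ (Vc n)) (hF : ∀ i, IsFlag (F i))
    (hmin : ∀ h : ι → Mt n, (∀ i, IsUnit (h i)) → finrank ℂ (ES F) ≤ finrank ℂ (ES fun i => gF (h i) (F i)))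
    (e : Mt n) (he : e ∈ ES F) (γ : ι → Mt n) : ∃ x : Mt n, ∀ i, (e * γ i - γ i * e) - x ∈ pS (F i) := by
  choose c hc using fun (i : ι) (j : Fin (n+1)) => exists_kerMat (F i j)
  choose d hd using fun (i : ι) (j : Fin (n+1)) => exists_ranMat (F i j)
  have key : ∀ h : ι → Mt n, (∀ i, IsUnit (h i)) →
      LinearMap.ker (cadM c (fun i _ => (h i).adjugate) (fun i _ => h i) d) = ES fun i => gF (h i) (F i) := by
    intro h hh
    ext x
    rw [mem_ES, LinearMap.mem_ker]
    constructor
    · intro hx i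
      rw [gF_pS_adj (hh i), pS_iff_cd (hF i) (c i) (d i) (hc i) (hd i)]
      intro j
      exact congrFun (congrFun hx i) j
    · intro hx
      ext1 i; ext1 j
      have := hx i
      rw [gF_pS_adj (hh i), pS_iff_cd (hF i) (c i) (d i) (hc i) (hd i)] at this
      exact this j
  let h : ℂ → ι → Mt n := fun t i => 1 + t • γ i
  have h0 : h 0 = 1 := by funext i; simp [h]
  have hcont : ∀ i, Continuous fun t => h t i := fun i => by fun_prop
  have hadj : ∀ i, Continuous fun t => (h t i).adjugate := fun i => (hcont i).matrix_adjugate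
  have hunit : ∀ᶠ t in 𝓝[≠] (0:ℂ), ∀ i, IsUnit (h t i) := by
    rw [eventually_all]
    intro i
    have : Continuous fun t => (h t i).det := (hcont i).matrix_det
    have h1 : ∀ᶠ t in 𝓝 (0:ℂ), (h t i).det ≠ 0 := by
      apply this.continuousAt.eventually_ne
      rw [h0]; simp
    filter_upwards [h1.filter_mono nhdsWithin_le_nhds] with t ht
    exact (Matrix.isUnit_iff_isUnit_det _).2 (isUnit_iff_ne_zero.2 ht)
  have hexp : ∀ t i, (h t i).adjugate * e * h t i = (h t i).det • e + t • ((h t i).adjugate * (e * γ i - γ i * e)) := by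
    intro t i
    have e1 : e * h t i = h t i * e + t • (e * γ i - γ i * e) := by
      simp only [h, mul_add, add_mul, mul_one, one_mul, mul_smul_comm, smul_mul_assoc, smul_sub]; abel
    rw [mul_assoc, e1, mul_add, ← mul_assoc, Matrix.adjugate_mul, smul_mul_assoc, one_mul, mul_smul_comm]
  have hced : ∀ i j, c i j * e * d i j = 0 := fun i => (pS_iff_cd (hF i) (c i) (d i) (hc i) (hd i) e).1 (mem_ES.1 he i)
  have main := CR (l := 𝓝[≠] (0:ℂ)) (fun t => cadM c (fun i _ => (h t i).adjugate) (fun i _ => h t i) d)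
    (cadM c (fun i _ => (h 0 i).adjugate) (fun i _ => h 0 i) d)
    (by
      intro x
      have : Continuous fun t => cadM c (fun i _ => (h t i).adjugate) (fun i _ => h t i) d x := by
        refine continuous_pi fun i => continuous_pi fun j => ?_
        exact ((continuous_const.mul (((hadj i).mul continuous_const).mul (hcont i))).mul continuous_const)
      exact (this.tendsto 0).mono_left nhdsWithin_le_nhds)
    (fun t i j => c i j * ((h t i).adjugate * (e * γ i - γ i * e)) * d i j)
    (fun i j => c i j * ((h 0 i).adjugate * (e * γ i - γ i * e)) * d i j)
    (by
      have : Continuous fun t => (fun (i : ι) (j : Fin (n+1)) => c i j * ((h t i).adjugate * (e * γ i - γ i * e)) * d i j) := by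
        refine continuous_pi fun i => continuous_pi fun j => ?_
        exact ((continuous_const.mul (((hadj i).mul continuous_const))).mul continuous_const)
      exact (this.tendsto 0).mono_left nhdsWithin_le_nhds)
    (by
      filter_upwards [self_mem_nhdsWithin] with t ht
      refine ⟨t⁻¹ • e, ?_⟩
      rw [map_smul]
      ext1 i; ext1 j
      have ht' : t ≠ 0 := ht
      change t⁻¹ • (c i j * ((h t i).adjugate * e * h t i) * d i j) = _
      rw [hexp, mul_add, add_mul, mul_smul_comm, smul_mul_assoc, hced, smul_zero, zero_add, mul_smul_comm, smul_mul_assoc,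
        smul_smul, inv_mul_cancel₀ ht', one_smul])
    (by
      filter_upwards [hunit] with t ht
      have h1 := LinearMap.finrank_range_add_finrank_ker (cadM c (fun i _ => (h t i).adjugate) (fun i _ => h t i) d)
      have h2 := LinearMap.finrank_range_add_finrank_ker (cadM c (fun i _ => (h 0 i).adjugate) (fun i _ => h 0 i) d)
      rw [key (h t) ht] at h1
      rw [key (h 0) (fun i => by rw [h0]; exact isUnit_one)] at h2
      have h3 := hmin (h t) ht
      have h4 : (fun i => gF (h 0 i) (F i)) = F := by funext i; rw [h0]; exact gF_one _
      rw [h4] at h2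
      omega)
  obtain ⟨x, hx⟩ := main
  refine ⟨x, fun i => ?_⟩
  rw [pS_iff_cd (hF i) (c i) (d i) (hc i) (hd i)]
  intro j
  have := congrFun (congrFun hx i) j
  simp only [h0, cadM, LinearMap.coe_mk, AddHom.coe_mk, Pi.one_apply, Matrix.adjugate_one, one_mul, mul_one] at this
  rw [mul_sub, sub_mul, this, sub_self]

lemma count2 (F : ι → ℕ → Submodule ℂ (Vc n)) 
    (e : Mt n) (hee : e * e = e) (he : e ∈ ES F)
    (ht : ∀ γ : ι → Mt n, ∃ x : Mt n, ∀ i, (e * γ i - γ i * e) - x ∈ pS (F i)) :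
    Fintype.card ι * finrank ℂ (HS e) ≤ finrank ℂ (HS e) + ∑ i, finrank ℂ (HS e ⊓ pS (F i) : Submodule ℂ (Mt n)) := by
  let Φ : (HS e × ((i : ι) → (HS e ⊓ pS (F i) : Submodule ℂ (Mt n)))) →ₗ[ℂ] (ι → HS e) :=
    { toFun := fun q i => ⟨q.1.1 + (q.2 i).1, (HS e).add_mem q.1.2 (q.2 i).2.1⟩
      map_add' := fun q r => by
        ext1 i; apply Subtype.ext
        change (q.1.1 + r.1.1) + ((q.2 i).1 + (r.2 i).1) = (q.1.1 + (q.2 i).1) + (r.1.1 + (r.2 i).1)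
        abel
      map_smul' := fun a q => by
        ext1 i; apply Subtype.ext
        change a • q.1.1 + a • (q.2 i).1 = a • (q.1.1 + (q.2 i).1)
        rw [smul_add] }
  have hs : Function.Surjective Φ := by
    intro γ
    obtain ⟨x, hx⟩ := ht (fun i => (γ i).1)
    have hxm : e * x * (1 - e) ∈ HS e := by
      refine ⟨?_, ?_⟩
      · rw [← mul_assoc, ← mul_assoc, hee]
      · rw [mul_assoc, sub_mul, one_mul, hee, sub_self, mul_zero]
    have hq : ∀ i, (γ i).1 - e * x * (1 - e) ∈ HS e ⊓ pS (F i) := by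
      intro i
      refine ⟨(HS e).sub_mem (γ i).2 hxm, ?_⟩
      have h1 := hx i
      have g1 := (γ i).2.1
      have g2 := (γ i).2.2
      rw [g1, g2, sub_zero] at h1
      have hei := mem_ES.1 he i
      have h2 := pS_mul (pS_mul hei h1) ((pS (F i)).sub_mem pS_one hei)
      have h3 : e * ((γ i).1 - x) * (1 - e) = (γ i).1 - e * x * (1 - e) := by
        rw [mul_sub e, g1, sub_mul, mul_sub (γ i).1, mul_one, g2, sub_zero]
      rwa [h3] at h2
    refine ⟨(⟨_, hxm⟩, fun i => ⟨_, hq i⟩), ?_⟩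
    ext1 i; apply Subtype.ext
    change e * x * (1 - e) + ((γ i).1 - e * x * (1 - e)) = _
    abel
  have h1 := LinearMap.finrank_le_finrank_of_surjective hs
  rw [Module.finrank_prod, Module.finrank_pi_fintype, Module.finrank_pi_fintype] at h1
  simpa using h1

theorem step2 (hn : 1 ≤ n) (F : ι → ℕ → Submodule ℂ (Vc n)) (hF : ∀ i, IsFlag (F i))
    (hnum : ∀ g : ι → Mt n, (∀ i, IsUnit (g i)) → ∀ W : Submodule ℂ (Vc n), 0 < finrank ℂ W → finrank ℂ W < n →
      2 * ((finrank ℂ W : ℤ) * (n - finrank ℂ W)) < ∑ i, ((finrank ℂ W : ℤ) * (n - finrank ℂ W) -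
        ∑ k ∈ Finset.range n, aW W (gF (g i) (F i)) k * (mF (gF (g i) (F i)) k - aW W (gF (g i) (F i)) k))) :
    ∃ g : ι → Mt n, (∀ i, IsUnit (g i)) ∧
      ∀ θ : Mt n, (∀ i, θ ∈ pS (gF (g i) (F i))) → ∃ c : ℂ, IsNilpotent (θ - c • (1 : Mt n)) := by
  classical
  have hex : ∃ m : ℕ, ∃ g : ι → Mt n, (∀ i, IsUnit (g i)) ∧ finrank ℂ (ES fun i => gF (g i) (F i)) = m :=
    ⟨_, 1, fun i => isUnit_one, rfl⟩
  obtain ⟨g, hg, hgm⟩ := Nat.find_spec hex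
  refine ⟨g, hg, fun θ hθ => ?_⟩
  rcases idem_exists hn θ with h | ⟨q, hq, hq0, hq1⟩
  · exact h
  exfalso
  set e := aeval θ q with he
  have heE : e ∈ ES fun i => gF (g i) (F i) := mem_ES.2 fun i => aeval_pS (hθ i) q
  have heE' : 1 - e ∈ ES fun i => gF (g i) (F i) := mem_ES.2 fun i => (pS _).sub_mem pS_one (aeval_pS (hθ i) q)
  have hF' : ∀ i, IsFlag (gF (g i) (F i)) := fun i => gF_flag (hg i) (hF i)
  have hmin : ∀ h : ι → Mt n, (∀ i, IsUnit (h i)) → finrank ℂ (ES fun i => gF (g i) (F i)) ≤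
      finrank ℂ (ES fun i => gF (h i) (gF (g i) (F i))) := by
    intro h hh
    rw [hgm]
    apply Nat.find_min' hex
    refine ⟨fun i => h i * g i, fun i => (hh i).mul (hg i), ?_⟩
    have e1 : (fun i => gF (h i * g i) (F i)) = fun i => gF (h i) (gF (g i) (F i)) := funext fun i => gF_mul _ _ _
    rw [e1]
  have c1 := count2 _ e hq heE (tan_surj _ hF' hmin e heE)
  have c2 := count2 _ (1-e) (idem_compl hq) heE' (tan_surj _ hF' hmin (1-e) heE')
  have r1 := rank_compl hq
  have hs1 := HS_fin hq
  have hs2 := HS_fin (idem_compl hq)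
  have rp : 0 < e.rank := by
    rw [Nat.pos_iff_ne_zero]; intro h; exact hq0 (rank_zero h)
  have rp' : 0 < (1 - e).rank := by
    rw [Nat.pos_iff_ne_zero]; intro h
    exact hq1 (sub_eq_zero.1 (rank_zero h)).symm
  have hn1 : n - e.rank = (1 - e).rank := by omega
  have hn2 : n - (1 - e).rank = e.rank := by omega
  rw [hn1] at hs1
  rw [hn2] at hs2
  set W := LinearMap.range e.mulVecLin with hW
  have hWr : finrank ℂ W = e.rank := rfl
  have hfin := hnum g hg W rp (show e.rank < n by omega)
  rw [hWr] at hfin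
  have hcast : (n : ℤ) - e.rank = (1 - e).rank := by omega
  rw [hcast] at hfin
  have hi : ∀ i, (finrank ℂ (HS e ⊓ pS (gF (g i) (F i)) : Submodule ℂ (Mt n)) : ℤ) + finrank ℂ (HS (1-e) ⊓ pS (gF (g i) (F i)) : Submodule ℂ (Mt n)) ≤
      (finrank ℂ (HS e) : ℤ) + ∑ k ∈ Finset.range n, aW W (gF (g i) (F i)) k * (mF (gF (g i) (F i)) k - aW W (gF (g i) (F i)) k) := by
    intro i
    have d1 := D1 e (hF' i)
    have d2 := isotropy hq (hF' i)
    rw [hs2] at d2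
    rw [hs1]
    zify at d2
    push_cast
    linarith
  have hsum := Finset.sum_le_sum (fun i (_ : i ∈ Finset.univ) => hi i)
  rw [hs1] at c1 hsum
  rw [hs2] at c2
  simp only [Finset.sum_add_distrib, Finset.sum_sub_distrib, Finset.sum_const, Finset.card_univ, nsmul_eq_mul] at hsum hfin
  zify at c1 c2
  push_cast at hsum
  nlinarith
end step2
end

section
open Module Filter Topology
noncomputable def pp {n : ℕ} (ξ : ℕ → ℂ) (Y : Mt n) (k : ℕ) : Mt n := aeval Y (∏ l ∈ Finset.range k, (X - C (ξ l)))

lemma pp_zero {n : ℕ} (ξ : ℕ → ℂ) (Y : Mt n) : pp ξ Y 0 = 1 := by simp [pp]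
lemma pp_succ {n : ℕ} (ξ : ℕ → ℂ) (Y : Mt n) (k : ℕ) : pp ξ Y (k+1) = pp ξ Y k * (Y - ξ k • (1 : Mt n)) := by
  simp only [pp, Finset.prod_range_succ, map_mul, map_sub, aeval_X, aeval_C, Algebra.algebraMap_eq_smul_one]
lemma pp_succ' {n : ℕ} (ξ : ℕ → ℂ) (Y : Mt n) (k : ℕ) : pp ξ Y (k+1) = (Y - ξ k • (1 : Mt n)) * pp ξ Y k := by
  simp only [pp, Finset.prod_range_succ_comm, map_mul, map_sub, aeval_X, aeval_C, Algebra.algebraMap_eq_smul_one]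

noncomputable def fl {n : ℕ} (ξ : ℕ → ℂ) (Y : Mt n) (k : ℕ) : Submodule ℂ (Vc n) := LinearMap.ker (pp ξ Y k).mulVecLin

lemma mem_fl {n : ℕ} {ξ : ℕ → ℂ} {Y : Mt n} {k : ℕ} {v : Vc n} : v ∈ fl ξ Y k ↔ (pp ξ Y k).mulVec v = 0 := Iff.rfl

def FC {n : ℕ} (ξ : ℕ → ℂ) (F : ℕ → Submodule ℂ (Vc n)) (Y : Mt n) : Prop :=
  ∀ k, ∀ v ∈ F (k+1), Y.mulVec v - ξ k • v ∈ F k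

lemma fl_FC {n : ℕ} (ξ : ℕ → ℂ) (Y : Mt n) : FC ξ (fl ξ Y) Y := by
  intro k v hv
  rw [mem_fl] at *
  rw [pp_succ, ← Matrix.mulVec_mulVec, Matrix.sub_mulVec, Matrix.smul_mulVec, Matrix.one_mulVec] at hv
  exact hv

lemma fl_flag {n : ℕ} (ξ : ℕ → ℂ) (Y : Mt n) (hY : Y.charpoly = ∏ k : Fin n, (X - C (ξ k))) : IsFlag (fl ξ Y) := by
  refine ⟨?_, ?_, ?_⟩
  · apply monotone_nat_of_le_succ
    intro k v hv
    rw [mem_fl] at *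
    rw [pp_succ', ← Matrix.mulVec_mulVec, hv, Matrix.mulVec_zero]
  · ext v
    rw [mem_fl, pp_zero, Matrix.one_mulVec, Submodule.mem_bot]
  · ext v
    rw [mem_fl]
    have : pp ξ Y n = 0 := by
      rw [pp, Finset.prod_range (fun l => X - C (ξ l)), ← hY]
      exact Matrix.aeval_self_charpoly Y
    simp [this]

lemma fl_mF {n : ℕ} (ξ : ℕ → ℂ) (Y : Mt n) (k : ℕ) : mF (fl ξ Y) k + (Y - ξ k • (1 : Mt n)).rank ≤ n := by
  have h1 : (fl ξ Y (k+1)).map (pp ξ Y k).mulVecLin ≤ LinearMap.ker (Y - ξ k • (1 : Mt n)).mulVecLin := by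
    rintro _ ⟨v, hv, rfl⟩
    have hv' : (pp ξ Y (k+1)).mulVec v = 0 := hv
    rw [pp_succ', ← Matrix.mulVec_mulVec] at hv'
    exact hv'
  have h2 := Submodule.finrank_mono h1
  have h3 := LinearMap.finrank_range_add_finrank_ker (Y - ξ k • (1 : Mt n)).mulVecLin
  rw [Module.finrank_fin_fun] at h3
  have h4 := LinearMap.finrank_range_add_finrank_ker ((pp ξ Y k).mulVecLin.domRestrict (fl ξ Y (k+1)))
  rw [LinearMap.range_domRestrict] at h4
  have h5 : finrank ℂ (LinearMap.ker ((pp ξ Y k).mulVecLin.domRestrict (fl ξ Y (k+1)))) ≤ finrank ℂ (fl ξ Y k) := by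
    rw [LinearMap.ker_domRestrict, ← Submodule.finrank_map_subtype_eq]
    apply Submodule.finrank_mono
    rintro _ ⟨v, hv, rfl⟩
    exact hv
  have h6 : finrank ℂ (Submodule.map (pp ξ Y k).mulVecLin (fl ξ Y (k+1))) + finrank ℂ (LinearMap.ker ((pp ξ Y k).mulVecLin.domRestrict (fl ξ Y (k+1)))) = finrank ℂ (fl ξ Y (k+1)) := h4
  unfold mF Matrix.rank
  omega

lemma FC_add {n : ℕ} {ξ : ℕ → ℂ} {F : ℕ → Submodule ℂ (Vc n)} {Y η : Mt n} (hY : FC ξ F Y) (hη : η ∈ nS F) : FC ξ F (Y + η) := by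
  intro k v hv
  rw [Matrix.add_mulVec, add_sub_right_comm]
  exact (F k).add_mem (hY k v hv) (hη k v hv)

lemma FC_pS {n : ℕ} {ξ : ℕ → ℂ} {F : ℕ → Submodule ℂ (Vc n)} (hF : IsFlag F) {Y : Mt n} (hY : FC ξ F Y) : Y ∈ pS F := by
  intro k v hv
  rcases k with _ | k
  · rw [hF.bot, Submodule.mem_bot] at *
    rw [hv, Matrix.mulVec_zero]
  · have h := hF.mono k.le_succ (hY k v hv)
    have h2 := (F (k+1)).add_mem h ((F (k+1)).smul_mem (ξ k) hv)
    rwa [sub_add_cancel] at h2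

lemma pow_pS {n : ℕ} {F : ℕ → Submodule ℂ (Vc n)} {x : Mt n} (hx : x ∈ pS F) (m : ℕ) : x ^ m ∈ pS F := by
  induction m with
  | zero => rw [pow_zero]; exact pS_one
  | succ m ih => rw [pow_succ]; exact pS_mul ih hx

lemma tr_nilp_FC {n : ℕ} {ξ : ℕ → ℂ} {F : ℕ → Submodule ℂ (Vc n)} (hF : IsFlag F) {Y u : Mt n} (hY : FC ξ F Y)
    (hu : u ∈ pS F) (hnil : IsNilpotent u) : (u * Y).trace = 0 := by
  have hYp := FC_pS hF hY
  have key : ∀ m k, ∀ v ∈ F (k+1), ((u * Y) ^ m).mulVec v - ξ k ^ m • (u ^ m).mulVec v ∈ F k := by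
    intro m k v hv
    induction m with
    | zero => simp
    | succ m ih =>
      have e : ((u * Y) ^ (m+1)).mulVec v - ξ k ^ (m+1) • (u ^ (m+1)).mulVec v =
        (u * Y).mulVec (((u * Y) ^ m).mulVec v - ξ k ^ m • (u ^ m).mulVec v) +
        ξ k ^ m • u.mulVec (Y.mulVec ((u ^ m).mulVec v) - ξ k • (u ^ m).mulVec v) := by
        simp only [pow_succ', ← Matrix.mulVec_mulVec, Matrix.mulVec_sub, Matrix.mulVec_smul, smul_sub, smul_smul]
        rw [mul_comm (ξ k)]; abel
      rw [e]
      refine (F k).add_mem (pS_mul hu hYp k _ ih) ((F k).smul_mem _ (hu k _ (hY k _ ?_)))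
      exact pow_pS hu m _ v hv
  obtain ⟨m, hm⟩ := hnil
  have h1 : (u * Y) ^ m ∈ nS F := by
    intro k v hv
    have := key m k v hv
    rwa [hm, Matrix.zero_mulVec, smul_zero, sub_zero] at this
  obtain ⟨l, hl⟩ := nS_nilp hF h1
  exact nilp_trace ⟨m * l, by rw [pow_mul, hl]⟩

lemma conj_isNilpotent {n : ℕ} {g x : Mt n} (hg : IsUnit g) (hx : IsNilpotent x) : IsNilpotent (g⁻¹ * x * g) := by
  have hd := (Matrix.isUnit_iff_isUnit_det g).1 hg
  obtain ⟨m, hm⟩ := hx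
  refine ⟨m, ?_⟩
  have : ∀ m, (g⁻¹ * x * g) ^ m = g⁻¹ * x ^ m * g := by
    intro m
    induction m with
    | zero => simp [Matrix.nonsing_inv_mul g hd]
    | succ m ih =>
      rw [pow_succ, ih, pow_succ]
      simp only [mul_assoc]
      rw [Matrix.mul_nonsing_inv_cancel_left _ _ hd]
  rw [this, hm, mul_zero, zero_mul]

lemma step3core {n : ℕ} {ι : Type*} [Fintype ι] (F : ι → ℕ → Submodule ℂ (Vc n)) (hF : ∀ i, IsFlag (F i))
    (ξ : ι → ℕ → ℂ) (B : ι → Mt n) (hB : ∀ i, FC (ξ i) (F i) (B i)) (htr : ∑ i, (B i).trace = 0)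
    (g : ι → Mt n) (hg : ∀ i, IsUnit (g i))
    (hE : ∀ θ : Mt n, (∀ i, θ ∈ pS (gF (g i) (F i))) → ∃ c : ℂ, IsNilpotent (θ - c • (1 : Mt n))) :
    ∃ η : ι → Mt n, (∀ i, η i ∈ nS (F i)) ∧ ∑ i, g i * (B i + η i) * (g i)⁻¹ = 0 := by
  classical
  have hd := fun i => (Matrix.isUnit_iff_isUnit_det (g i)).1 (hg i)
  let Φ : ((i : ι) → nS (F i)) →ₗ[ℂ] Mt n := ∑ i, LinearMap.mulLeft ℂ (g i) ∘ₗ LinearMap.mulRight ℂ (g i)⁻¹ ∘ₗ (nS (F i)).subtype ∘ₗ LinearMap.proj i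
  have hΦ : ∀ x, Φ x = ∑ i, g i * (x i).1 * (g i)⁻¹ := by
    intro x; simp [Φ, mul_assoc]
  have hmem : -∑ i, g i * B i * (g i)⁻¹ ∈ LinearMap.range Φ := by
    apply mem_of_tr
    intro θ hθ
    have hp : ∀ i, θ ∈ pS (gF (g i) (F i)) := by
      intro i
      refine pS_of_tr (gF_flag (hg i) (hF i)) fun y hy => ?_
      refine hθ y ⟨Pi.single i ⟨_, (gF_nS (hg i)).1 hy⟩, ?_⟩
      rw [hΦ, Finset.sum_eq_single i]
      · simp [mul_assoc, Matrix.mul_nonsing_inv_cancel_left _ _ (hd i), Matrix.mul_nonsing_inv _ (hd i)]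
      · intro j _ hj
        rw [Pi.single_eq_of_ne hj]; simp
      · simp
    obtain ⟨c, hc⟩ := hE θ hp
    have h1 : ∀ i, (θ * (g i * B i * (g i)⁻¹)).trace = c * (B i).trace := by
      intro i
      set u := θ - c • (1 : Mt n) with hu
      have e1 : θ = u + c • 1 := by rw [hu]; abel
      have hup : u ∈ pS (gF (g i) (F i)) := (pS _).sub_mem (hp i) ((pS _).smul_mem c pS_one)
      have h2 := tr_nilp_FC (hF i) (hB i) ((gF_pS (hg i)).1 hup) (conj_isNilpotent (hg i) hc)
      have e2 : (u * (g i * B i * (g i)⁻¹)).trace = ((g i)⁻¹ * u * g i * B i).trace := by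
        rw [← mul_assoc, Matrix.trace_mul_comm, mul_assoc, mul_assoc]
      have e3 : (g i * B i * (g i)⁻¹).trace = (B i).trace := by
        rw [Matrix.trace_mul_comm, ← mul_assoc, Matrix.nonsing_inv_mul _ (hd i), one_mul]
      rw [e1, add_mul, Matrix.trace_add, e2, h2, smul_mul_assoc, one_mul, Matrix.trace_smul, e3, zero_add, smul_eq_mul]
    rw [mul_neg, Matrix.trace_neg, Finset.mul_sum, Matrix.trace_sum, Finset.sum_congr rfl (fun i _ => h1 i), ← Finset.mul_sum, htr, mul_zero, neg_zero]
  obtain ⟨η, hη⟩ := hmem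
  refine ⟨fun i => (η i).1, fun i => (η i).2, ?_⟩
  rw [hΦ] at hη
  simp only [mul_add, add_mul, Finset.sum_add_distrib]
  rw [hη, add_neg_cancel]

lemma diag_of_eig {n : ℕ} (Y : Mt n) (μ : Fin n → ℂ) (hμ : Function.Injective μ) (h : ∀ k, ∃ v : Vc n, v ≠ 0 ∧ Y.mulVec v = μ k • v) :
    ∃ S : Mt n, IsUnit S ∧ Y * S = S * Matrix.diagonal μ := by
  choose v hv0 hv using h
  have hli : LinearIndependent ℂ v :=
    Module.End.eigenvectors_linearIndependent' Y.toLin' μ hμ v (fun k => by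
      rw [Module.End.hasEigenvector_iff, Module.End.mem_eigenspace_iff]
      exact ⟨by rw [Matrix.toLin'_apply]; exact hv k, hv0 k⟩)
  refine ⟨Matrix.of fun i j => v j i, ?_, ?_⟩
  · rw [← Matrix.linearIndependent_cols_iff_isUnit]
    exact hli
  · ext i j
    rw [Matrix.mul_diagonal, Matrix.mul_apply]
    have := congrFun (hv j) i
    simp only [Matrix.mulVec, dotProduct, Pi.smul_apply, smul_eq_mul] at this
    simp only [Matrix.of_apply]
    rw [this, mul_comm]

lemma FC_eig {n : ℕ} {ξ : ℕ → ℂ} {F : ℕ → Submodule ℂ (Vc n)} {Y : Mt n} (hY : FC ξ F Y) (k : ℕ) (hk : 0 < mF F k) :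
    ∃ v : Vc n, v ≠ 0 ∧ Y.mulVec v = ξ k • v := by
  by_contra! hne
  let f : F (k+1) →ₗ[ℂ] F k := LinearMap.restrict (Y.mulVecLin - ξ k • LinearMap.id) (hY k)
  have hf : Function.Injective f := by
    rw [injective_iff_map_eq_zero]
    intro v hv
    have h1 : Y.mulVec v.1 - ξ k • v.1 = 0 := congrArg Subtype.val hv
    by_contra hv0
    exact hne v.1 (fun h => hv0 (Subtype.ext h)) (sub_eq_zero.1 h1)
  have := LinearMap.finrank_le_finrank_of_injective hf
  unfold mF at hk
  omega

lemma comm_diag {n : ℕ} {μ : Fin n → ℂ} (hμ : Function.Injective μ) {θ : Mt n} (h : θ * Matrix.diagonal μ = Matrix.diagonal μ * θ) :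
    θ = Matrix.diagonal (fun i => θ i i) := by
  ext i j
  by_cases hij : i = j
  · subst hij; simp
  · rw [Matrix.diagonal_apply_ne _ hij]
    have := congrFun (congrFun h i) j
    rw [Matrix.mul_diagonal, Matrix.diagonal_mul, mul_comm] at this
    have h2 : (μ j - μ i) * θ i j = 0 := by rw [sub_mul, this, sub_self]
    rcases mul_eq_zero.1 h2 with h3 | h3
    · exact absurd (hμ (sub_eq_zero.1 h3)).symm hij
    · exact h3

lemma diag_poly {n : ℕ} {μ : Fin n → ℂ} (hμ : Function.Injective μ) (t : Fin n → ℂ) :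
    ∃ q : ℂ[X], aeval (Matrix.diagonal μ) q = Matrix.diagonal t := by
  refine ⟨Lagrange.interpolate Finset.univ μ t, ?_⟩
  have : ∀ q : ℂ[X], aeval (Matrix.diagonal μ) q = Matrix.diagonal (fun i => q.eval (μ i)) := by
    intro q
    have h1 := Polynomial.aeval_algHom_apply (Matrix.diagonalAlgHom (n := Fin n) (α := ℂ) ℂ) μ q
    rw [Matrix.diagonalAlgHom_apply] at h1
    rw [h1, Matrix.diagonalAlgHom_apply]
    congr 1
    funext i
    have h2 := Polynomial.aeval_algHom_apply (Pi.evalAlgHom ℂ (fun _ : Fin n => ℂ) i) μ q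
    simp [Polynomial.aeval_def] at h2 ⊢
  rw [this]
  congr 1
  funext i
  rw [Lagrange.eval_interpolate_at_node _ hμ.injOn (Finset.mem_univ i)]

lemma diag_nilp {n : ℕ} {t : Fin n → ℂ} (h : IsNilpotent (Matrix.diagonal t)) : t = 0 := by
  obtain ⟨m, hm⟩ := h
  rw [Matrix.diagonal_pow] at hm
  funext i
  have := congrFun (congrFun hm i) i
  simp at this
  exact this.1
end

section
open Module Filter Topology
lemma mF_gF {n : ℕ} {g : Mt n} (hg : IsUnit g) (F : ℕ → Submodule ℂ (Vc n)) (k : ℕ) : mF (gF g F) k = mF F k := by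
  unfold mF; rw [gF_fin hg, gF_fin hg]

/-- data of the additive problem in flag form -/
structure SolD {n p : ℕ} (F : Fin p → ℕ → Submodule ℂ (Vc n)) (B : Fin p → Mt n) (μ : Fin n → ℂ)
    (g C : Fin p → Mt n) : Prop where
  unit : ∀ i, IsUnit (g i)
  conj : ∀ i, (g i)⁻¹ * C i * g i - B i ∈ nS (F i)
  sum : ∑ i, C i = -Matrix.diagonal μ
  endo : ∀ θ : Mt n, (∀ i, θ * C i = C i * θ) → (∀ i, θ ∈ pS (gF (g i) (F i))) → ∃ c : ℂ, θ = c • (1 : Mt n)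

lemma fl_diag {n : ℕ} (μ : Fin n → ℂ) (hμ : Function.Injective μ) (ξ : ℕ → ℂ) (hξ : ∀ k : Fin n, ξ k = μ k) :
    IsFlag (fl ξ (Matrix.diagonal μ)) ∧ ∀ k < n, mF (fl ξ (Matrix.diagonal μ)) k = 1 := by
  have h1 : IsFlag (fl ξ (Matrix.diagonal μ)) := by
    apply fl_flag
    rw [Matrix.charpoly_diagonal]
    exact Finset.prod_congr rfl fun k _ => by rw [hξ]
  refine ⟨h1, ?_⟩
  have h2 : ∀ k ∈ Finset.range n, mF (fl ξ (Matrix.diagonal μ)) k ≤ 1 := by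
    intro k hk
    rw [Finset.mem_range] at hk
    have h3 := fl_mF ξ (Matrix.diagonal μ) k
    have h4 : Matrix.diagonal μ - ξ k • (1 : Mt n) = Matrix.diagonal (fun i => μ i - ξ k) := by
      rw [Matrix.smul_one_eq_diagonal, Matrix.diagonal_sub]
    rw [h4, Matrix.rank_diagonal] at h3
    have h5 : Fintype.card {i : Fin n // μ i - ξ k ≠ 0} = n - 1 := by
      have e : ∀ i : Fin n, μ i - ξ k ≠ 0 ↔ i ≠ ⟨k, hk⟩ := by
        intro i
        have := hξ ⟨k, hk⟩
        simp only at this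
        rw [this, sub_ne_zero]
        exact hμ.ne_iff
      rw [Fintype.card_congr (Equiv.subtypeEquivRight e), Fintype.card_subtype_compl]
      simp
    rw [h5] at h3
    omega
  have h3 := mF_sum h1
  have h4 : ∑ k ∈ Finset.range n, mF (fl ξ (Matrix.diagonal μ)) k = ∑ k ∈ Finset.range n, 1 := by rw [h3]; simp
  have h5 := (Finset.sum_eq_sum_iff_of_le h2).1 h4
  intro k hk
  exact h5 k (Finset.mem_range.2 hk)

lemma conj_aeval {n : ℕ} {T : Mt n} (hT : IsUnit T) (x : Mt n) (q : ℂ[X]) : aeval (T * x * T⁻¹) q = T * aeval x q * T⁻¹ := by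
  have hd := (Matrix.isUnit_iff_isUnit_det T).1 hT
  induction q using Polynomial.induction_on' with
  | add p q hp hq => rw [map_add, map_add, hp, hq, mul_add, add_mul]
  | monomial m a =>
    rw [aeval_monomial, aeval_monomial, ← Algebra.smul_def, ← Algebra.smul_def, mul_smul_comm, smul_mul_assoc]
    congr 1
    induction m with
    | zero => simp [Matrix.mul_nonsing_inv _ hd]
    | succ m ih =>
      rw [pow_succ, ih, pow_succ]
      simp only [mul_assoc]
      rw [Matrix.nonsing_inv_mul_cancel_left _ _ hd]

theorem step3 {n p : ℕ} (hn : 1 ≤ n) (F : Fin p → ℕ → Submodule ℂ (Vc n)) (hF : ∀ i, IsFlag (F i)) (ξ : Fin p → ℕ → ℂ)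
    (B : Fin p → Mt n) (hB : ∀ i, FC (ξ i) (F i) (B i)) (μ : Fin n → ℂ) (hμ : Function.Injective μ)
    (htr : ∑ i, μ i + ∑ i, (B i).trace = 0)
    (hnum : ∀ g : Fin p → Mt n, (∀ i, IsUnit (g i)) → ∀ W : Submodule ℂ (Vc n), 0 < finrank ℂ W → finrank ℂ W < n →
      ((finrank ℂ W : ℤ) * (n - finrank ℂ W)) < ∑ i, ((finrank ℂ W : ℤ) * (n - finrank ℂ W) -
        ∑ k ∈ Finset.range n, aW W (gF (g i) (F i)) k * (mF (gF (g i) (F i)) k - aW W (gF (g i) (F i)) k))) :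
    ∃ g C, SolD F B μ g C := by
  let ξ0 : ℕ → ℂ := fun k => if h : k < n then μ ⟨k, h⟩ else 0
  have hξ0 : ∀ k : Fin n, ξ0 k = μ k := fun k => by simp [ξ0]
  obtain ⟨hF0, hm0⟩ := fl_diag μ hμ ξ0 hξ0
  set F0 := fl ξ0 (Matrix.diagonal μ) with hF0def
  let F' : Fin (p+1) → ℕ → Submodule ℂ (Vc n) := Fin.cons F0 F
  let B' : Fin (p+1) → Mt n := Fin.cons (Matrix.diagonal μ) B
  let ξ' : Fin (p+1) → ℕ → ℂ := Fin.cons ξ0 ξ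
  have hF' : ∀ i, IsFlag (F' i) := fun i => by
    refine Fin.cases ?_ (fun i => ?_) i
    · exact hF0
    · exact hF i
  have hB' : ∀ i, FC (ξ' i) (F' i) (B' i) := fun i => by
    refine Fin.cases ?_ (fun i => ?_) i
    · exact fl_FC ξ0 _
    · exact hB i
  obtain ⟨g, hg, hE⟩ := step2 hn F' hF' (by
    intro g hg W hW0 hWn
    rw [Fin.sum_univ_succ]
    have h1 := hnum (fun i => g i.succ) (fun i => hg _) W hW0 hWn
    have h2 : ∑ k ∈ Finset.range n, aW W (gF (g 0) (F' 0)) k * (mF (gF (g 0) (F' 0)) k - aW W (gF (g 0) (F' 0)) k) = 0 := by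
      apply Finset.sum_eq_zero
      intro k hk
      have f := gF_flag (hg 0) (hF' 0)
      have a1 := aW_nonneg W f k
      have a2 := aW_le W f k
      have a3 : mF (gF (g 0) (F' 0)) k = 1 := by rw [mF_gF (hg 0)]; exact hm0 k (Finset.mem_range.1 hk)
      rw [a3] at a2 ⊢
      have : aW W (gF (g 0) (F' 0)) k = 0 ∨ aW W (gF (g 0) (F' 0)) k = 1 := by omega
      rcases this with h | h <;> rw [h] <;> simp
    rw [h2]
    have h3 : ∀ i : Fin p, F' i.succ = F i := fun i => rfl
    simp only [h3]
    linarith)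
  obtain ⟨η, hη, hsum⟩ := step3core F' hF' ξ' B' hB' (by
    rw [Fin.sum_univ_succ]
    change (Matrix.diagonal μ).trace + ∑ i, (B i).trace = 0
    rw [Matrix.trace_diagonal, htr]) g hg hE
  have hY0 := FC_add (hB' 0) (hη 0)
  obtain ⟨S, hS, hYS⟩ := diag_of_eig (B' 0 + η 0) μ hμ (fun k => by
    rw [← hξ0 k]
    apply FC_eig hY0 k
    have := hm0 k k.2
    change 0 < mF F0 k
    omega)
  set T := g 0 * S with hT
  have hTu : IsUnit T := (hg 0).mul hS
  have hTd := (Matrix.isUnit_iff_isUnit_det T).1 hTu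
  have hSd := (Matrix.isUnit_iff_isUnit_det S).1 hS
  have hgd := fun i => (Matrix.isUnit_iff_isUnit_det (g i)).1 (hg i)
  have hC0 : g 0 * (B' 0 + η 0) * (g 0)⁻¹ = T * Matrix.diagonal μ * T⁻¹ := by
    have : B' 0 + η 0 = S * Matrix.diagonal μ * S⁻¹ := by
      rw [← hYS, Matrix.mul_nonsing_inv_cancel_right _ _ hSd]
    rw [this, hT, Matrix.mul_inv_rev]
    simp only [mul_assoc]
  have hTi : IsUnit T⁻¹ := (Matrix.isUnit_nonsing_inv_iff).2 hTu
  have hgi : ∀ i : Fin p, (T⁻¹ * g i.succ)⁻¹ = (g i.succ)⁻¹ * T := by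
    intro i
    rw [Matrix.mul_inv_rev, Matrix.nonsing_inv_nonsing_inv _ hTd]
  have hCC : ∑ i : Fin p, T⁻¹ * (g i.succ * (B i + η i.succ) * (g i.succ)⁻¹) * T = -Matrix.diagonal μ := by
    rw [← Finset.sum_mul, ← Finset.mul_sum]
    have h1 : ∑ i : Fin p, g i.succ * (B i + η i.succ) * (g i.succ)⁻¹ = -(T * Matrix.diagonal μ * T⁻¹) := by
      rw [Fin.sum_univ_succ, hC0] at hsum
      exact (neg_eq_of_add_eq_zero_right hsum).symm
    rw [h1, mul_neg, neg_mul]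
    simp only [mul_assoc]
    rw [Matrix.nonsing_inv_mul _ hTd, mul_one, Matrix.nonsing_inv_mul_cancel_left _ _ hTd]
  refine ⟨fun i => T⁻¹ * g i.succ, fun i => T⁻¹ * (g i.succ * (B i + η i.succ) * (g i.succ)⁻¹) * T, ?_, ?_, hCC, ?_⟩
  · intro i
    exact hTi.mul (hg _)
  · intro i
    rw [hgi]
    have : (g i.succ)⁻¹ * T * (T⁻¹ * (g i.succ * (B i + η i.succ) * (g i.succ)⁻¹) * T) * (T⁻¹ * g i.succ) = B i + η i.succ := by
      simp only [mul_assoc]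
      rw [Matrix.mul_nonsing_inv_cancel_left _ _ hTd, Matrix.mul_nonsing_inv_cancel_left _ _ hTd,
        Matrix.nonsing_inv_mul _ (hgd _), mul_one, Matrix.nonsing_inv_mul_cancel_left _ _ (hgd _)]
    rw [this, add_sub_cancel_left]
    exact hη i.succ
  · intro θ hcom hθ
    have h1 : θ * Matrix.diagonal μ = Matrix.diagonal μ * θ := by
      have : Matrix.diagonal μ = -∑ i : Fin p, T⁻¹ * (g i.succ * (B i + η i.succ) * (g i.succ)⁻¹) * T := by rw [hCC, neg_neg]
      rw [this, mul_neg, neg_mul, Finset.mul_sum, Finset.sum_mul, Finset.sum_congr rfl fun i _ => hcom i]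
    have h2 := comm_diag hμ h1
    set t : Fin n → ℂ := fun i => θ i i with ht
    obtain ⟨q, hq⟩ := diag_poly hμ t
    have h3 : ∀ i, T * θ * T⁻¹ ∈ pS (gF (g i) (F' i)) := by
      intro i
      refine Fin.cases ?_ (fun i => ?_) i
      · rw [h2, ← hq, ← conj_aeval hTu, ← hC0, conj_aeval (hg 0), gF_pS (hg 0)]
        simp only [mul_assoc]
        rw [Matrix.nonsing_inv_mul _ (hgd _), mul_one, Matrix.nonsing_inv_mul_cancel_left _ _ (hgd _)]
        exact aeval_pS (FC_pS (hF' 0) hY0) q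
      · have := hθ i
        rw [gF_mul, gF_pS hTi, Matrix.nonsing_inv_nonsing_inv _ hTd] at this
        exact this
    obtain ⟨c, hc⟩ := hE _ h3
    refine ⟨c, ?_⟩
    have h4 := conj_isNilpotent hTu hc
    have h5 : T⁻¹ * (T * θ * T⁻¹ - c • 1) * T = Matrix.diagonal (t - fun _ => c) := by
      rw [mul_sub, sub_mul]
      simp only [mul_assoc, mul_smul_comm, smul_mul_assoc, one_mul]
      rw [Matrix.nonsing_inv_mul _ hTd, mul_one, Matrix.nonsing_inv_mul_cancel_left _ _ hTd, h2, Matrix.smul_one_eq_diagonal, Matrix.diagonal_sub]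
      rfl
    rw [h5] at h4
    have h6 := diag_nilp h4
    rw [h2, sub_eq_zero.1 h6, Matrix.smul_one_eq_diagonal]
end

section
open Module Filter Topology
lemma curveA {E R : Type*} [NormedAddCommGroup E] [NormedSpace ℂ E] [CompleteSpace E] [NormedAddCommGroup R] [NormedSpace ℂ R]
    [FiniteDimensional ℂ R] {f : E → R} {f' : E →L[ℂ] R} (h4 : HasStrictFDerivAt f f' 0) (h6 : f'.range = ⊤) (v : E) (hv : f' v = 0) :
    ∃ x : ℂ → E, Tendsto (fun t => t⁻¹ • x t) (𝓝[≠] 0) (𝓝 v) ∧ ∀ᶠ t in 𝓝[≠] (0:ℂ), f (x t) = f 0 := by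
  have : CompleteSpace R := FiniteDimensional.complete ℂ R
  let w : f'.ker := ⟨v, hv⟩
  have h7 := h4.to_implicitFunction h6
  have h8 := h4.map_implicitFunction_eq h6
  have h9 := h4.implicitFunction_apply_image h6
  let x : ℂ → E := fun t => h4.implicitFunction f f' h6 (f 0) (t • w)
  have hx0 : x 0 = 0 := by
    simp only [x, zero_smul, h9]
  have hc : HasDerivAt (fun t : ℂ => t • w) w 0 := by
    simpa using (hasDerivAt_id (0:ℂ)).smul_const w
  have hxd : HasDerivAt x v 0 := by
    have := HasFDerivAt.comp_hasDerivAt (x := (0:ℂ)) (f := fun t : ℂ => t • w) (l := h4.implicitFunction f f' h6 (f 0)) (by rw [zero_smul]; exact h7.hasFDerivAt) hc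
    exact this
  have hsl := hasDerivAt_iff_tendsto_slope.1 hxd
  refine ⟨x, hsl.congr fun t => by simp [slope, hx0], ?_⟩
  have : Tendsto (fun t : ℂ => (f 0, t • w)) (𝓝[≠] 0) (𝓝 (f 0, 0)) := by
    refine Tendsto.prodMk_nhds tendsto_const_nhds ?_
    have := hc.continuousAt.tendsto
    rw [zero_smul] at this
    exact this.mono_left nhdsWithin_le_nhds
  exact this.eventually h8

lemma curve0 {R : Type*} [NormedRing R] [NormedAlgebra ℂ R] [FiniteDimensional ℂ R] {ι : Type*} [Fintype ι]
    (C : ι → R) (Z : Submodule ℂ (ι → R))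
    (hs : ∀ y : R, ∃ γ : ι → R, ∃ ζ ∈ Z, ∃ c : ℂ, ∑ i, (γ i * C i - C i * γ i + ζ i) + c • (1 : R) = y)
    (γ ζ : ι → R) (hζ : ζ ∈ Z) (hk : ∑ i, (γ i * C i - C i * γ i + ζ i) = 0) :
    ∃ (G : ℂ → ι → R) (η : ℂ → ι → R) (c : ℂ → ℂ), (∀ t, η t ∈ Z) ∧
      Tendsto (fun t => t⁻¹ • G t) (𝓝[≠] 0) (𝓝 γ) ∧ Tendsto (fun t => t⁻¹ • η t) (𝓝[≠] 0) (𝓝 ζ) ∧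
      ∀ᶠ t in 𝓝[≠] (0:ℂ), ∑ i, (1 + G t i) * (C i + η t i) * Ring.inverse (1 + G t i) + c t • (1 : R) = ∑ i, C i := by
  have : CompleteSpace R := FiniteDimensional.complete ℂ R
  have : CompleteSpace Z := FiniteDimensional.complete ℂ Z
  let f : ((ι → R) × Z × ℂ) → R := fun x => ∑ i, (1 + x.1 i) * (C i + x.2.1.1 i) * Ring.inverse (1 + x.1 i) + x.2.2 • (1 : R)
  let pg : ι → ((ι → R) × Z × ℂ) →L[ℂ] R := fun i => (ContinuousLinearMap.proj i).comp (ContinuousLinearMap.fst ℂ (ι → R) (Z × ℂ))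
  let pz : ι → ((ι → R) × Z × ℂ) →L[ℂ] R := fun i => (ContinuousLinearMap.proj i).comp (Z.subtypeL.comp
    ((ContinuousLinearMap.fst ℂ Z ℂ).comp (ContinuousLinearMap.snd ℂ (ι → R) (Z × ℂ))))
  let pc : ((ι → R) × Z × ℂ) →L[ℂ] ℂ := (ContinuousLinearMap.snd ℂ Z ℂ).comp (ContinuousLinearMap.snd ℂ (ι → R) (Z × ℂ))
  have h1 : ∀ i, HasStrictFDerivAt (fun x : ((ι → R) × Z × ℂ) => 1 + x.1 i) (pg i) 0 := fun i => ((pg i).hasStrictFDerivAt (x := 0)).const_add 1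
  have h2 : ∀ i, HasStrictFDerivAt (fun x : ((ι → R) × Z × ℂ) => C i + x.2.1.1 i) (pz i) 0 := fun i => ((pz i).hasStrictFDerivAt (x := 0)).const_add (C i)
  have h3 : ∀ i, ∃ d : ((ι → R) × Z × ℂ) →L[ℂ] R, HasStrictFDerivAt (fun x : ((ι → R) × Z × ℂ) => (1 + x.1 i) * (C i + x.2.1.1 i) * Ring.inverse (1 + x.1 i)) d 0 ∧
      ∀ x, d x = x.1 i * C i - C i * x.1 i + x.2.1.1 i := by
    intro i
    have a := hasStrictFDerivAt_ringInverse (𝕜 := ℂ) (1 : Rˣ)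
    have b : HasStrictFDerivAt (fun x : ((ι → R) × Z × ℂ) => Ring.inverse (1 + x.1 i)) _ (0:((ι → R) × Z × ℂ)) :=
      HasStrictFDerivAt.comp (0:((ι → R) × Z × ℂ)) (g := Ring.inverse) (f := fun x : ((ι → R) × Z × ℂ) => 1 + x.1 i) (by simpa using a) (h1 i)
    refine ⟨_, ((h1 i).mul' (h2 i)).mul' b, ?_⟩
    intro x
    simp [pg, pz]
    abel
  choose d hd hd' using h3
  have h4 : HasStrictFDerivAt f (∑ i, d i + pc.smulRight (1:R)) 0 := by
    have := (HasStrictFDerivAt.fun_sum (u := Finset.univ) fun i _ => hd i).add ((pc.smulRight (1:R)).hasStrictFDerivAt (x := 0))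
    exact this
  set f' := ∑ i, d i + pc.smulRight (1:R) with hf'
  have h5 : ∀ x : ((ι → R) × Z × ℂ), f' x = ∑ i, (x.1 i * C i - C i * x.1 i + x.2.1.1 i) + x.2.2 • (1:R) := by
    intro x
    simp [hf', hd', pc]
  have h6 : f'.range = ⊤ := by
    rw [LinearMap.range_eq_top]
    intro y
    obtain ⟨γ, ζ, hζ, c, h⟩ := hs y
    exact ⟨(γ, ⟨ζ, hζ⟩, c), by rw [← h]; exact h5 _⟩
  obtain ⟨x, hsl', hx⟩ := curveA h4 h6 (γ, ⟨ζ, hζ⟩, 0) ((h5 _).trans (by simp [hk]))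
  refine ⟨fun t => (x t).1, fun t => (x t).2.1.1, fun t => (x t).2.2, fun t => (x t).2.1.2, ?_, ?_, ?_⟩
  · exact (continuous_fst.tendsto _).comp hsl'
  · exact ((continuous_subtype_val.comp (continuous_fst.comp continuous_snd)).tendsto _).comp hsl'
  · filter_upwards [hx] with t ht
    have : f 0 = ∑ i, C i := by simp [f]
    rw [← this, ← ht]

section
attribute [local instance] Matrix.linftyOpNormedRing Matrix.linftyOpNormedAlgebra

lemma curve1 {n : ℕ} {ι : Type*} [Fintype ι]
    (C : ι → Mt n) (Z : Submodule ℂ (ι → Mt n))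
    (hs : ∀ y : Mt n, ∃ γ : ι → Mt n, ∃ ζ ∈ Z, ∃ c : ℂ, ∑ i, (γ i * C i - C i * γ i + ζ i) + c • (1 : Mt n) = y)
    (γ ζ : ι → Mt n) (hζ : ζ ∈ Z) (hk : ∑ i, (γ i * C i - C i * γ i + ζ i) = 0) :
    ∃ (G : ℂ → ι → Mt n) (η : ℂ → ι → Mt n) (c : ℂ → ℂ), (∀ t, η t ∈ Z) ∧
      Tendsto (fun t => t⁻¹ • G t) (𝓝[≠] 0) (𝓝 γ) ∧ Tendsto (fun t => t⁻¹ • η t) (𝓝[≠] 0) (𝓝 ζ) ∧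
      ∀ᶠ t in 𝓝[≠] (0:ℂ), ∑ i, (1 + G t i) * (C i + η t i) * (1 + G t i)⁻¹ + c t • (1 : Mt n) = ∑ i, C i := by
  simp only [Matrix.nonsing_inv_eq_ringInverse]
  exact curve0 C Z hs γ ζ hζ hk
end

lemma tr_comm0 {n : ℕ} (a b : Mt n) : (a * b - b * a).trace = 0 := by
  rw [Matrix.trace_sub, Matrix.trace_mul_comm, sub_self]

lemma smul_eq_zero_of_tr {n : ℕ} {c : ℂ} (h : (c • (1 : Mt n)).trace = 0) : c • (1 : Mt n) = 0 := by
  rcases Nat.eq_zero_or_pos n with rfl | hn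
  · exact Subsingleton.elim _ _
  · rw [Matrix.trace_smul, Matrix.trace_one, smul_eq_mul, mul_eq_zero] at h
    rcases h with h | h
    · rw [h, zero_smul]
    · simp at h; omega

lemma curve {n : ℕ} {ι : Type*} [Fintype ι]
    (C : ι → Mt n) (Z : Submodule ℂ (ι → Mt n)) (hZ : ∀ ζ ∈ Z, ∀ i, (ζ i).trace = 0)
    (hd : ∀ θ : Mt n, θ.trace = 0 → (∀ i, θ * C i = C i * θ) → (∀ ζ ∈ Z, (θ * ∑ i, ζ i).trace = 0) → ∃ c : ℂ, θ = c • (1 : Mt n))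
    (γ ζ : ι → Mt n) (hζ : ζ ∈ Z) (hk : ∑ i, (γ i * C i - C i * γ i + ζ i) = 0) :
    ∃ (G : ℂ → ι → Mt n) (η : ℂ → ι → Mt n), (∀ t, η t ∈ Z) ∧
      (∀ i, Tendsto (fun t => t⁻¹ • G t i) (𝓝[≠] 0) (𝓝 (γ i))) ∧ (∀ i, Tendsto (fun t => t⁻¹ • η t i) (𝓝[≠] 0) (𝓝 (ζ i))) ∧
      (∀ i, Tendsto (fun t => G t i) (𝓝[≠] 0) (𝓝 0)) ∧ (∀ i, Tendsto (fun t => η t i) (𝓝[≠] 0) (𝓝 0)) ∧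
      (∀ᶠ t in 𝓝[≠] (0:ℂ), ∀ i, IsUnit (1 + G t i)) ∧
      ∀ᶠ t in 𝓝[≠] (0:ℂ), ∑ i, (1 + G t i) * (C i + η t i) * (1 + G t i)⁻¹ = ∑ i, C i := by
  classical
  have hs : ∀ y : Mt n, ∃ γ : ι → Mt n, ∃ ζ ∈ Z, ∃ c : ℂ, ∑ i, (γ i * C i - C i * γ i + ζ i) + c • (1 : Mt n) = y := by
    let U : Submodule ℂ (Mt n) :=
      { carrier := {y | ∃ γ : ι → Mt n, ∃ ζ ∈ Z, ∃ c : ℂ, ∑ i, (γ i * C i - C i * γ i + ζ i) + c • (1 : Mt n) = y}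
        zero_mem' := ⟨0, 0, Z.zero_mem, 0, by simp⟩
        add_mem' := by
          rintro _ _ ⟨γ, ζ, hζ, c, rfl⟩ ⟨γ', ζ', hζ', c', rfl⟩
          refine ⟨γ + γ', ζ + ζ', Z.add_mem hζ hζ', c + c', ?_⟩
          simp only [Pi.add_apply, add_mul, mul_add, add_smul, Finset.sum_add_distrib, Finset.sum_sub_distrib]
          abel
        smul_mem' := by
          rintro a _ ⟨γ, ζ, hζ, c, rfl⟩
          refine ⟨a • γ, a • ζ, Z.smul_mem a hζ, a * c, ?_⟩
          simp only [Pi.smul_apply, smul_mul_assoc, mul_smul_comm, mul_smul, smul_add, smul_sub, Finset.smul_sum] }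
    intro y
    apply mem_of_tr U y
    intro θ hθ
    have h1 : θ.trace = 0 := by
      have := hθ 1 ⟨0, 0, Z.zero_mem, 1, by simp⟩
      simpa using this
    have h2 : ∀ i, θ * C i = C i * θ := by
      intro i
      have : ∀ x, ((C i * θ - θ * C i) * x).trace = 0 := by
        intro x
        have := hθ (x * C i - C i * x) ⟨Pi.single i x, 0, Z.zero_mem, 0, by
          rw [Finset.sum_eq_single i]
          · simp
          · intro j _ hj; simp [hj]
          · simp⟩
        rw [mul_sub, Matrix.trace_sub] at this
        rw [sub_mul, Matrix.trace_sub, ← this, ← Matrix.mul_assoc, Matrix.trace_mul_comm (θ * x), ← Matrix.mul_assoc, ← Matrix.mul_assoc]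
      have := tr_nondeg this
      exact (sub_eq_zero.1 this).symm
    obtain ⟨c, rfl⟩ := hd θ h1 h2 (by
      intro ζ hζ
      exact hθ _ ⟨0, ζ, hζ, 0, by simp⟩)
    rw [smul_eq_zero_of_tr h1]; simp
  obtain ⟨G, η, c, h1, h2, h3, h4⟩ := curve1 C Z hs γ ζ hζ hk
  have h2' := fun i => ((continuous_apply i).tendsto _).comp h2
  have h3' := fun i => ((continuous_apply i).tendsto _).comp h3
  have z : ∀ (H : ℂ → ι → Mt n) (a : ι → Mt n) (i), Tendsto (fun t => t⁻¹ • H t i) (𝓝[≠] 0) (𝓝 (a i)) →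
      Tendsto (fun t => H t i) (𝓝[≠] 0) (𝓝 0) := by
    intro H a i h
    have : Tendsto (fun t : ℂ => t) (𝓝[≠] 0) (𝓝 0) := tendsto_id.mono_left nhdsWithin_le_nhds
    have := this.smul h
    rw [zero_smul] at this
    refine this.congr' ?_
    filter_upwards [self_mem_nhdsWithin] with t ht
    rw [smul_smul, mul_inv_cancel₀ ht, one_smul]
  have hG := fun i => z G γ i (h2' i)
  have hu : ∀ᶠ t in 𝓝[≠] (0:ℂ), ∀ i, IsUnit (1 + G t i) := by
    rw [eventually_all]
    intro i
    have : Tendsto (fun t => (1 + G t i).det) (𝓝[≠] 0) (𝓝 1) := by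
      have a : Continuous fun x : Mt n => (1 + x).det := (continuous_const.add continuous_id).matrix_det
      have := (a.tendsto 0).comp (hG i)
      rw [add_zero, Matrix.det_one] at this
      exact this
    filter_upwards [this.eventually_ne one_ne_zero] with t ht
    rw [Matrix.isUnit_iff_isUnit_det]
    exact isUnit_iff_ne_zero.2 ht
  refine ⟨G, η, h1, h2', h3', hG, fun i => z η ζ i (h3' i), hu, ?_⟩
  filter_upwards [hu, h4] with t ht ht4
  have : (c t • (1 : Mt n)).trace = 0 := by
    have e := congrArg Matrix.trace ht4
    rw [Matrix.trace_add, Matrix.trace_sum, Matrix.trace_sum] at e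
    have : ∀ i, ((1 + G t i) * (C i + η t i) * (1 + G t i)⁻¹).trace = (C i).trace := by
      intro i
      rw [Matrix.trace_mul_comm, Matrix.nonsing_inv_mul_cancel_left _ _ ((Matrix.isUnit_iff_isUnit_det _).1 (ht i)), Matrix.trace_add, hZ _ (h1 t), add_zero]
    simp only [this] at e
    simpa using e
  rw [smul_eq_zero_of_tr this, add_zero] at ht4
  exact ht4
end

section
open Module Filter Topology
section conn
variable {n : ℕ} {ι : Type*}

def CInv (C : ι → Mt n) (I : Finset (Fin n)) : Prop := ∀ i, ∀ j ∉ I, ∀ l ∈ I, C i j l = 0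

def HA (C : ι → Mt n) (F : ι → ℕ → Submodule ℂ (Vc n)) (I : Finset (Fin n)) (t : Fin n → ℂ) : Prop :=
  (∀ i, ∀ j, ∀ l ∈ I, (t j - t l) * C i j l = 0) ∧ ∀ i k v, v ∈ F i k → (∀ j ∉ I, v j = 0) → (fun j => t j * v j) ∈ F i k

def HB (C : ι → Mt n) (F : ι → ℕ → Submodule ℂ (Vc n)) (I : Finset (Fin n)) (t : Fin n → ℂ) : Prop :=
  (∀ i, ∀ j ∉ I, ∀ l, (t j - t l) * C i j l = 0) ∧ ∀ i k v, v ∈ F i k → ∃ w ∈ F i k, ∀ j ∉ I, w j = t j * v j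

lemma exists_conn (C : ι → Mt n) (F : ι → ℕ → Submodule ℂ (Vc n))
    (hE : ∀ s : Fin n → ℂ, (∀ i j l, (s j - s l) * C i j l = 0) → (∀ i k v, v ∈ F i k → (fun j => s j * v j) ∈ F i k) → ∀ j l, s j = s l)
    (I0 : Finset (Fin n)) (h0 : I0.Nonempty) (h1 : I0 ≠ Finset.univ) (hI0 : CInv C I0) :
    ∃ I : Finset (Fin n), I.Nonempty ∧ I ≠ Finset.univ ∧ CInv C I ∧ (∀ t, HA C F I t → ∀ j ∈ I, ∀ l ∈ I, t j = t l) ∧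
      ∀ t, HB C F I t → ∀ j ∉ I, ∀ l ∉ I, t j = t l := by
  classical
  obtain ⟨M, hM, hMm⟩ := Finset.exists_min_image (Finset.univ.filter fun I : Finset (Fin n) => I.Nonempty ∧ CInv C I ∧ I ⊆ I0)
    Finset.card ⟨I0, by simp [h0, hI0]⟩
  simp only [Finset.mem_filter, Finset.mem_univ, true_and] at hM hMm
  have hMc : ∀ t, HA C F M t → ∀ j ∈ M, ∀ l ∈ M, t j = t l := by
    intro t ht j hj l hl
    have hinv : CInv C (M.filter fun x => t x = t l) := by
      intro i x hx y hy
      rw [Finset.mem_filter] at hx hy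
      by_cases hxM : x ∈ M
      · have := ht.1 i x y hy.1
        rw [hy.2] at this
        exact (mul_eq_zero.1 this).resolve_left (fun h => hx ⟨hxM, sub_eq_zero.1 h⟩)
      · exact hM.2.1 i x hxM y hy.1
    have := hMm (M.filter fun x => t x = t l) ⟨⟨l, by simp [hl]⟩, hinv, (Finset.filter_subset _ _).trans hM.2.2⟩
    have := Finset.eq_of_subset_of_card_le (Finset.filter_subset _ _) this
    rw [← this, Finset.mem_filter] at hj
    exact hj.2
  have hMu : M ≠ Finset.univ := by
    rintro rfl
    exact h1 (Finset.univ_subset_iff.1 hM.2.2)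
  obtain ⟨I, hI, hIm⟩ := Finset.exists_max_image (Finset.univ.filter fun I : Finset (Fin n) => I.Nonempty ∧ I ≠ Finset.univ ∧ CInv C I ∧
      ∀ t, HA C F I t → ∀ j ∈ I, ∀ l ∈ I, t j = t l) Finset.card ⟨M, by simp only [Finset.mem_filter, Finset.mem_univ, true_and]; exact ⟨hM.1, hMu, hM.2.1, hMc⟩⟩
  simp only [Finset.mem_filter, Finset.mem_univ, true_and] at hI hIm
  obtain ⟨hIn, hIu, hIi, hIc⟩ := hI
  refine ⟨I, hIn, hIu, hIi, hIc, ?_⟩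
  intro t ht l0 hl0 j hj
  by_contra hne
  set K := I ∪ Finset.univ.filter (fun l => l ∉ I ∧ t l ≠ t j) with hK
  have mK : ∀ x, x ∉ K ↔ x ∉ I ∧ t x = t j := by
    intro x; simp [hK]; tauto
  have hIK : I ⊆ K := Finset.subset_union_left
  have hjK : j ∉ K := (mK j).2 ⟨hj, rfl⟩
  have hlK : l0 ∈ K := by
    by_contra h
    exact hne ((mK l0).1 h).2
  have hKi : CInv C K := by
    intro i x hx y hy
    rw [mK] at hx
    by_cases hyI : y ∈ I
    · exact hIi i x hx.1 y hyI
    · have := ht.1 i x hx.1 y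
      refine (mul_eq_zero.1 this).resolve_left (fun h => ?_)
      exact (mK y).2 ⟨hyI, by rw [← hx.2, sub_eq_zero.1 h]⟩ hy
  have hKc : ¬ ∀ t, HA C F K t → ∀ j ∈ K, ∀ l ∈ K, t j = t l := by
    intro h
    have := hIm K ⟨hIn.mono hIK, fun h => hjK (h ▸ Finset.mem_univ _), hKi, h⟩
    have := Finset.eq_of_subset_of_card_le hIK this
    rw [this] at hl0
    exact hl0 hlK
  push Not at hKc
  obtain ⟨t', ht', x, hx, y, hy, hxy⟩ := hKc
  obtain ⟨b0, hb0⟩ := hIn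
  have hb : ∀ l ∈ I, t' l = t' b0 := by
    intro l hl
    refine hIc t' ⟨fun i m q hq => ht'.1 i m q (hIK hq), fun i k v hv hv' => ht'.2 i k v hv fun m hm => hv' m fun h => hm (hIK h)⟩ l hl b0 hb0
  have key := hE (fun l => (t' l - t' b0) * (t l - t j)) (by
    intro i m l
    by_cases hC : C i m l = 0
    · rw [hC, mul_zero]
    suffices h : (t' m - t' b0) * (t m - t j) = (t' l - t' b0) * (t l - t j) by
      rw [h, sub_self, zero_mul]
    by_cases hl : l ∈ I
    · have hm : m ∈ I := by
        by_contra hm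
        exact hC (hIi i m hm l hl)
      rw [hb _ hl, hb _ hm]; ring
    · by_cases hlK : l ∈ K
      · have e := (mul_eq_zero.1 (ht'.1 i m l hlK)).resolve_right hC
        rw [sub_eq_zero] at e
        by_cases hm : m ∈ I
        · rw [← e, hb _ hm]; ring
        · have e' := (mul_eq_zero.1 (ht.1 i m hm l)).resolve_right hC
          rw [sub_eq_zero] at e'
          rw [e, e']
      · have e1 := ((mK l).1 hlK).2
        by_cases hm : m ∈ I
        · rw [hb _ hm, e1]; ring
        · have e' := (mul_eq_zero.1 (ht.1 i m hm l)).resolve_right hC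
          rw [sub_eq_zero] at e'
          rw [e', e1]; ring) (by
    intro i k v hv
    obtain ⟨w, hw, hw'⟩ := ht.2 i k v hv
    have h1 : w - t j • v ∈ F i k := Submodule.sub_mem _ hw (Submodule.smul_mem _ _ hv)
    have h2 := ht'.2 i k _ h1 (by
      intro m hm
      rw [mK] at hm
      simp [hw' m hm.1, hm.2])
    have h3 := Submodule.sub_mem _ h2 (Submodule.smul_mem _ (t' b0) h1)
    convert h3 using 1
    funext m
    by_cases hm : m ∈ I
    · simp [hb m hm]
    · simp [hw' m hm]; ring)
  have h4 : ∀ l ∈ K, t' l = t' b0 := by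
    intro l hl
    by_cases hlI : l ∈ I
    · exact hb l hlI
    · have := key l j
      simp only [sub_self, mul_zero] at this
      rcases mul_eq_zero.1 this with h | h
      · exact sub_eq_zero.1 h
      · exact absurd hl ((mK l).2 ⟨hlI, sub_eq_zero.1 h⟩)
  exact hxy (by rw [h4 x hx, h4 y hy])
end conn
end

section
open Module Filter Topology
lemma rank_LSC {n : ℕ} {τ : Type*} {l : Filter τ} (M : τ → Mt n) (M0 : Mt n) (h : Tendsto M l (𝓝 M0)) :
    ∀ᶠ t in l, M0.rank ≤ (M t).rank :=
  LSC (fun t => (M t).mulVecLin) M0.mulVecLin fun e =>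
    ((Continuous.matrix_mulVec continuous_id (continuous_const (y := e))).tendsto M0).comp h

lemma inv_tendsto {n : ℕ} {τ : Type*} {l : Filter τ} (G : τ → Mt n) (h : Tendsto G l (𝓝 0)) :
    Tendsto (fun t => (1 + G t)⁻¹) l (𝓝 1) := by
  have a : ContinuousAt (fun x : Mt n => (1 + x)⁻¹) 0 := by
    simp only [Matrix.inv_def, Ring.inverse_eq_inv']
    have c1 : Continuous fun x : Mt n => 1 + x := continuous_const.add continuous_id
    exact (c1.matrix_det.continuousAt.inv₀ (by simp)).smul c1.matrix_adjugate.continuousAt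
  have := a.tendsto.comp h
  rw [add_zero, inv_one] at this
  exact this

section
variable {n : ℕ} {ι : Type*}
def endM (C : ι → Mt n) (c d : ι → Fin (n+1) → Mt n) (g : ι → Mt n) : Mt n →ₗ[ℂ] (ι → Mt n) × (ι → Fin (n+1) → Mt n) where
  toFun x := (fun i => x * C i - C i * x, fun i j => c i j * ((g i).adjugate * x * g i) * d i j)
  map_add' x y := by
    refine Prod.ext (funext fun i => ?_) (funext fun i => funext fun j => ?_)
    · simp only [Prod.mk_add_mk, Pi.add_apply, add_mul, mul_add]; abel
    · simp only [Prod.mk_add_mk, Pi.add_apply, add_mul, mul_add]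
  map_smul' a x := by
    refine Prod.ext (funext fun i => ?_) (funext fun i => funext fun j => ?_)
    · simp [smul_sub]
    · simp

lemma endM_ker (F : ι → ℕ → Submodule ℂ (Vc n)) (hF : ∀ i, IsFlag (F i)) (c d : ι → Fin (n+1) → Mt n)
    (hc : ∀ i (j : Fin (n+1)) v, (c i j).mulVec v = 0 ↔ v ∈ F i (j:ℕ)) (hd : ∀ i (j : Fin (n+1)) v, v ∈ F i (j:ℕ) ↔ ∃ w, (d i j).mulVec w = v)
    (C g : ι → Mt n) (hg : ∀ i, IsUnit (g i)) (x : Mt n) :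
    x ∈ LinearMap.ker (endM C c d g) ↔ (∀ i, x * C i = C i * x) ∧ ∀ i, x ∈ pS (gF (g i) (F i)) := by
  rw [LinearMap.mem_ker]
  change ((fun i => x * C i - C i * x), (fun i j => c i j * ((g i).adjugate * x * g i) * d i j)) = 0 ↔ _
  rw [Prod.mk_eq_zero, funext_iff, funext_iff]
  simp only [funext_iff, Pi.zero_apply, sub_eq_zero]
  refine and_congr_right fun _ => forall_congr' fun i => ?_
  rw [gF_pS_adj (hg i), pS_iff_cd (hF i) (c i) (d i) (hc i) (hd i)]

lemma endo_open [Fintype ι] (hn : 1 ≤ n) (F : ι → ℕ → Submodule ℂ (Vc n)) (hF : ∀ i, IsFlag (F i))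
    (C g : ι → Mt n) (hg : ∀ i, IsUnit (g i))
    (hE : ∀ θ : Mt n, (∀ i, θ * C i = C i * θ) → (∀ i, θ ∈ pS (gF (g i) (F i))) → ∃ c : ℂ, θ = c • (1 : Mt n))
    {τ : Type*} {l : Filter τ} (Ct gt : τ → ι → Mt n) (hC : ∀ i, Tendsto (fun t => Ct t i) l (𝓝 (C i)))
    (hgt : ∀ i, Tendsto (fun t => gt t i) l (𝓝 (g i))) (hu : ∀ᶠ t in l, ∀ i, IsUnit (gt t i)) :
    ∀ᶠ t in l, ∀ θ : Mt n, (∀ i, θ * Ct t i = Ct t i * θ) → (∀ i, θ ∈ pS (gF (gt t i) (F i))) → ∃ c : ℂ, θ = c • (1 : Mt n) := by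
  choose c hc using fun i (j : Fin (n+1)) => exists_kerMat (F i j)
  choose d hd using fun i (j : Fin (n+1)) => exists_ranMat (F i j)
  have := LSC (l := l) (fun t => endM (Ct t) c d (gt t)) (endM C c d g) (by
    intro x
    refine Tendsto.prodMk_nhds (tendsto_pi_nhds.2 fun i => ?_) (tendsto_pi_nhds.2 fun i => tendsto_pi_nhds.2 fun j => ?_)
    · have a : Continuous fun y : Mt n => x * y - y * x := (continuous_const.mul continuous_id).sub (continuous_id.mul continuous_const)
      exact (a.tendsto _).comp (hC i)
    · have a : Continuous fun y : Mt n => c i j * (y.adjugate * x * y) * d i j :=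
        (continuous_const.mul ((continuous_id.matrix_adjugate.mul continuous_const).mul continuous_id)).mul continuous_const
      exact (a.tendsto _).comp (hgt i))
  filter_upwards [this, hu] with t h1 h2 θ hθ1 hθ2
  have a1 := LinearMap.finrank_range_add_finrank_ker (endM (Ct t) c d (gt t))
  have a2 := LinearMap.finrank_range_add_finrank_ker (endM C c d g)
  have one_mem : (1 : Mt n) ∈ LinearMap.ker (endM (Ct t) c d (gt t)) := by
    rw [endM_ker F hF c d hc hd _ _ h2]
    exact ⟨fun i => by rw [one_mul, mul_one], fun i => pS_one⟩
  have a3 : finrank ℂ (LinearMap.ker (endM C c d g)) ≤ 1 := by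
    have : LinearMap.ker (endM C c d g) ≤ Submodule.span ℂ {(1 : Mt n)} := by
      intro x hx
      rw [endM_ker F hF c d hc hd _ _ hg] at hx
      obtain ⟨a, rfl⟩ := hE x hx.1 hx.2
      exact Submodule.smul_mem _ _ (Submodule.mem_span_singleton_self _)
    exact (Submodule.finrank_mono this).trans ((finrank_span_le_card _).trans (by simp))
  have a4 : finrank ℂ (LinearMap.ker (endM (Ct t) c d (gt t))) ≤ 1 := by omega
  have : Nonempty (Fin n) := ⟨⟨0, hn⟩⟩
  have hne : (⟨1, one_mem⟩ : LinearMap.ker (endM (Ct t) c d (gt t))) ≠ 0 := by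
    intro h
    exact one_ne_zero (congrArg Subtype.val h)
  have a5 : finrank ℂ (LinearMap.ker (endM (Ct t) c d (gt t))) = 1 := by
    have := (Module.finrank_pos_iff_exists_ne_zero (R := ℂ)).2 ⟨_, hne⟩
    omega
  obtain ⟨a, ha⟩ := (finrank_eq_one_iff_of_nonzero' _ hne).1 a5 ⟨θ, (endM_ker F hF c d hc hd _ _ h2 θ).2 ⟨hθ1, hθ2⟩⟩
  exact ⟨a, (congrArg Subtype.val ha).symm⟩
end

lemma deform {n p : ℕ} (hn : 1 ≤ n) {F : Fin p → ℕ → Submodule ℂ (Vc n)} (hF : ∀ i, IsFlag (F i)) {B : Fin p → Mt n} {μ : Fin n → ℂ}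
    {g C : Fin p → Mt n} (hs : SolD F B μ g C) (γ ζ : Fin p → Mt n) (hζ : ∀ i, ζ i ∈ nS (gF (g i) (F i)))
    (hk : ∑ i, (γ i * C i - C i * γ i + ζ i) = 0) :
    ∃ (G : ℂ → Fin p → Mt n) (Ct : ℂ → Fin p → Mt n),
      (∀ i, Tendsto (fun t => t⁻¹ • G t i) (𝓝[≠] 0) (𝓝 (γ i))) ∧
      (∀ i, Tendsto (fun t => G t i) (𝓝[≠] 0) (𝓝 0)) ∧
      (∀ i, Tendsto (fun t => Ct t i) (𝓝[≠] 0) (𝓝 (C i))) ∧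
      (∀ i, Tendsto (fun t => t⁻¹ • (Ct t i - C i)) (𝓝[≠] 0) (𝓝 (γ i * C i - C i * γ i + ζ i))) ∧
      (∀ᶠ t in 𝓝[≠] (0:ℂ), SolD F B μ (fun i => (1 + G t i) * g i) (Ct t)) := by
  have hFl := fun i => gF_flag (hs.unit i) (hF i)
  let Z : Submodule ℂ (Fin p → Mt n) := Submodule.pi Set.univ fun i => nS (gF (g i) (F i))
  have mZ : ∀ x, x ∈ Z ↔ ∀ i, x i ∈ nS (gF (g i) (F i)) := by intro x; simp [Z, Submodule.mem_pi]
  obtain ⟨G, η, h1, h2, h3, h4, h5, h6, h7⟩ := curve C Z (fun x hx i => nilp_trace (nS_nilp (hFl i) ((mZ x).1 hx i))) (by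
    intro θ _ h1 h2
    refine hs.endo θ h1 fun i => pS_of_tr (hFl i) fun y hy => ?_
    have := h2 (Pi.single i y) ((mZ _).2 fun j => by
      by_cases hj : j = i
      · subst hj; simpa using hy
      · simp [hj])
    rwa [Finset.sum_eq_single i (fun j _ hj => by simp [hj]) (by simp), Pi.single_eq_same] at this) γ ζ ((mZ ζ).2 hζ) hk
  have h8 := fun i => inv_tendsto (fun t => G t i) (h4 i)
  have e1 : ∀ i, Tendsto (fun t => 1 + G t i) (𝓝[≠] 0) (𝓝 1) := fun i => by
    have := (tendsto_const_nhds (x := (1 : Mt n))).add (h4 i)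
    rwa [add_zero] at this
  have e2 : ∀ i, Tendsto (fun t => C i + η t i) (𝓝[≠] 0) (𝓝 (C i)) := fun i => by
    have := (tendsto_const_nhds (x := C i)).add (h5 i)
    rwa [add_zero] at this
  have e3 : ∀ i, Tendsto (fun t => (1 + G t i) * (C i + η t i) * (1 + G t i)⁻¹) (𝓝[≠] 0) (𝓝 (C i)) := fun i => by
    have := ((e1 i).mul (e2 i)).mul (h8 i)
    rwa [one_mul, mul_one] at this
  have hgt : ∀ i, Tendsto (fun t => (1 + G t i) * g i) (𝓝[≠] 0) (𝓝 (g i)) := fun i => by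
    have := (e1 i).mul_const (g i)
    rwa [one_mul] at this
  have hu : ∀ᶠ t in 𝓝[≠] (0:ℂ), ∀ i, IsUnit ((1 + G t i) * g i) := by
    filter_upwards [h6] with t ht i using (ht i).mul (hs.unit i)
  refine ⟨G, fun t i => (1 + G t i) * (C i + η t i) * (1 + G t i)⁻¹, h2, h4, e3, fun i => ?_, ?_⟩
  · have a := ((((h2 i).mul_const (C i)).sub ((h2 i).const_mul (C i))).add (h3 i)).add ((h2 i).mul (h5 i))
    have a := a.mul (h8 i)
    rw [mul_zero, add_zero, mul_one] at a
    refine a.congr' ?_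
    filter_upwards [h6] with t ht
    have hd := (Matrix.isUnit_iff_isUnit_det _).1 (ht i)
    have : C i = C i * (1 + G t i) * (1 + G t i)⁻¹ := by rw [Matrix.mul_nonsing_inv_cancel_right _ _ hd]
    conv_rhs => arg 2; arg 2; rw [this]
    rw [← sub_mul, ← smul_mul_assoc]
    congr 1
    simp only [smul_mul_assoc, mul_smul_comm, ← smul_sub, ← smul_add]
    congr 1
    noncomm_ring
  · filter_upwards [h6, hu, h7, endo_open hn F hF C g hs.unit hs.endo (fun t i => (1 + G t i) * (C i + η t i) * (1 + G t i)⁻¹) (fun t i => (1 + G t i) * g i) e3 hgt hu] with t t1 t2 t3 t4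
    refine ⟨t2, fun i => ?_, t3.trans hs.sum, t4⟩
    have hd := (Matrix.isUnit_iff_isUnit_det _).1 (t1 i)
    have : ((1 + G t i) * g i)⁻¹ * ((1 + G t i) * (C i + η t i) * (1 + G t i)⁻¹) * ((1 + G t i) * g i) = (g i)⁻¹ * C i * g i + (g i)⁻¹ * η t i * g i := by
      rw [Matrix.mul_inv_rev]
      simp only [mul_assoc]
      rw [Matrix.nonsing_inv_mul_cancel_left _ _ hd, Matrix.nonsing_inv_mul_cancel_left _ _ hd]
      simp only [add_mul, mul_add]
    rw [this, add_sub_right_comm]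
    exact Submodule.add_mem _ (hs.conj i) ((gF_nS (hs.unit i)).1 ((mZ _).1 (h1 t) i))
end

section
open Module Filter Topology
section
variable {n p : ℕ}

def PI (I : Finset (Fin n)) : Mt n := Matrix.diagonal (fun j => if j ∈ I then 1 else 0)

lemma PI_idem (I : Finset (Fin n)) : PI I * PI I = PI I := by
  unfold PI; rw [Matrix.diagonal_mul_diagonal]; congr 1; funext j; split_ifs <;> simp

lemma PI_mulVec (I : Finset (Fin n)) (v : Vc n) (j) : (PI I).mulVec v j = if j ∈ I then v j else 0 := by
  unfold PI; rw [Matrix.mulVec_diagonal]; simp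

lemma PI_fix {I : Finset (Fin n)} {v : Vc n} : (PI I).mulVec v = v ↔ ∀ j ∉ I, v j = 0 := by
  rw [funext_iff]; simp only [PI_mulVec]
  constructor
  · intro h j hj; have := h j; rw [if_neg hj] at this; exact this.symm
  · intro h j; split_ifs with hj; rfl; exact (h j hj).symm

lemma PI_apply (I : Finset (Fin n)) (M : Mt n) (j l) : ((1 - PI I) * M) j l = if j ∈ I then 0 else M j l := by
  unfold PI
  rw [sub_mul, one_mul, Matrix.sub_apply, Matrix.diagonal_mul]; split_ifs <;> simp

lemma PI_apply' (I : Finset (Fin n)) (M : Mt n) (j l) : (M * PI I) j l = if l ∈ I then M j l else 0 := by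
  unfold PI
  rw [Matrix.mul_diagonal]; split_ifs <;> simp

lemma PI_inv {I : Finset (Fin n)} {M : Mt n} : (1 - PI I) * M * PI I = 0 ↔ ∀ j ∉ I, ∀ l ∈ I, M j l = 0 := by
  constructor
  · intro h j hj l hl
    have := congrFun (congrFun h j) l
    rwa [PI_apply', PI_apply, if_pos hl, if_neg hj] at this
  · intro h
    ext j l
    rw [PI_apply', PI_apply]
    split_ifs with h1 h2
    · rfl
    · exact h j h2 l h1
    · rfl

lemma PI_rank (I : Finset (Fin n)) : (PI I).rank = I.card := by
  unfold PI
  rw [Matrix.rank_diagonal]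
  have : ∀ i : Fin n, (if i ∈ I then (1:ℂ) else 0) ≠ 0 ↔ i ∈ I := by intro i; simp
  rw [Fintype.card_congr (Equiv.subtypeEquivRight this)]; simp

def rkt (c : Fin p → Fin (n+1) → Mt n) (g C : Fin p → Mt n) (s : Finset (Fin n) × Fin p × Option (Fin (n+1))) : Mt n :=
  match s.2.2 with
  | none => (1 - PI s.1) * C s.2.1 * PI s.1
  | some k => c s.2.1 k * (g s.2.1).adjugate * PI s.1

noncomputable def msr (c : Fin p → Fin (n+1) → Mt n) (g C : Fin p → Mt n) : ℕ := ∑ s, (rkt c g C s).rank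

lemma exists_max {F : Fin p → ℕ → Submodule ℂ (Vc n)} {B : Fin p → Mt n} {μ : Fin n → ℂ} (c : Fin p → Fin (n+1) → Mt n)
    (h : ∃ g C, SolD F B μ g C) : ∃ g C, SolD F B μ g C ∧ ∀ g' C', SolD F B μ g' C' → msr c g' C' ≤ msr c g C := by
  let S : Set ℕ := {m | ∃ g C, SolD F B μ g C ∧ msr c g C = m}
  have h1 : S.Nonempty := by
    obtain ⟨g, C, h⟩ := h
    exact ⟨_, g, C, h, rfl⟩
  have h2 : BddAbove S := by
    refine ⟨Fintype.card (Finset (Fin n) × Fin p × Option (Fin (n+1))) * n, ?_⟩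
    rintro _ ⟨g, C, _, rfl⟩
    refine (Finset.sum_le_card_nsmul _ _ n fun s _ => (Matrix.rank_le_card_width _).trans (by simp)).trans (by simp)
  obtain ⟨g, C, h3, h4⟩ := Nat.sSup_mem h1 h2
  exact ⟨g, C, h3, fun g' C' h' => by rw [h4]; exact le_csSup h2 ⟨g', C', h', rfl⟩⟩

lemma key1 (hn : 1 ≤ n) {F : Fin p → ℕ → Submodule ℂ (Vc n)} (hF : ∀ i, IsFlag (F i)) {B : Fin p → Mt n} {μ : Fin n → ℂ}
    (c : Fin p → Fin (n+1) → Mt n) (hc : ∀ i (j : Fin (n+1)) v, (c i j).mulVec v = 0 ↔ v ∈ F i (j:ℕ))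
    {g C : Fin p → Mt n} (hs : SolD F B μ g C) (hm : ∀ g' C', SolD F B μ g' C' → msr c g' C' ≤ msr c g C)
    (I : Finset (Fin n)) (hI : CInv C I) (γ ζ : Fin p → Mt n) (hζ : ∀ i, ζ i ∈ nS (gF (g i) (F i)))
    (hk : ∑ i, (γ i * C i - C i * γ i + ζ i) = 0) (i : Fin p) :
    (1 - PI I) * (γ i * C i - C i * γ i + ζ i) * PI I = 0 ∧
    ∀ k w, (PI I).mulVec w = w → w ∈ gF (g i) (F i) k → ∃ u, (γ i).mulVec w - (PI I).mulVec u ∈ gF (g i) (F i) k := by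
  obtain ⟨G, Ct, h1, h2, h3, h4, h5⟩ := deform hn hF hs γ ζ hζ hk
  have a1 : ∀ i, Tendsto (fun t => 1 + G t i) (𝓝[≠] 0) (𝓝 1) := fun i => by
    have := (tendsto_const_nhds (x := (1 : Mt n))).add (h2 i)
    rwa [add_zero] at this
  have adj : ∀ i, Tendsto (fun t => (1 + G t i).adjugate) (𝓝[≠] 0) (𝓝 1) := fun i => by
    have := ((continuous_id.matrix_adjugate).tendsto _).comp (a1 i)
    simp only [id, Matrix.adjugate_one] at this
    exact this
  have adjt : ∀ i (a : Mt n), Tendsto (fun t => a * ((1 + G t i) * g i).adjugate * PI I) (𝓝[≠] 0) (𝓝 (a * (g i).adjugate * PI I)) := fun i a => by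
    simp only [Matrix.adjugate_mul_distrib]
    have := (((adj i).const_mul (g i).adjugate).const_mul a).mul_const (PI I)
    rwa [mul_one] at this
  have hr : ∀ s, ∀ᶠ t in 𝓝[≠] (0:ℂ), (rkt c g C s).rank ≤ (rkt c (fun i => (1 + G t i) * g i) (Ct t) s).rank := by
    rintro ⟨J, i, o⟩
    apply rank_LSC
    cases o with
    | none => exact ((h3 i).const_mul _).mul_const _
    | some k =>
      simp only [rkt, Matrix.adjugate_mul_distrib]
      have := (((adj i).const_mul (g i).adjugate).const_mul (c i k)).mul_const (PI J)
      rwa [mul_one] at this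
  have hr' : ∀ᶠ t in 𝓝[≠] (0:ℂ), ∀ s, (rkt c (fun i => (1 + G t i) * g i) (Ct t) s).rank = (rkt c g C s).rank := by
    filter_upwards [eventually_all.2 hr, h5] with t t1 t2 s
    have := (Finset.sum_eq_sum_iff_of_le fun s _ => t1 s).1 (le_antisymm (Finset.sum_le_sum fun s _ => t1 s) (hm _ _ t2))
    exact (this s (Finset.mem_univ s)).symm
  constructor
  · have b : Tendsto (fun t => (1 - PI I) * (t⁻¹ • (Ct t i - C i)) * PI I) (𝓝[≠] 0) (𝓝 ((1 - PI I) * (γ i * C i - C i * γ i + ζ i) * PI I)) :=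
      ((h4 i).const_mul _).mul_const _
    have z : Tendsto (fun t => (1 - PI I) * (t⁻¹ • (Ct t i - C i)) * PI I) (𝓝[≠] 0) (𝓝 0) := by
      refine tendsto_const_nhds.congr' ?_
      filter_upwards [hr'] with t ht
      have e0 : (1 - PI I) * C i * PI I = 0 := PI_inv.2 (hI i)
      have := ht (I, i, none)
      simp only [rkt, e0, Matrix.rank_zero] at this
      have := rank_zero this
      rw [mul_smul_comm, smul_mul_assoc, mul_sub, sub_mul, e0, this, sub_self, smul_zero]
    exact tendsto_nhds_unique b z
  · intro k w hw hwk
    rcases lt_or_ge n k with hkn | hkn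
    · have : gF (g i) (F i) k = ⊤ := by
        have hf := gF_flag (hs.unit i) (hF i)
        exact top_le_iff.1 (hf.top ▸ hf.mono hkn.le)
      rw [this]; exact ⟨0, trivial⟩
    have hdet := (Matrix.isUnit_iff_isUnit_det _).1 (hs.unit i)
    have hadj : (g i).adjugate = (g i).det • (g i)⁻¹ := by
      rw [Matrix.inv_def, smul_smul, Ring.mul_inverse_cancel _ hdet, one_smul]
    let kk : Fin (n+1) := ⟨k, by omega⟩
    have mem : ∀ v, (c i kk * (g i).adjugate).mulVec v = 0 ↔ v ∈ gF (g i) (F i) k := by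
      intro v
      rw [← Matrix.mulVec_mulVec, hc, mem_gF (hs.unit i), hadj, Matrix.smul_mulVec, Submodule.smul_mem_iff _ hdet.ne_zero]
    have hCR := CR (l := 𝓝[≠] (0:ℂ)) (fun t => (c i kk * ((1 + G t i) * g i).adjugate * PI I).mulVecLin) (c i kk * (g i).adjugate * PI I).mulVecLin
      (fun e => ((Continuous.matrix_mulVec continuous_id (continuous_const (y := e))).tendsto _).comp (adjt i (c i kk)))
      (fun t => -((c i kk * (g i).adjugate) * ((1 + G t i).adjugate * (t⁻¹ • G t i))).mulVec w) (-((c i kk * (g i).adjugate) * (1 * γ i)).mulVec w)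
      (((Continuous.matrix_mulVec continuous_id (continuous_const (y := w))).tendsto _).comp (((adj i).mul (h1 i)).const_mul _)).neg
      (by
        filter_upwards with t
        refine ⟨t⁻¹ • w, ?_⟩
        have e1 : (1 + G t i).adjugate * G t i = (1 + G t i).det • (1 : Mt n) - (1 + G t i).adjugate := by
          rw [← Matrix.adjugate_mul, mul_add, mul_one, add_sub_cancel_left]
        rw [Matrix.mulVecLin_apply, Matrix.adjugate_mul_distrib, Matrix.mulVec_smul, ← Matrix.mulVec_mulVec, hw, mul_smul_comm, e1,
          mul_smul_comm, Matrix.smul_mulVec, ← smul_neg, mul_sub, mul_smul_comm, mul_one, Matrix.sub_mulVec, Matrix.smul_mulVec, (mem w).2 hwk,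
          smul_zero, zero_sub, neg_neg, mul_assoc])
      (by
        filter_upwards [hr'] with t ht
        exact (ht (I, i, some kk)).le)
    obtain ⟨u, hu⟩ := hCR
    refine ⟨-u, (mem _).1 ?_⟩
    rw [Matrix.mulVecLin_apply, one_mul] at hu
    rw [Matrix.mulVec_sub, Matrix.mulVec_neg, Matrix.mulVec_neg, Matrix.mulVec_mulVec, Matrix.mulVec_mulVec, hu, sub_neg_eq_add, add_neg_cancel]
end
end

section
open Module Filter Topology
section
variable {n p : ℕ}

lemma tr_sg {e : Mt n} {F : ℕ → Submodule ℂ (Vc n)} (hF : IsFlag F) {σ γ : Mt n} (h1 : σ ∈ HS e) (h2 : σ ∈ nS F)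
    (h : ∀ k w, e.mulVec w = w → w ∈ F k → ∃ u, γ.mulVec w - e.mulVec u ∈ F k) : (σ * γ).trace = 0 := by
  apply nilp_trace
  have hW : ∀ v, e.mulVec (σ.mulVec v) = σ.mulVec v := fun v => by rw [Matrix.mulVec_mulVec, h1.1]
  have key : ∀ m k v, e.mulVec v = v → v ∈ F k → k ≤ m → ((σ * γ) ^ m).mulVec v = 0 := by
    intro m
    induction m with
    | zero =>
      intro k v _ hv hk
      have : k = 0 := by omega
      subst this
      rw [hF.bot, Submodule.mem_bot] at hv
      rw [hv, Matrix.mulVec_zero]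
    | succ m ih =>
      intro k v hev hv hk
      rcases k with _ | k
      · rw [hF.bot, Submodule.mem_bot] at hv
        rw [hv, Matrix.mulVec_zero]
      · rw [pow_succ, ← Matrix.mulVec_mulVec, ← Matrix.mulVec_mulVec]
        refine ih k _ (hW _) ?_ (by omega)
        obtain ⟨u, hu⟩ := h (k+1) v hev hv
        have := h2 k _ hu
        rwa [Matrix.mulVec_sub, Matrix.mulVec_mulVec _ σ e, h1.2, Matrix.zero_mulVec, sub_zero] at this
  refine ⟨n+1, mat_ext fun v => ?_⟩
  rw [pow_succ, ← Matrix.mulVec_mulVec, ← Matrix.mulVec_mulVec, Matrix.zero_mulVec]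
  exact key n n _ (hW _) (by rw [hF.top]; trivial) le_rfl

lemma key2 (hn : 1 ≤ n) {F : Fin p → ℕ → Submodule ℂ (Vc n)} (hF : ∀ i, IsFlag (F i)) {B : Fin p → Mt n} {μ : Fin n → ℂ}
    (c : Fin p → Fin (n+1) → Mt n) (hc : ∀ i (j : Fin (n+1)) v, (c i j).mulVec v = 0 ↔ v ∈ F i (j:ℕ))
    {g C : Fin p → Mt n} (hs : SolD F B μ g C) (hm : ∀ g' C', SolD F B μ g' C' → msr c g' C' ≤ msr c g C)
    (I : Finset (Fin n)) (hI : CInv C I) (τ σ : Fin p → Mt n) (hτ : ∀ i, τ i ∈ HS (PI I))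
    (hσ : ∀ i, σ i ∈ HS (PI I)) (hσ' : ∀ i, σ i ∈ nS (gF (g i) (F i))) :
    ∃ θ : Mt n, ∀ i, θ - τ i ∈ pS (gF (g i) (F i)) ∧ C i * (θ - τ i) - (θ - τ i) * C i = σ i := by
  have hFl := fun i => gF_flag (hs.unit i) (hF i)
  let E := (Fin p → Mt n) × ((i : Fin p) → nS (gF (g i) (F i)))
  let q : Fin p → E →ₗ[ℂ] Mt n := fun i =>
    (LinearMap.mulRight ℂ (C i) - LinearMap.mulLeft ℂ (C i)) ∘ₗ LinearMap.proj i ∘ₗ LinearMap.fst ℂ _ _ +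
      (nS (gF (g i) (F i))).subtype ∘ₗ LinearMap.proj i ∘ₗ LinearMap.snd ℂ _ _
  have hq : ∀ i x, q i x = x.1 i * C i - C i * x.1 i + (x.2 i).1 := fun i x => rfl
  let tr := Matrix.traceLinearMap (Fin n) ℂ ℂ
  let Ψ : E →ₗ[ℂ] Mt n := ∑ i, q i
  let Λ : E →ₗ[ℂ] ℂ := ∑ i, (tr ∘ₗ LinearMap.mulLeft ℂ (τ i) ∘ₗ q i + tr ∘ₗ LinearMap.mulLeft ℂ (σ i) ∘ₗ LinearMap.proj i ∘ₗ LinearMap.fst ℂ _ _)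
  have hΛ : ∀ x, Λ x = ∑ i, ((τ i * q i x).trace + (σ i * x.1 i).trace) := by
    intro x; simp only [Λ, LinearMap.sum_apply]; rfl
  have hmem : Λ ∈ (LinearMap.ker Ψ).dualAnnihilator := by
    rw [Submodule.mem_dualAnnihilator]
    intro x hx
    rw [LinearMap.mem_ker, LinearMap.sum_apply] at hx
    simp only [hq] at hx
    rw [hΛ]
    refine Finset.sum_eq_zero fun i _ => ?_
    obtain ⟨k1, k2⟩ := key1 hn hF c hc hs hm I hI x.1 (fun i => (x.2 i).1) (fun i => (x.2 i).2) hx i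
    rw [tr_sg (hFl i) (hσ i) (hσ' i) k2, add_zero, hq]
    have e1 : τ i = PI I * τ i * (1 - PI I) := by rw [(hτ i).1, mul_sub, mul_one, (hτ i).2, sub_zero]
    rw [e1, mul_assoc, mul_assoc, Matrix.trace_mul_comm, mul_assoc, k1, mul_zero, Matrix.trace_zero]
  rw [← LinearMap.range_dualMap_eq_dualAnnihilator_ker] at hmem
  obtain ⟨f, hf⟩ := hmem
  obtain ⟨θ, hθ⟩ := exists_tr f
  have hf' : ∀ x, (θ * Ψ x).trace = Λ x := fun x => by rw [← hθ, ← hf]; rfl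
  have hsep : ∀ i (γ : Mt n) (ζ : nS (gF (g i) (F i))), ((θ - τ i) * (γ * C i - C i * γ + ζ.1)).trace = (σ i * γ).trace := by
    intro i γ ζ
    have h := hf' (Pi.single i γ, Pi.single i ζ)
    have e0 : ∀ j, j ≠ i → q j (Pi.single i γ, Pi.single i ζ) = 0 := by
      intro j hj; rw [hq]; simp [hj]
    have e1 : q i (Pi.single i γ, Pi.single i ζ) = γ * C i - C i * γ + ζ.1 := by
      rw [hq]; simp
    have e2 : (Pi.single i γ : Fin p → Mt n) i = γ := by simp
    rw [hΛ, LinearMap.sum_apply, Finset.sum_eq_single i (fun j _ hj => e0 j hj) (by simp), e1,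
      Finset.sum_eq_single i (fun j _ hj => by rw [e0 j hj]; simp [hj]) (by simp), e1] at h
    dsimp only at h
    rw [e2] at h
    rw [sub_mul, Matrix.trace_sub, h]; ring
  refine ⟨θ, fun i => ⟨pS_of_tr (hFl i) fun y hy => ?_, ?_⟩⟩
  · have := hsep i 0 ⟨y, hy⟩
    simpa using this
  · have : ∀ γ, ((C i * (θ - τ i) - (θ - τ i) * C i - σ i) * γ).trace = 0 := by
      intro γ
      have := hsep i γ 0
      rw [Submodule.coe_zero, add_zero, mul_sub, Matrix.trace_sub] at this
      rw [sub_mul, Matrix.trace_sub, sub_mul, Matrix.trace_sub, ← this, ← Matrix.mul_assoc, Matrix.trace_mul_comm ((θ - τ i) * γ), ← Matrix.mul_assoc, ← Matrix.mul_assoc]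
      ring
    exact sub_eq_zero.1 (tr_nondeg this)

lemma HS_comm {e x c : Mt n} (hx : x ∈ HS e) (hc : (1 - e) * c * e = 0) : c * x - x * c ∈ HS e := by
  have h0 : e * c * e = c * e := by
    rw [sub_mul, sub_mul, one_mul, sub_eq_zero] at hc; exact hc.symm
  rw [mem_HS, mul_sub, sub_mul]
  have e1 : e * (c * x) = c * x := by
    rw [← hx.1, ← mul_assoc c, ← mul_assoc, ← mul_assoc, h0]
  have e2 : e * (x * c) = x * c := by rw [← mul_assoc, hx.1]
  have e3 : c * x * e = 0 := by rw [mul_assoc, hx.2, mul_zero]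
  have e4 : x * c * e = 0 := by rw [mul_assoc, ← h0, mul_assoc e, ← mul_assoc x, hx.2, zero_mul]
  rw [e1, e2, e3, e4, sub_self]
  exact ⟨rfl, rfl⟩

lemma mem_HS_PI {I : Finset (Fin n)} {x : Mt n} : x ∈ HS (PI I) ↔ ∀ j l, (j ∉ I ∨ l ∈ I) → x j l = 0 := by
  rw [mem_HS]
  have : PI I * x = x ↔ (1 - PI I) * x = 0 := by rw [sub_mul, one_mul, sub_eq_zero, eq_comm]
  rw [this]
  constructor
  · rintro ⟨h1, h2⟩ j l (h | h)
    · have := congrFun (congrFun h1 j) l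
      rwa [PI_apply, if_neg h] at this
    · have := congrFun (congrFun h2 j) l
      rwa [PI_apply', if_pos h] at this
  · intro h
    constructor
    · ext j l; rw [PI_apply]; split_ifs with hj; rfl; exact h j l (Or.inl hj)
    · ext j l; rw [PI_apply']; split_ifs with hj; exact h j l (Or.inr hj); rfl

lemma key3 (hn : 1 ≤ n) {F : Fin p → ℕ → Submodule ℂ (Vc n)} (hF : ∀ i, IsFlag (F i)) {B : Fin p → Mt n} {μ : Fin n → ℂ} (hμ : Function.Injective μ)
    (c : Fin p → Fin (n+1) → Mt n) (hc : ∀ i (j : Fin (n+1)) v, (c i j).mulVec v = 0 ↔ v ∈ F i (j:ℕ))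
    {g C : Fin p → Mt n} (hs : SolD F B μ g C) (hm : ∀ g' C', SolD F B μ g' C' → msr c g' C' ≤ msr c g C)
    (I : Finset (Fin n)) (hI : CInv C I) (h0 : I.Nonempty) (hu : I ≠ Finset.univ)
    (hA : ∀ t, HA C (fun i => gF (g i) (F i)) I t → ∀ j ∈ I, ∀ l ∈ I, t j = t l)
    (hB : ∀ t, HB C (fun i => gF (g i) (F i)) I t → ∀ j ∉ I, ∀ l ∉ I, t j = t l)
    (τ σ : Fin p → Mt n) (hτ : ∀ i, τ i ∈ HS (PI I))
    (hσ : ∀ i, σ i ∈ HS (PI I)) (hσ' : ∀ i, σ i ∈ nS (gF (g i) (F i))) :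
    ∃ a : ℂ, ∃ h ∈ HS (PI I), ∀ i, a • PI I + h - τ i ∈ pS (gF (g i) (F i)) ∧ C i * (a • PI I + h - τ i) - (a • PI I + h - τ i) * C i = σ i := by
  obtain ⟨θ, hθ⟩ := key2 hn hF c hc hs hm I hI τ σ hτ hσ hσ'
  have hCi : ∀ i, (1 - PI I) * C i * PI I = 0 := fun i => PI_inv.2 (hI i)
  have h1 : ∀ i, C i * θ - θ * C i ∈ HS (PI I) := by
    intro i
    have := Submodule.add_mem _ (hσ i) (HS_comm (hτ i) (hCi i))
    rw [← (hθ i).2] at this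
    convert this using 1
    noncomm_ring
  have h2 : ∀ j l, (j ∉ I ∨ l ∈ I) → j ≠ l → θ j l = 0 := by
    intro j l hjl hne
    have : (∑ i, C i) * θ - θ * (∑ i, C i) ∈ HS (PI I) := by
      rw [Finset.sum_mul, Finset.mul_sum, ← Finset.sum_sub_distrib]
      exact Submodule.sum_mem _ fun i _ => h1 i
    rw [hs.sum] at this
    have := mem_HS_PI.1 this j l hjl
    rw [Matrix.sub_apply, neg_mul, mul_neg, Matrix.neg_apply, Matrix.neg_apply, Matrix.diagonal_mul, Matrix.mul_diagonal] at this
    have e : (μ l - μ j) * θ j l = 0 := by rw [← this]; ring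
    exact (mul_eq_zero.1 e).resolve_left fun h => hne (hμ (sub_eq_zero.1 h)).symm
  let t : Fin n → ℂ := fun j => θ j j
  set h := θ - Matrix.diagonal t with hh
  have hH : h ∈ HS (PI I) := by
    rw [mem_HS_PI]
    intro j l hjl
    by_cases e : j = l
    · subst e; simp [hh, t]
    · rw [hh, Matrix.sub_apply, Matrix.diagonal_apply_ne _ e, h2 j l hjl e, sub_zero]
  have hθT : θ = Matrix.diagonal t + h := by rw [hh]; abel
  have h3 : ∀ i j l, (j ∉ I ∨ l ∈ I) → (t j - t l) * C i j l = 0 := by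
    intro i j l hjl
    have := Submodule.sub_mem _ (h1 i) (HS_comm hH (hCi i))
    have := mem_HS_PI.1 this j l hjl
    have e : C i * θ - θ * C i - (C i * h - h * C i) = C i * Matrix.diagonal t - Matrix.diagonal t * C i := by
      rw [hh]; noncomm_ring
    rw [e, Matrix.sub_apply, Matrix.diagonal_mul, Matrix.mul_diagonal] at this
    rw [← neg_eq_zero, ← this]; ring
  have hv : ∀ x ∈ HS (PI I), ∀ v : Vc n, (∀ j ∉ I, v j = 0) → x.mulVec v = 0 := by
    intro x hx v hv
    rw [← PI_fix.2 hv, Matrix.mulVec_mulVec, hx.2, Matrix.zero_mulVec]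
  have hv' : ∀ x ∈ HS (PI I), ∀ v : Vc n, ∀ j ∉ I, x.mulVec v j = 0 := by
    intro x hx v
    rw [← PI_fix, Matrix.mulVec_mulVec, hx.1]
  have hTv : ∀ v : Vc n, (Matrix.diagonal t).mulVec v = fun j => t j * v j := by
    intro v; funext j; rw [Matrix.mulVec_diagonal]
  have hta := hA t ⟨fun i j l hl => h3 i j l (Or.inr hl), fun i k v hvF hvI => by
    have := (hθ i).1 k v hvF
    rwa [hθT, Matrix.sub_mulVec, Matrix.add_mulVec, hv h hH v hvI, hv _ (hτ i) v hvI, add_zero, sub_zero, hTv] at this⟩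
  have htb := hB t ⟨fun i j hj l => h3 i j l (Or.inl hj), fun i k v hvF => ⟨_, (hθ i).1 k v hvF, fun j hj => by
    rw [hθT, Matrix.sub_mulVec, Matrix.add_mulVec, hTv, Pi.sub_apply, Pi.add_apply, hv' h hH v j hj, hv' _ (hτ i) v j hj, add_zero, sub_zero]⟩⟩
  obtain ⟨x, hx⟩ := h0
  obtain ⟨y, hy⟩ : ∃ y, y ∉ I := by
    by_contra hcon; push Not at hcon
    exact hu (Finset.eq_univ_iff_forall.2 hcon)
  have hT : (t x - t y) • PI I + h = θ - t y • (1 : Mt n) := by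
    have : (t x - t y) • PI I = Matrix.diagonal t - t y • (1 : Mt n) := by
      rw [Matrix.smul_one_eq_diagonal, Matrix.diagonal_sub, PI, ← Matrix.diagonal_smul]
      congr 1; funext j
      by_cases hj : j ∈ I
      · simp [hj, hta j hj x hx]
      · simp [hj, htb j hj y hy]
    rw [this, hθT]; abel
  refine ⟨t x - t y, h, hH, fun i => ?_⟩
  rw [hT, sub_right_comm]
  refine ⟨Submodule.sub_mem _ (hθ i).1 (Submodule.smul_mem _ _ pS_one), ?_⟩
  rw [← (hθ i).2, mul_sub (C i) (θ - τ i), sub_mul (θ - τ i)]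
  simp

lemma abs_count {A T S P : Type*} [AddCommGroup A] [AddCommGroup T] [AddCommGroup S] [AddCommGroup P] [Module ℂ A] [Module ℂ T]
    [Module ℂ S] [Module ℂ P] [FiniteDimensional ℂ A] [FiniteDimensional ℂ T] [FiniteDimensional ℂ S] [FiniteDimensional ℂ P]
    (R : Submodule ℂ (A × T × S)) (h1 : ∀ τ σ, ∃ a, (a, τ, σ) ∈ R) (j : P →ₗ[ℂ] T) (h2 : ∀ τ σ, (0, τ, σ) ∈ R → ∃ x, j x = τ)
    (h3 : ∀ σ, (0, 0, σ) ∈ R → σ = 0) : finrank ℂ T + finrank ℂ S ≤ finrank ℂ A + finrank ℂ P := by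
  have k1 : finrank ℂ (T × S) ≤ finrank ℂ R := by
    refine LinearMap.finrank_le_finrank_of_surjective (f := LinearMap.snd ℂ A (T × S) ∘ₗ R.subtype) ?_
    rintro ⟨τ, σ⟩
    obtain ⟨a, ha⟩ := h1 τ σ
    exact ⟨⟨_, ha⟩, rfl⟩
  let f : R →ₗ[ℂ] A := LinearMap.fst ℂ A (T × S) ∘ₗ R.subtype
  have k2 := LinearMap.finrank_range_add_finrank_ker f
  have k3 : finrank ℂ (LinearMap.range f) ≤ finrank ℂ A := Submodule.finrank_le _
  have kf : ∀ q : LinearMap.ker f, q.1.1 = (0, q.1.1.2.1, q.1.1.2.2) := fun q => Prod.ext q.2 rfl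
  have k4 : finrank ℂ (LinearMap.ker f) ≤ finrank ℂ (LinearMap.range j) := by
    refine LinearMap.finrank_le_finrank_of_injective (f := LinearMap.codRestrict (LinearMap.range j)
      (LinearMap.fst ℂ T S ∘ₗ LinearMap.snd ℂ A (T × S) ∘ₗ R.subtype ∘ₗ (LinearMap.ker f).subtype) fun q => ?_) ?_
    · exact h2 q.1.1.2.1 q.1.1.2.2 (kf q ▸ q.1.2)
    · rw [injective_iff_map_eq_zero]
      intro q hq
      have hz : q.1.1.2.1 = 0 := congrArg Subtype.val hq
      have hm : q.1.1 ∈ R := q.1.2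
      have e := kf q
      rw [hz] at e
      rw [e] at hm
      rw [h3 _ hm] at e
      exact Subtype.ext (Subtype.ext e)
  have k5 := LinearMap.finrank_range_le j
  rw [Module.finrank_prod] at k1
  omega

lemma key4 (e : Mt n) (Fg : Fin p → ℕ → Submodule ℂ (Vc n)) (C : Fin p → Mt n)
    (hk : ∀ τ σ : Fin p → Mt n, (∀ i, τ i ∈ HS e) → (∀ i, σ i ∈ HS e) → (∀ i, σ i ∈ nS (Fg i)) →
      ∃ a : ℂ, ∃ h ∈ HS e, ∀ i, a • e + h - τ i ∈ pS (Fg i) ∧ C i * (a • e + h - τ i) - (a • e + h - τ i) * C i = σ i) :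
    p * finrank ℂ (HS e) + ∑ i, finrank ℂ (HS e ⊓ nS (Fg i) : Submodule ℂ (Mt n)) ≤
      1 + finrank ℂ (HS e) + ∑ i, finrank ℂ (HS e ⊓ pS (Fg i) : Submodule ℂ (Mt n)) := by
  let u : Fin p → ((ℂ × HS e) × (Fin p → HS e) × ((i : Fin p) → (HS e ⊓ nS (Fg i) : Submodule ℂ (Mt n)))) →ₗ[ℂ] Mt n := fun i =>
    ((LinearMap.toSpanSingleton ℂ _ e) ∘ₗ LinearMap.fst ℂ _ _ + (HS e).subtype ∘ₗ LinearMap.snd ℂ _ _) ∘ₗ LinearMap.fst ℂ _ _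
      - (HS e).subtype ∘ₗ LinearMap.proj i ∘ₗ LinearMap.fst ℂ _ _ ∘ₗ LinearMap.snd ℂ _ _
  have hu : ∀ i q, u i q = q.1.1 • e + q.1.2.1 - (q.2.1 i).1 := fun i q => rfl
  let w : Fin p → ((ℂ × HS e) × (Fin p → HS e) × ((i : Fin p) → (HS e ⊓ nS (Fg i) : Submodule ℂ (Mt n)))) →ₗ[ℂ] Mt n := fun i =>
    (LinearMap.mulLeft ℂ (C i) - LinearMap.mulRight ℂ (C i)) ∘ₗ u i - (HS e ⊓ nS (Fg i)).subtype ∘ₗ LinearMap.proj i ∘ₗ LinearMap.snd ℂ _ _ ∘ₗ LinearMap.snd ℂ _ _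
  have hw : ∀ i q, w i q = (C i * u i q - u i q * C i) - (q.2.2 i).1 := fun i q => rfl
  have hR : ∀ q, q ∈ (⨅ i, (Submodule.comap (u i) (pS (Fg i)) ⊓ LinearMap.ker (w i))) ↔ ∀ i, u i q ∈ pS (Fg i) ∧ C i * u i q - u i q * C i = (q.2.2 i).1 := by
    intro q
    simp only [Submodule.mem_iInf, Submodule.mem_inf, Submodule.mem_comap, LinearMap.mem_ker, hw, sub_eq_zero]
  have := abs_count (P := (i : Fin p) → (HS e ⊓ pS (Fg i) : Submodule ℂ (Mt n))) (⨅ i, (Submodule.comap (u i) (pS (Fg i)) ⊓ LinearMap.ker (w i)))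
    (fun τ σ => by
      obtain ⟨a, h, hh, hk⟩ := hk (fun i => (τ i).1) (fun i => (σ i).1) (fun i => (τ i).2) (fun i => (σ i).2.1) (fun i => (σ i).2.2)
      exact ⟨(a, ⟨h, hh⟩), (hR _).2 hk⟩)
    (LinearMap.pi fun i => Submodule.inclusion inf_le_left ∘ₗ LinearMap.proj i)
    (fun τ σ h => ⟨fun i => ⟨(τ i).1, (τ i).2, by
      have := ((hR _).1 h i).1
      rw [hu] at this
      simpa using this⟩, rfl⟩)
    (fun σ h => by
      funext i
      have := ((hR _).1 h i).2
      rw [hu] at this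
      apply Subtype.ext
      simpa using this.symm)
  rw [Module.finrank_pi_fintype, Module.finrank_pi_fintype, Module.finrank_pi_fintype, Module.finrank_prod, Module.finrank_self] at this
  simpa only [Finset.sum_const, Finset.card_univ, Fintype.card_fin, smul_eq_mul] using this
end
end

section
open Module Filter Topology
section
variable {n p : ℕ}

lemma step4 (hn : 1 ≤ n) {F : Fin p → ℕ → Submodule ℂ (Vc n)} (hF : ∀ i, IsFlag (F i)) {B : Fin p → Mt n} {μ : Fin n → ℂ} (hμ : Function.Injective μ)
    (hex : ∃ g C, SolD F B μ g C)
    (hgen : ∀ g C, SolD F B μ g C → ∀ I : Finset (Fin n), CInv C I → I.Nonempty → I ≠ Finset.univ → 2 ≤ I.card ∧ I.card + 2 ≤ n)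
    (hnum : ∀ g : Fin p → Mt n, (∀ i, IsUnit (g i)) → ∀ W : Submodule ℂ (Vc n), 2 ≤ finrank ℂ W → finrank ℂ W + 2 ≤ n →
      (finrank ℂ W : ℤ) * (n - finrank ℂ W) + 2 ≤ ∑ i, ((finrank ℂ W : ℤ) * (n - finrank ℂ W) -
        ∑ k ∈ Finset.range n, aW W (gF (g i) (F i)) k * (mF (gF (g i) (F i)) k - aW W (gF (g i) (F i)) k))) :
    ∃ g C, SolD F B μ g C ∧ ∀ I : Finset (Fin n), CInv C I → I.Nonempty → I = Finset.univ := by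
  choose c hc using fun (i : Fin p) (j : Fin (n+1)) => exists_kerMat (F i (j:ℕ))
  obtain ⟨g, C, hs, hm⟩ := exists_max c hex
  refine ⟨g, C, hs, fun I0 hI0 h0 => ?_⟩
  by_contra h1
  have hE : ∀ s : Fin n → ℂ, (∀ i j l, (s j - s l) * C i j l = 0) →
      (∀ i k v, v ∈ gF (g i) (F i) k → (fun j => s j * v j) ∈ gF (g i) (F i) k) → ∀ j l, s j = s l := by
    intro s hs1 hs2 j l
    obtain ⟨a, ha⟩ := hs.endo (Matrix.diagonal s) (fun i => by
      ext x y
      rw [Matrix.diagonal_mul, Matrix.mul_diagonal]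
      linear_combination hs1 i x y) (fun i k v hv => by
      have := hs2 i k v hv
      convert this using 1
      funext x; rw [Matrix.mulVec_diagonal])
    have h := fun j => congrFun (congrFun ha j) j
    simp at h
    rw [h, h]
  obtain ⟨I, i0, i1, hI, hA, hB⟩ := exists_conn C (fun i => gF (g i) (F i)) hE I0 h0 h1 hI0
  have k4 := key4 (PI I) (fun i => gF (g i) (F i)) C (fun τ σ a b d => key3 hn hF hμ c hc hs hm I hI i0 i1 hA hB τ σ a b d)
  obtain ⟨c1, c2⟩ := hgen g C hs I hI i0 i1
  have hr : finrank ℂ (LinearMap.range (PI I).mulVecLin) = I.card := PI_rank I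
  have nn := hnum g hs.unit (LinearMap.range (PI I).mulVecLin) (by rw [hr]; exact c1) (by rw [hr]; exact c2)
  have hd := Finset.sum_le_sum fun i (_ : i ∈ Finset.univ) => D1 (PI I) (gF_flag (hs.unit i) (hF i))
  rw [HS_fin (PI_idem I), PI_rank] at k4
  rw [hr, Finset.sum_sub_distrib, Finset.sum_const, Finset.card_univ, Fintype.card_fin, nsmul_eq_mul] at nn
  rw [Finset.sum_add_distrib] at hd
  zify [show I.card ≤ n by omega] at k4
  linarith

lemma FC_pp {ξ : ℕ → ℂ} {F : ℕ → Submodule ℂ (Vc n)} (hF : IsFlag F) {Y : Mt n} (hY : FC ξ F Y) (k : ℕ) :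
    ∀ v ∈ F k, (pp ξ Y k).mulVec v = 0 := by
  induction k with
  | zero => intro v hv; rw [hF.bot, Submodule.mem_bot] at hv; rw [hv, Matrix.mulVec_zero]
  | succ k ih =>
    intro v hv
    rw [pp_succ, ← Matrix.mulVec_mulVec]
    apply ih
    rw [Matrix.sub_mulVec, Matrix.smul_mulVec, Matrix.one_mulVec]
    exact hY k v hv

lemma pp_eig {ξ : ℕ → ℂ} {Y : Mt n} {a : ℂ} {v : Vc n} (h : Y.mulVec v = a • v) (k : ℕ) :
    (pp ξ Y k).mulVec v = (∏ j ∈ Finset.range k, (a - ξ j)) • v := by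
  induction k with
  | zero => rw [pp_zero]; simp
  | succ k ih =>
    rw [pp_succ, ← Matrix.mulVec_mulVec, Matrix.sub_mulVec, Matrix.smul_mulVec, Matrix.one_mulVec, h, ← sub_smul,
      Matrix.mulVec_smul, ih, smul_smul, Finset.prod_range_succ, mul_comm]

lemma eig_mem {ξ : ℕ → ℂ} {F : ℕ → Submodule ℂ (Vc n)} (hF : IsFlag F) {Y : Mt n} (hY : FC ξ F Y) {a : ℂ} 
    (h : ¬ IsUnit (Y - a • (1 : Mt n))) : ∃ k : Fin n, a = ξ k := by
  obtain ⟨v, hv0, hv⟩ : ∃ v : Vc n, v ≠ 0 ∧ (Y - a • (1 : Mt n)).mulVec v = 0 := by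
    by_contra! hcon
    apply h
    rw [← Matrix.mulVec_injective_iff_isUnit]
    rw [← Matrix.coe_mulVecLin, injective_iff_map_eq_zero]
    intro v hv; by_contra h0; exact hcon v h0 hv
  rw [Matrix.sub_mulVec, Matrix.smul_mulVec, Matrix.one_mulVec, sub_eq_zero] at hv
  have := FC_pp hF hY n v (by rw [hF.top]; trivial)
  rw [pp_eig hv, smul_eq_zero, or_iff_left hv0, Finset.prod_eq_zero_iff] at this
  obtain ⟨k, hk, e⟩ := this
  exact ⟨⟨k, Finset.mem_range.1 hk⟩, sub_eq_zero.1 e⟩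

/-- one-element and co-one-element invariant coordinate sets are excluded by genericity -/
lemma gen_of {F : Fin p → ℕ → Submodule ℂ (Vc n)} (hF : ∀ i, IsFlag (F i)) {ξ : Fin p → ℕ → ℂ} {B : Fin p → Mt n} (hB : ∀ i, FC (ξ i) (F i) (B i))
    {μ : Fin n → ℂ} (hg : ∀ (j : Fin n) (k : Fin p → Fin n), μ j + ∑ i, ξ i (k i) ≠ 0)
    {g C} (hs : SolD F B μ g C) (I : Finset (Fin n)) (hI : CInv C I) (h0 : I.Nonempty) (h1 : I ≠ Finset.univ) : 2 ≤ I.card ∧ I.card + 2 ≤ n := by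
  have key : ∀ j, (∀ i, ¬ IsUnit (C i - (C i j j) • (1 : Mt n))) → False := by
    intro j hj
    have : ∀ i, ∃ k : Fin n, C i j j = ξ i k := by
      intro i
      refine eig_mem (hF i) (Y := (g i)⁻¹ * C i * g i) ?_ ?_
      · have := FC_add (hB i) (hs.conj i)
        rwa [add_sub_cancel] at this
      · intro hu
        apply hj i
        have hgu := (Matrix.isUnit_iff_isUnit_det _).1 (hs.unit i)
        have e : C i - C i j j • (1 : Mt n) = g i * ((g i)⁻¹ * C i * g i - C i j j • (1 : Mt n)) * (g i)⁻¹ := by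
          rw [mul_sub, sub_mul, mul_smul_comm, smul_mul_assoc, mul_one, Matrix.mul_nonsing_inv _ hgu, mul_assoc, mul_assoc, mul_assoc,
            Matrix.mul_nonsing_inv _ hgu, ← mul_assoc, ← mul_assoc, Matrix.mul_nonsing_inv _ hgu, one_mul, mul_one]
        rw [e]
        exact ((hs.unit i).mul hu).mul (Matrix.isUnit_nonsing_inv_iff.2 (hs.unit i))
    choose k hk using this
    apply hg j k
    have := congrFun (congrFun hs.sum j) j
    rw [Matrix.sum_apply, Matrix.neg_apply, Matrix.diagonal_apply_eq] at this
    rw [← Finset.sum_congr rfl fun i _ => hk i, this, add_neg_cancel]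
  constructor
  · by_contra hc
    have : I.card = 1 := by have := h0.card_pos; omega
    obtain ⟨j, rfl⟩ := Finset.card_eq_one.1 this
    refine key j fun i hu => ?_
    have hz := Matrix.mulVec_injective_iff_isUnit.2 hu
    have : (C i - C i j j • (1 : Mt n)).mulVec (Pi.single j 1) = (C i - C i j j • (1 : Mt n)).mulVec 0 := by
      rw [Matrix.mulVec_zero]
      funext x
      rw [Matrix.mulVec_single_one]
      by_cases hx : x = j
      · subst hx; simp
      · simp [hI i x (by simpa using hx) j (by simp), hx]
    have := congrFun (hz this) j
    simp at this
  · by_contra hc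
    have hlt : I.card < n := by
      have := Finset.card_lt_card (Finset.ssubset_univ_iff.2 h1); simpa using this
    have : Iᶜ.card = 1 := by rw [Finset.card_compl, Fintype.card_fin]; omega
    obtain ⟨j, hj⟩ := Finset.card_eq_one.1 this
    refine key j fun i hu => ?_
    have hz := Matrix.vecMul_injective_iff_isUnit.2 hu
    have hjI : j ∉ I := by rw [← Finset.mem_compl, hj]; simp
    have : Matrix.vecMul (Pi.single j 1 : Vc n) (C i - C i j j • (1 : Mt n)) = Matrix.vecMul 0 (C i - C i j j • (1 : Mt n)) := by
      rw [Matrix.zero_vecMul]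
      funext x
      rw [Matrix.single_one_vecMul]
      by_cases hx : x = j
      · subst hx; simp
      · have : x ∈ I := by by_contra h; rw [← Finset.mem_compl, hj] at h; simp at h; exact hx h
        simp [hI i j hjI x this, Ne.symm hx, Matrix.one_apply]
    have := congrFun (hz this) j
    simp at this
end
end

section
open Module Filter Topology
lemma sim_step {V V' : Type} [AddCommGroup V] [AddCommGroup V'] [Module ℂ V] [Module ℂ V'] [FiniteDimensional ℂ V] [FiniteDimensional ℂ V']
    (N : V →ₗ[ℂ] V) (N' : V' →ₗ[ℂ] V') (hd : finrank ℂ V = finrank ℂ V') (φ : LinearMap.range N ≃ₗ[ℂ] LinearMap.range N')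
    (hφ : ∀ u : LinearMap.range N, (φ ⟨N u, LinearMap.mem_range_self N _⟩).1 = N' (φ u)) :
    ∃ Φ : V ≃ₗ[ℂ] V', ∀ v, Φ (N v) = N' (Φ v) := by
  have hφ0 : ∀ u : (LinearMap.range N), N u = 0 ↔ N' (φ u) = 0 := by
    intro u
    rw [← hφ u]
    constructor
    · intro h
      have : (⟨N u, LinearMap.mem_range_self N _⟩ : (LinearMap.range N)) = 0 := Subtype.ext h
      rw [this, map_zero]; rfl
    · intro h
      have : φ ⟨N u, LinearMap.mem_range_self N _⟩ = 0 := Subtype.ext h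
      rw [LinearEquiv.map_eq_zero_iff] at this
      exact congrArg Subtype.val this
  have hdU : finrank ℂ (LinearMap.range N) = finrank ℂ (LinearMap.range N') := φ.finrank_eq
  have e1 := LinearMap.finrank_range_add_finrank_ker N
  have e2 := LinearMap.finrank_range_add_finrank_ker N'
  have cmp : ∀ {E : Type} [AddCommGroup E] [Module ℂ E] [FiniteDimensional ℂ E] (A K : Submodule ℂ E),
      ∃ G ≤ K, Disjoint G A ∧ K ≤ (A ⊓ K) ⊔ G ∧ finrank ℂ G + finrank ℂ (A ⊓ K : Submodule ℂ E) = finrank ℂ K := by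
    intro E _ _ _ A K
    obtain ⟨C, hC⟩ := Submodule.exists_isCompl (A ⊓ K)
    have h1 : (A ⊓ K) ⊔ C ⊓ K = K := by
      rw [← sup_inf_assoc_of_le C inf_le_right, hC.sup_eq_top, top_inf_eq]
    have h2 : (A ⊓ K) ⊓ (C ⊓ K) = ⊥ := by rw [eq_bot_iff, ← hC.inf_eq_bot]; exact inf_le_inf_left _ inf_le_left
    refine ⟨C ⊓ K, inf_le_right, ?_, h1.ge, ?_⟩
    · rw [disjoint_iff, eq_bot_iff, ← h2]
      exact fun x hx => ⟨⟨hx.2, hx.1.2⟩, hx.1⟩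
    · have := Submodule.finrank_sup_add_finrank_inf_eq (A ⊓ K) (C ⊓ K)
      rw [h1, h2, finrank_bot] at this
      omega
  obtain ⟨K, hK1, hK2, hK3, hK4⟩ := cmp (LinearMap.range N) (LinearMap.ker N)
  obtain ⟨K', hK1', hK2', hK3', hK4'⟩ := cmp (LinearMap.range N') (LinearMap.ker N')
  have e3 : finrank ℂ ((LinearMap.range N') ⊓ LinearMap.ker N' : Submodule ℂ V') ≤ finrank ℂ ((LinearMap.range N) ⊓ LinearMap.ker N : Submodule ℂ V) := by
    refine LinearMap.finrank_le_finrank_of_injective (f := LinearMap.codRestrict ((LinearMap.range N) ⊓ LinearMap.ker N)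
      ((LinearMap.range N).subtype ∘ₗ φ.symm.toLinearMap ∘ₗ Submodule.inclusion inf_le_left) fun x => ⟨(φ.symm _).2, ?_⟩) ?_
    · refine (hφ0 _).2 ?_
      change N' (φ (φ.symm _)) = 0
      rw [LinearEquiv.apply_symm_apply]
      exact x.2.2
    · intro x y h
      have := congrArg Subtype.val h
      have := φ.symm.injective (Subtype.ext this)
      exact Subtype.ext (congrArg (fun z : LinearMap.range N' => (z : V')) this)
  have e4 : finrank ℂ K ≤ finrank ℂ K' := by omega
  obtain ⟨ψ, hψ⟩ := rank_le_iff_exists_linearMap.1 (show Module.rank ℂ K ≤ Module.rank ℂ K' by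
    rw [← Module.finrank_eq_rank, ← Module.finrank_eq_rank]; exact_mod_cast e4)
  obtain ⟨Q, hQ, hUQ⟩ := hK2.exists_isCompl
  obtain ⟨ψ', hψ'⟩ := LinearMap.exists_extend (K'.subtype ∘ₗ ψ)
  let a : V →ₗ[ℂ] V' := LinearMap.ofIsCompl hUQ.symm ((LinearMap.range N').subtype ∘ₗ φ.toLinearMap) (ψ'.domRestrict Q)
  have aU : ∀ u : (LinearMap.range N), a u = φ u := fun u => LinearMap.ofIsCompl_apply_left hUQ.symm u
  have aK : ∀ k : K, a k = ψ k := fun k => by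
    rw [show a k = ψ' k from LinearMap.ofIsCompl_apply_right hUQ.symm (⟨k.1, hQ k.2⟩ : Q)]
    exact congrArg (fun f => f k) hψ'
  have dec : ∀ v, N v = 0 → ∃ (u : (LinearMap.range N)) (k : K), v = u + k ∧ N u = 0 := by
    intro v hv
    obtain ⟨u, hu, k, hk, rfl⟩ := Submodule.mem_sup.1 (hK3 hv)
    exact ⟨⟨u, hu.1⟩, ⟨k, hk⟩, rfl, hu.2⟩
  have a0 : ∀ v, N v = 0 → N' (a v) = 0 := by
    intro v hv
    obtain ⟨u, k, rfl, hu⟩ := dec v hv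
    have : N' (ψ k) = 0 := hK1' (ψ k).2
    rw [map_add, aU, aK, map_add, (hφ0 u).1 hu, this, add_zero]
  have ai : ∀ v, N v = 0 → a v = 0 → v = 0 := by
    intro v hv h
    obtain ⟨u, k, rfl, hu⟩ := dec v hv
    rw [map_add, aU, aK] at h
    have hz : (ψ k).1 = 0 := by
      refine Submodule.disjoint_def.1 hK2' _ (ψ k).2 ?_
      rw [eq_neg_of_add_eq_zero_right h]
      exact Submodule.neg_mem _ (φ u).2
    have h1 : k = 0 := hψ (by rw [map_zero]; exact Subtype.ext hz)
    have h2 : φ u = 0 := Subtype.ext (by rw [hz, add_zero] at h; exact h)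
    rw [LinearEquiv.map_eq_zero_iff] at h2
    rw [h1, h2]; simp
  obtain ⟨s, hs⟩ := LinearMap.exists_rightInverse_of_surjective N'.rangeRestrict N'.range_rangeRestrict
  have hs' : ∀ u : (LinearMap.range N'), N' (s u) = u := fun u => congrArg Subtype.val (congrArg (fun f => f u) hs)
  let b : V →ₗ[ℂ] V' := a + s ∘ₗ (φ.toLinearMap ∘ₗ N.rangeRestrict - N'.rangeRestrict ∘ₗ a)
  have hb : ∀ v, b v = a v + s (φ (N.rangeRestrict v) - N'.rangeRestrict (a v)) := fun v => rfl
  have hbN : ∀ v, N' (b v) = φ (N.rangeRestrict v) := by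
    intro v
    rw [hb, map_add, hs', Submodule.coe_sub]; simp
  have hbU : ∀ u : (LinearMap.range N), b u = φ u := by
    intro u
    rw [hb, aU]
    have : φ (N.rangeRestrict u) - N'.rangeRestrict (φ u) = 0 := by
      apply Subtype.ext
      rw [Submodule.coe_sub, show (N'.rangeRestrict (φ u)).1 = N' (φ u) from rfl, ← hφ u]
      exact sub_self _
    rw [this, map_zero, add_zero]
  have hbi : Function.Injective b := by
    rw [injective_iff_map_eq_zero]
    intro v hv
    have h1 := hbN v
    rw [hv, map_zero] at h1
    have h2 : φ (N.rangeRestrict v) = 0 := Subtype.ext h1.symm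
    rw [LinearEquiv.map_eq_zero_iff] at h2
    have h3 : N v = 0 := congrArg Subtype.val h2
    apply ai v h3
    have : N'.rangeRestrict (a v) = 0 := Subtype.ext (a0 v h3)
    rw [hb, h2, this] at hv
    simpa using hv
  refine ⟨LinearMap.linearEquivOfInjective b hbi hd, fun v => ?_⟩
  rw [LinearMap.linearEquivOfInjective_apply, LinearMap.linearEquivOfInjective_apply, hbN]
  exact hbU (N.rangeRestrict v)

noncomputable def qq (ξ : ℕ → ℂ) (k : ℕ) : ℂ[X] := ∏ l ∈ Finset.range k, (X - C (ξ l))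

lemma aeval_restrict {V : Type} [AddCommGroup V] [Module ℂ V] (f : Module.End ℂ V) (U : Submodule ℂ V) (h : ∀ u ∈ U, f u ∈ U) (q : ℂ[X]) (u : U) :
    (aeval (LinearMap.restrict f h) q u : V) = aeval f q u := by
  induction q using Polynomial.induction_on' with
  | add p q hp hq => simp [hp, hq]
  | monomial k c =>
    simp only [aeval_monomial, Module.End.mul_apply, Module.algebraMap_end_apply, Submodule.coe_smul]
    congr 1
    rw [Module.End.pow_restrict]
    rfl

lemma sim (m : ℕ) : ∀ (ξ : ℕ → ℂ) (V V' : Type) [AddCommGroup V] [AddCommGroup V'] [Module ℂ V] [Module ℂ V'] [FiniteDimensional ℂ V] [FiniteDimensional ℂ V']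
    (f : Module.End ℂ V) (g : Module.End ℂ V'), (∀ k ≤ m, finrank ℂ (LinearMap.range (aeval f (qq ξ k))) = finrank ℂ (LinearMap.range (aeval g (qq ξ k)))) →
    aeval f (qq ξ m) = 0 → aeval g (qq ξ m) = 0 → ∃ Φ : V ≃ₗ[ℂ] V', ∀ v, Φ (f v) = g (Φ v) := by
  induction m with
  | zero =>
    intro ξ V V' _ _ _ _ _ _ f g h hf hg
    have hf' : ∀ v : V, v = 0 := fun v => by simpa [qq] using congrArg (fun q => q v) hf
    have hg' : ∀ v : V', v = 0 := fun v => by simpa [qq] using congrArg (fun q => q v) hg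
    refine ⟨⟨⟨⟨fun _ => 0, by simp⟩, by simp⟩, fun _ => 0, fun v => (hf' v).symm, fun v => (hg' v).symm⟩, fun v => ?_⟩
    rw [hf' (f v), hg' (g _), map_zero]
  | succ m ih =>
    intro ξ V V' _ _ _ _ _ _ f g h hf hg
    have hq : ∀ k, qq ξ (k+1) = qq (fun l => ξ (l+1)) k * (X - C (ξ 0)) := fun k => Finset.prod_range_succ' _ _
    have ha : ∀ {E : Type} [AddCommGroup E] [Module ℂ E] (f : Module.End ℂ E) k, aeval f (qq ξ (k+1)) = aeval f (qq (fun l => ξ (l+1)) k) ∘ₗ (f - ξ 0 • LinearMap.id) := by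
      intro E _ _ f k
      rw [hq, map_mul, map_sub, aeval_X, aeval_C]; rfl
    have hr : ∀ {E : Type} [AddCommGroup E] [Module ℂ E] (f : Module.End ℂ E), ∀ u ∈ LinearMap.range (f - ξ 0 • LinearMap.id), f u ∈ LinearMap.range (f - ξ 0 • LinearMap.id) := by
      rintro E _ _ f _ ⟨v, rfl⟩
      exact ⟨f v, by simp⟩
    have hra : ∀ {E : Type} [AddCommGroup E] [Module ℂ E] (f : Module.End ℂ E) k,
        finrank ℂ (LinearMap.range (aeval (LinearMap.restrict f (hr f)) (qq (fun l => ξ (l+1)) k))) = finrank ℂ (LinearMap.range (aeval f (qq ξ (k+1)))) := by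
      intro E _ _ f k
      rw [ha, ← Submodule.finrank_map_subtype_eq]
      have : Submodule.map (LinearMap.range (f - ξ 0 • LinearMap.id)).subtype (LinearMap.range (aeval (LinearMap.restrict f (hr f)) (qq (fun l => ξ (l+1)) k)))
          = LinearMap.range (aeval f (qq (fun l => ξ (l+1)) k) ∘ₗ (f - ξ 0 • LinearMap.id)) := by
        ext x
        constructor
        · rintro ⟨_, ⟨⟨_, v, rfl⟩, rfl⟩, rfl⟩
          exact ⟨v, (aeval_restrict f _ (hr f) (qq (fun l => ξ (l+1)) k) ⟨_, v, rfl⟩).symm⟩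
        · rintro ⟨v, rfl⟩
          exact ⟨_, ⟨⟨_, v, rfl⟩, rfl⟩, aeval_restrict f _ (hr f) _ _⟩
      rw [this]
    have hr0 : ∀ {E : Type} [AddCommGroup E] [Module ℂ E] (f : Module.End ℂ E), aeval f (qq ξ (m+1)) = 0 →
        aeval (LinearMap.restrict f (hr f)) (qq (fun l => ξ (l+1)) m) = 0 := by
      intro E _ _ f h
      rw [ha] at h
      apply LinearMap.ext
      rintro ⟨_, v, rfl⟩
      apply Subtype.ext
      rw [aeval_restrict]
      exact congrArg (fun q => q v) h
    obtain ⟨φ, hφ⟩ := ih (fun l => ξ (l+1)) _ _ (LinearMap.restrict f (hr f)) (LinearMap.restrict g (hr g))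
      (fun k hk => by rw [hra, hra]; exact h (k+1) (by omega)) (hr0 f hf) (hr0 g hg)
    have hd : finrank ℂ V = finrank ℂ V' := by
      have := h 0 (by omega)
      rw [show qq ξ 0 = 1 from Finset.prod_range_zero _, map_one (aeval f), map_one (aeval g)] at this
      rwa [show (1 : Module.End ℂ V) = LinearMap.id from rfl, show (1 : Module.End ℂ V') = LinearMap.id from rfl, LinearMap.range_id, LinearMap.range_id, finrank_top, finrank_top] at this
    obtain ⟨Φ, hΦ⟩ := sim_step (f - ξ 0 • LinearMap.id) (g - ξ 0 • LinearMap.id) hd φ (by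
      intro u
      have h1 := congrArg Subtype.val (hφ u)
      have h2 : (⟨(f - ξ 0 • LinearMap.id : Module.End ℂ V) u, LinearMap.mem_range_self _ _⟩ : LinearMap.range (f - ξ 0 • LinearMap.id)) = LinearMap.restrict f (hr f) u - ξ 0 • u := by
        apply Subtype.ext; simp
      rw [h2, map_sub, map_smul, Submodule.coe_sub, h1]
      simp)
    refine ⟨Φ, fun v => ?_⟩
    have := hΦ v
    simp only [LinearMap.sub_apply, LinearMap.smul_apply, LinearMap.id_apply, map_sub, map_smul] at this
    exact sub_left_injective this

lemma simM {n : ℕ} (ξ : ℕ → ℂ) (Y B : Mt n) (h : ∀ k ≤ n, (pp ξ Y k).rank = (pp ξ B k).rank) (hY : pp ξ Y n = 0) (hB : pp ξ B n = 0) :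
    ∃ S : Mt n, IsUnit S ∧ Y = S * B * S⁻¹ := by
  have e : ∀ (Z : Mt n) k, aeval (Matrix.toLinAlgEquiv' Z) (qq ξ k) = Matrix.toLinAlgEquiv' (pp ξ Z k) := by
    intro Z k
    rw [pp]
    exact Polynomial.aeval_algHom_apply (Matrix.toLinAlgEquiv' : Mt n ≃ₐ[ℂ] _).toAlgHom Z _
  obtain ⟨Φ, hΦ⟩ := sim n ξ (Vc n) (Vc n) (Matrix.toLinAlgEquiv' B) (Matrix.toLinAlgEquiv' Y)
    (fun k hk => by rw [e, e]; exact (h k hk).symm) (by rw [e, hB, map_zero]) (by rw [e, hY, map_zero])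
  have h1 : LinearMap.toMatrix' Φ.toLinearMap * LinearMap.toMatrix' Φ.symm.toLinearMap = 1 := by
    rw [← LinearMap.toMatrix'_comp, LinearEquiv.comp_coe, LinearEquiv.symm_trans_self]; exact LinearMap.toMatrix'_id
  have hu : IsUnit (LinearMap.toMatrix' Φ.toLinearMap) := by
    rw [Matrix.isUnit_iff_isUnit_det]; exact Matrix.isUnit_det_of_right_inverse h1
  refine ⟨_, hu, ?_⟩
  rw [Matrix.inv_eq_right_inv h1]
  have : LinearMap.toMatrix' Φ.toLinearMap * B = Y * LinearMap.toMatrix' Φ.toLinearMap := by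
    apply mat_ext
    intro v
    rw [← Matrix.mulVec_mulVec, ← Matrix.mulVec_mulVec, LinearMap.toMatrix'_mulVec, LinearMap.toMatrix'_mulVec]
    exact hΦ v
  rw [this, mul_assoc, h1, mul_one]
end

section
open Module Filter Topology
section
variable {n p : ℕ}

lemma exists_fill (M : Mt n) : ∃ N : Mt n, IsUnit (M + N) ∧ M.rank + N.rank ≤ n := by
  obtain ⟨K, hK⟩ := Submodule.exists_isCompl (LinearMap.ker M.mulVecLin)
  obtain ⟨D, hD⟩ := Submodule.exists_isCompl (LinearMap.range M.mulVecLin)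
  have e1 := LinearMap.finrank_range_add_finrank_ker M.mulVecLin
  have e2 := Submodule.finrank_add_eq_of_isCompl hD
  rw [Module.finrank_fin_fun] at e1 e2
  let e : LinearMap.ker M.mulVecLin ≃ₗ[ℂ] D := LinearEquiv.ofFinrankEq _ _ (by omega)
  let f : Vc n →ₗ[ℂ] Vc n := D.subtype ∘ₗ e.toLinearMap ∘ₗ (LinearMap.ker M.mulVecLin).projectionOnto K hK
  have hf : ∀ v, (LinearMap.toMatrix' f).mulVec v = f v := fun v => LinearMap.toMatrix'_mulVec f v
  refine ⟨LinearMap.toMatrix' f, ?_, ?_⟩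
  · rw [← Matrix.mulVec_injective_iff_isUnit, ← Matrix.coe_mulVecLin, injective_iff_map_eq_zero]
    intro v hv
    rw [Matrix.mulVecLin_apply, Matrix.add_mulVec, hf] at hv
    have h1 : f v = 0 := by
      refine Submodule.disjoint_def.1 hD.disjoint _ ?_ (e _).2
      rw [eq_neg_of_add_eq_zero_right hv]
      exact Submodule.neg_mem _ ⟨v, rfl⟩
    rw [h1, add_zero] at hv
    have h2 : e ((LinearMap.ker M.mulVecLin).projectionOnto K hK v) = 0 := Subtype.ext h1
    rw [LinearEquiv.map_eq_zero_iff] at h2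
    rw [Submodule.projectionOnto_apply_left hK ⟨v, hv⟩] at h2
    exact congrArg Subtype.val h2
  · have : (LinearMap.toMatrix' f).rank ≤ finrank ℂ D := by
      apply Submodule.finrank_mono
      rintro _ ⟨v, rfl⟩
      rw [Matrix.mulVecLin_apply, hf]; exact (e _).2
    unfold Matrix.rank at *
    omega

lemma generic_rank (q : Matrix (Fin n) (Fin n) ℂ[X]) :
    ∀ᶠ ε in 𝓝[≠] (0:ℂ), ((evalRingHom (1:ℂ)).mapMatrix q).rank ≤ ((evalRingHom ε).mapMatrix q).rank := by
  obtain ⟨N, hN, hr⟩ := exists_fill ((evalRingHom (1:ℂ)).mapMatrix q)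
  let d := (q + Polynomial.C.mapMatrix N).det
  have hd : ∀ ε, d.eval ε = ((evalRingHom ε).mapMatrix q + N).det := by
    intro ε
    rw [← coe_evalRingHom, RingHom.map_det, map_add]
    congr 2
    ext i j; simp
  have hd0 : d ≠ 0 := by
    intro h
    have := hd 1
    rw [h, eval_zero] at this
    exact ((Matrix.isUnit_iff_isUnit_det _).1 hN).ne_zero this.symm
  have h1 : ∀ᶠ ε in cofinite, d.eval ε ≠ 0 := by
    rw [eventually_cofinite]
    refine (d.roots.toFinset.finite_toSet).subset fun x hx => ?_
    simp only [ne_eq, not_not, Set.mem_ofPred_eq] at hx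
    simpa [hd0] using hx
  filter_upwards [nhdsNE_le_cofinite 0 h1] with ε hε
  change d.eval ε ≠ 0 at hε
  rw [hd] at hε
  have h2 := Matrix.rank_of_isUnit _ ((Matrix.isUnit_iff_isUnit_det _).2 (isUnit_iff_ne_zero.2 hε))
  have h3 : ((evalRingHom ε).mapMatrix q + N).rank ≤ ((evalRingHom ε).mapMatrix q).rank + N.rank := by
    unfold Matrix.rank
    rw [Matrix.mulVecLin_add]
    exact (Submodule.finrank_mono (LinearMap.range_add_le _ _)).trans (Submodule.finrank_add_le_finrank_add_finrank _ _)
  rw [h2, Fintype.card_fin] at h3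
  omega

lemma pp_poly (ξ : ℕ → ℂ) (Y D : Mt n) (k : ℕ) : ∃ q : Matrix (Fin n) (Fin n) ℂ[X], ∀ ε : ℂ, (evalRingHom ε).mapMatrix q = pp ξ (Y + ε • D) k := by
  induction k with
  | zero => exact ⟨1, fun ε => by rw [map_one, pp_zero]⟩
  | succ k ih =>
    obtain ⟨q, hq⟩ := ih
    refine ⟨q * ((C : ℂ →+* ℂ[X]).mapMatrix Y + (X : ℂ[X]) • (C : ℂ →+* ℂ[X]).mapMatrix D - (C : ℂ →+* ℂ[X]).mapMatrix (ξ k • (1 : Mt n))), fun ε => ?_⟩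
    rw [map_mul, hq, pp_succ]
    congr 1
    ext i j
    simp; exact mul_comm _ _

lemma generic_sim {ξ : ℕ → ℂ} {B Y : Mt n} (hF : IsFlag (fl ξ B)) (h : Y - B ∈ nS (fl ξ B)) :
    ∀ᶠ ε in 𝓝[≠] (0:ℂ), ∃ S : Mt n, IsUnit S ∧ Y + ε • (B - Y) = S * B * S⁻¹ := by
  have h1 : ∀ᶠ ε in 𝓝[≠] (0:ℂ), ∀ k : Fin (n+1), (pp ξ B k).rank ≤ (pp ξ (Y + ε • (B - Y)) k).rank := by
    rw [eventually_all]
    intro k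
    obtain ⟨q, hq⟩ := pp_poly ξ Y (B - Y) k
    have := generic_rank q
    simp only [hq, one_smul, add_sub_cancel] at this
    exact this
  have hfc : ∀ ε : ℂ, FC ξ (fl ξ B) (Y + ε • (B - Y)) := by
    intro ε
    have := FC_add (fl_FC ξ B) (Submodule.smul_mem _ (1 - ε) h)
    convert this using 1
    module
  filter_upwards [h1] with ε hε
  refine simM ξ _ _ (fun k hk => le_antisymm ?_ (hε ⟨k, by omega⟩)) ?_ ?_
  · have e1 := LinearMap.finrank_range_add_finrank_ker (pp ξ B k).mulVecLin
    have e2 := LinearMap.finrank_range_add_finrank_ker (pp ξ (Y + ε • (B - Y)) k).mulVecLin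
    have e3 : finrank ℂ (LinearMap.ker (pp ξ B k).mulVecLin) ≤ finrank ℂ (LinearMap.ker (pp ξ (Y + ε • (B - Y)) k).mulVecLin) :=
      Submodule.finrank_mono fun v hv => FC_pp hF (hfc ε) k v hv
    unfold Matrix.rank
    omega
  · apply mat_ext; intro v; rw [Matrix.zero_mulVec]; exact FC_pp hF (hfc ε) n v (by rw [hF.top]; trivial)
  · apply mat_ext; intro v; rw [Matrix.zero_mulVec]; exact FC_pp hF (fl_FC ξ B) n v (by rw [hF.top]; trivial)

lemma triv_cent {C : Fin p → Mt n} {μ : Fin n → ℂ} (hμ : Function.Injective μ) (hs : ∑ i, C i = -Matrix.diagonal μ)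
    (hI : ∀ I : Finset (Fin n), CInv C I → I.Nonempty → I = Finset.univ) (θ : Mt n) (h : ∀ i, θ * C i = C i * θ) : ∃ c : ℂ, θ = c • (1 : Mt n) := by
  have h1 : θ * Matrix.diagonal μ = Matrix.diagonal μ * θ := by
    have : θ * ∑ i, C i = (∑ i, C i) * θ := by rw [Finset.mul_sum, Finset.sum_mul]; exact Finset.sum_congr rfl fun i _ => h i
    rw [hs, mul_neg, neg_mul, neg_inj] at this
    exact this
  have h2 := comm_diag hμ h1
  rcases isEmpty_or_nonempty (Fin n) with he | ⟨⟨x⟩⟩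
  · exact ⟨0, by ext i; exact he.elim i⟩
  refine ⟨θ x x, ?_⟩
  have h3 := hI (Finset.univ.filter fun j => θ j j = θ x x) (by
    intro i j hj l hl
    have := congrFun (congrFun (h i) j) l
    rw [h2, Matrix.diagonal_mul, Matrix.mul_diagonal] at this
    simp only [Finset.mem_filter, Finset.mem_univ, true_and] at hj hl
    rw [hl] at this
    have e : (θ j j - θ x x) * C i j l = 0 := by rw [sub_mul, this]; ring
    exact (mul_eq_zero.1 e).resolve_left (sub_ne_zero.2 hj)) ⟨x, by simp⟩
  rw [h2, Matrix.smul_one_eq_diagonal]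
  congr 1; funext j
  have : j ∈ (Finset.univ.filter fun j => θ j j = θ x x) := by rw [h3]; simp
  simpa using this

lemma sc_conj {g Y B : Mt n} (hg : IsUnit g) (h : ∃ S : Mt n, IsUnit S ∧ Y = S * B * S⁻¹) : ∃ S : Mt n, IsUnit S ∧ g * Y * g⁻¹ = S * B * S⁻¹ := by
  obtain ⟨S, hS, rfl⟩ := h
  exact ⟨g * S, hg.mul hS, by rw [Matrix.mul_inv_rev]; simp only [mul_assoc]⟩

lemma step5 {ξ : Fin p → ℕ → ℂ} {B : Fin p → Mt n} (hF : ∀ i, IsFlag (fl (ξ i) (B i))) {μ : Fin n → ℂ} (hμ : Function.Injective μ)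
    {g C : Fin p → Mt n} (hs : SolD (fun i => fl (ξ i) (B i)) B μ g C) (hI : ∀ I : Finset (Fin n), CInv C I → I.Nonempty → I = Finset.univ) :
    ∃ A : Fin p → Mt n, (∀ i, ∃ S : Mt n, IsUnit S ∧ A i = S * B i * S⁻¹) ∧ ∑ i, A i = -Matrix.diagonal μ ∧
      ∀ I : Finset (Fin n), CInv A I → I.Nonempty → I = Finset.univ := by
  have hu := fun i => (Matrix.isUnit_iff_isUnit_det _).1 (hs.unit i)
  have hC : ∀ i, C i = g i * ((g i)⁻¹ * C i * g i) * (g i)⁻¹ := by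
    intro i
    rw [mul_assoc, mul_assoc, mul_assoc, Matrix.mul_nonsing_inv _ (hu i), ← mul_assoc, ← mul_assoc, Matrix.mul_nonsing_inv _ (hu i), one_mul, mul_one]
  let v : Fin p → Mt n := fun i => g i * (B i - (g i)⁻¹ * C i * g i) * (g i)⁻¹
  have hCv : ∀ i (ε : ℂ), C i + ε • v i = g i * ((g i)⁻¹ * C i * g i + ε • (B i - (g i)⁻¹ * C i * g i)) * (g i)⁻¹ := by
    intro i ε
    rw [mul_add, add_mul, ← hC i, mul_smul_comm, smul_mul_assoc]
  have hsim := fun i => generic_sim (hF i) (hs.conj i)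
  have htv : ∀ i, (v i).trace = 0 := by
    intro i
    rw [Matrix.trace_mul_cycle, Matrix.nonsing_inv_mul _ (hu i), one_mul, ← neg_sub, Matrix.trace_neg, nilp_trace (nS_nilp (hF i) (hs.conj i)), neg_zero]
  by_cases hv0 : v = 0
  · refine ⟨C, fun i => ?_, hs.sum, hI⟩
    refine ⟨g i, hs.unit i, ?_⟩
    have := hCv i 1
    rw [one_smul, one_smul, add_sub_cancel, hv0, Pi.zero_apply, add_zero] at this
    exact this
  have hcent := triv_cent hμ hs.sum hI
  obtain ⟨γ, hγ⟩ : ∃ γ : Fin p → Mt n, ∑ i, (γ i * C i - C i * γ i + v i) = 0 := by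
    let T : (Fin p → Mt n) →ₗ[ℂ] Mt n := ∑ i, (LinearMap.mulRight ℂ (C i) - LinearMap.mulLeft ℂ (C i)) ∘ₗ LinearMap.proj i
    have hT : ∀ γ, T γ = ∑ i, (γ i * C i - C i * γ i) := by intro γ; simp only [T, LinearMap.sum_apply]; rfl
    obtain ⟨γ, h⟩ := mem_of_tr (LinearMap.range T) (-∑ i, v i) (by
      intro θ hθ
      obtain ⟨c, rfl⟩ := hcent θ (by
        intro i
        have : ∀ y, ((C i * θ - θ * C i) * y).trace = 0 := by
          intro y
          have h1 := hθ _ ⟨Pi.single i y, rfl⟩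
          rw [hT, Finset.sum_eq_single i (fun j _ hj => by simp [hj]) (by simp)] at h1
          simp only [Pi.single_eq_same] at h1
          rw [mul_sub, Matrix.trace_sub, ← mul_assoc, ← mul_assoc, Matrix.trace_mul_comm (θ * y), ← mul_assoc] at h1
          rw [sub_mul, Matrix.trace_sub, h1]
        exact (sub_eq_zero.1 (tr_nondeg this)).symm)
      rw [smul_mul_assoc, one_mul, Matrix.trace_smul, Matrix.trace_neg, Matrix.trace_sum]
      simp [htv])
    refine ⟨γ, ?_⟩
    rw [Finset.sum_add_distrib, ← hT, h, neg_add_cancel]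
  obtain ⟨G, η, h1, -, h3, h4, h5, h6, h7⟩ := curve C (Submodule.span ℂ {v})
    (fun ζ hζ i => by obtain ⟨a, rfl⟩ := Submodule.mem_span_singleton.1 hζ; simp [htv])
    (fun θ _ h _ => hcent θ h) γ v (Submodule.mem_span_singleton_self v) hγ
  choose ε hε using fun t => Submodule.mem_span_singleton.1 (h1 t)
  obtain ⟨i0, a, b, hab⟩ : ∃ i a b, v i a b ≠ 0 := by
    by_contra! hcon
    exact hv0 (funext fun i => by ext a b; exact hcon i a b)
  have hent : ∀ {f : ℂ → Mt n} {x : Mt n} {l : Filter ℂ} (a b : Fin n), Tendsto f l (𝓝 x) → Tendsto (fun t => f t a b) l (𝓝 (x a b)) :=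
    fun a b h => ((continuous_id.matrix_elem a b).tendsto _).comp h
  have hεe : ∀ t, η t i0 a b / v i0 a b = ε t := fun t => by
    rw [← hε t, Pi.smul_apply, Matrix.smul_apply, smul_eq_mul, mul_div_cancel_right₀ _ hab]
  have hε0 : Tendsto ε (𝓝[≠] 0) (𝓝 0) := by
    have := (hent a b (h5 i0)).div_const (v i0 a b)
    simp only [hεe] at this
    simpa using this
  have hεn : ∀ᶠ t in 𝓝[≠] (0:ℂ), ε t ≠ 0 := by
    filter_upwards [(hent a b (h3 i0)).eventually_ne hab] with t ht h0
    apply ht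
    rw [← hε t, h0]; simp
  have hεt : Tendsto ε (𝓝[≠] 0) (𝓝[≠] 0) := tendsto_nhdsWithin_iff.2 ⟨hε0, hεn⟩
  have hAC : ∀ i, Tendsto (fun t => (1 + G t i) * (C i + η t i) * (1 + G t i)⁻¹) (𝓝[≠] 0) (𝓝 (C i)) := by
    intro i
    have := (((tendsto_const_nhds (x := (1 : Mt n))).add (h4 i)).mul ((tendsto_const_nhds (x := C i)).add (h5 i))).mul (inv_tendsto (fun t => G t i) (h4 i))
    simpa using this
  have hir : ∀ᶠ t in 𝓝[≠] (0:ℂ), ∀ I : Finset (Fin n), CInv (fun i => (1 + G t i) * (C i + η t i) * (1 + G t i)⁻¹) I → I.Nonempty → I = Finset.univ := by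
    rw [eventually_all]
    intro I
    by_cases hCI : CInv C I
    · exact Eventually.of_forall fun t _ h => hI I hCI h
    · unfold CInv at hCI
      push Not at hCI
      obtain ⟨i, j, hj, l, hl, hne⟩ := hCI
      filter_upwards [(hent j l (hAC i)).eventually_ne hne] with t ht hc
      exact absurd (hc i j hj l hl) ht
  have hsi : ∀ᶠ t in 𝓝[≠] (0:ℂ), ∀ i, ∃ S : Mt n, IsUnit S ∧ (g i)⁻¹ * C i * g i + ε t • (B i - (g i)⁻¹ * C i * g i) = S * B i * S⁻¹ := by
    rw [eventually_all]
    exact fun i => hεt.eventually (hsim i)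
  obtain ⟨t, t1, t2, t3, t4⟩ := (h6.and (h7.and (hir.and hsi))).exists
  refine ⟨_, fun i => ?_, t2.trans hs.sum, t3⟩
  have := sc_conj (t1 i) (sc_conj (hs.unit i) (t4 i))
  rwa [← hCv, ← Pi.smul_apply, hε] at this

lemma irr_of {A : Fin p → Mt n} {μ : Fin n → ℂ} (hμ : Function.Injective μ) (hI : ∀ I : Finset (Fin n), CInv A I → I.Nonempty → I = Finset.univ)
    (W : Submodule ℂ (Vc n)) (h0 : ∀ v ∈ W, (Matrix.diagonal μ).mulVec v ∈ W) (h : ∀ i, ∀ v ∈ W, (A i).mulVec v ∈ W) : W = ⊥ ∨ W = ⊤ := by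
  classical
  have hp : ∀ (s : Finset (Fin n)) v, v ∈ W → (fun j => (∏ l ∈ s, (μ j - μ l)) * v j) ∈ W := by
    intro s
    induction s using Finset.induction_on with
    | empty => intro v hv; simpa using hv
    | insert l s hl ih =>
      intro v hv
      have := ih _ (W.sub_mem (h0 v hv) (W.smul_mem (μ l) hv))
      convert this using 2
      rw [Finset.prod_insert hl, Pi.sub_apply, Matrix.mulVec_diagonal, Pi.smul_apply, smul_eq_mul]; ring
  have hc : ∀ v ∈ W, ∀ j, v j ≠ 0 → Pi.single j 1 ∈ W := by
    intro v hv j hj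
    have h1 := hp (Finset.univ.erase j) v hv
    have h2 : (∏ l ∈ Finset.univ.erase j, (μ j - μ l)) ≠ 0 :=
      Finset.prod_ne_zero_iff.2 fun l hl => sub_ne_zero.2 fun e => (Finset.ne_of_mem_erase hl) (hμ e).symm
    have h3 := W.smul_mem ((∏ l ∈ Finset.univ.erase j, (μ j - μ l)) * v j)⁻¹ h1
    convert h3 using 1
    funext x
    by_cases hx : x = j
    · subst hx
      rw [Pi.single_eq_same, Pi.smul_apply, smul_eq_mul, inv_mul_cancel₀ (mul_ne_zero h2 hj)]
    · have e : ∏ l ∈ Finset.univ.erase j, (μ x - μ l) = 0 := Finset.prod_eq_zero (i := x) (by simp [hx]) (sub_self _)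
      rw [Pi.single_eq_of_ne hx, Pi.smul_apply, e, zero_mul, smul_zero]
  by_cases hne : (Finset.univ.filter fun j => (Pi.single j 1 : Vc n) ∈ W).Nonempty
  · right
    have := hI _ (by
      intro i j hj l hl
      simp only [Finset.mem_filter, Finset.mem_univ, true_and] at hj hl
      by_contra hA
      apply hj
      refine hc _ (h i _ hl) j ?_
      rw [Matrix.mulVec_single_one]; exact hA) hne
    rw [eq_top_iff]
    intro v _
    rw [show v = ∑ j, v j • (Pi.single j 1 : Vc n) by
      funext x; simp [Finset.sum_apply, Pi.single_apply]]
    refine W.sum_mem fun j _ => W.smul_mem _ ?_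
    have hj : j ∈ (Finset.univ.filter fun j => (Pi.single j 1 : Vc n) ∈ W) := by rw [this]; simp
    simpa using hj
  · left
    rw [eq_bot_iff]
    intro v hv
    rw [Submodule.mem_bot]
    funext j
    by_contra hj
    exact hne ⟨j, by simpa using hc v hv j hj⟩
end
end

section
open Module Filter Topology
lemma fin_inf {n : ℕ} {ι : Type*} [DecidableEq ι] (M : ι → Mt n) (s : Finset ι) :
    n ≤ finrank ℂ (s.inf fun i => LinearMap.ker (M i).mulVecLin : Submodule ℂ (Vc n)) + ∑ i ∈ s, (M i).rank := by
  induction s using Finset.induction_on with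
  | empty => rw [Finset.inf_empty, finrank_top]; simp
  | insert i s hi ih =>
    rw [Finset.inf_insert, Finset.sum_insert hi]
    have h1 := Submodule.finrank_sup_add_finrank_inf_eq (LinearMap.ker (M i).mulVecLin) (s.inf fun i => LinearMap.ker (M i).mulVecLin : Submodule ℂ (Vc n))
    have h2 := Submodule.finrank_le (LinearMap.ker (M i).mulVecLin ⊔ (s.inf fun i => LinearMap.ker (M i).mulVecLin : Submodule ℂ (Vc n)))
    have h3 := LinearMap.finrank_range_add_finrank_ker (M i).mulVecLin
    rw [Module.finrank_fin_fun] at h2 h3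
    change (M i).rank + _ = n at h3
    have h4 : n ≤ finrank ℂ (LinearMap.ker (M i).mulVecLin ⊓ (s.inf fun i => LinearMap.ker (M i).mulVecLin : Submodule ℂ (Vc n)) : Submodule ℂ (Vc n)) + ((M i).rank + ∑ i ∈ s, (M i).rank) := by
      linarith
    exact h4

lemma rk_attain {n : ℕ} (Y : Mt n) : ∃ μ : ℂ, (Y - μ • (1 : Mt n)).rank = rk Y :=
  Nat.sInf_mem (Set.range_nonempty fun μ : ℂ => (Y - μ • (1 : Mt n)).rank)

lemma rk_le {n : ℕ} (Y : Mt n) (μ : ℂ) : rk Y ≤ (Y - μ • (1 : Mt n)).rank :=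
  Nat.sInf_le ⟨μ, rfl⟩

lemma beta_nec {n q : ℕ} (hn : 2 ≤ n) {A B : Fin q → Mt n} (hc : ∀ j, SameClass (A j) (B j)) (hs : ∑ j, A j = 0)
    (hi : IrreducibleTuple A) (j : Fin q) : n ≤ ∑ i ∈ Finset.univ.erase j, rk (B i) := by
  by_contra hlt
  choose μ hμ using fun i => rk_attain (B i)
  have h1 : ∀ i, (A i - μ i • (1 : Mt n)).rank ≤ rk (B i) := by
    intro i
    obtain ⟨S, hS, h⟩ := hc i
    have hd := (Matrix.isUnit_iff_isUnit_det _).1 hS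
    have : A i - μ i • (1 : Mt n) = S * (B i - μ i • (1 : Mt n)) * S⁻¹ := by
      rw [h, mul_sub, sub_mul, Matrix.mul_smul, Matrix.smul_mul, mul_one, Matrix.mul_nonsing_inv _ hd]
    rw [this, ← hμ i]
    exact (Matrix.rank_mul_le_left _ _).trans (Matrix.rank_mul_le_right _ _)
  have h2 := fin_inf (fun i => A i - μ i • (1 : Mt n)) (Finset.univ.erase j)
  have h3 : ∑ i ∈ Finset.univ.erase j, (A i - μ i • (1 : Mt n)).rank ≤ ∑ i ∈ Finset.univ.erase j, rk (B i) :=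
    Finset.sum_le_sum fun i _ => h1 i
  obtain ⟨v, hv, hv0⟩ := (Submodule.ne_bot_iff _).1 (fun h => by
    rw [h, finrank_bot] at h2; omega :
      ((Finset.univ.erase j).inf fun i => LinearMap.ker (A i - μ i • (1 : Mt n)).mulVecLin : Submodule ℂ (Vc n)) ≠ ⊥)
  rw [Submodule.mem_finsetInf] at hv
  have h4 : ∀ i, i ≠ j → (A i).mulVec v = μ i • v := by
    intro i hij
    have := hv i (Finset.mem_erase.2 ⟨hij, Finset.mem_univ _⟩)
    rw [LinearMap.mem_ker, Matrix.mulVecLin_apply, Matrix.sub_mulVec, Matrix.smul_mulVec, Matrix.one_mulVec] at this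
    exact sub_eq_zero.1 this
  have h5 : ∀ i, ∃ c : ℂ, (A i).mulVec v = c • v := by
    intro i
    by_cases hij : i = j
    · subst hij
      refine ⟨-∑ l ∈ Finset.univ.erase i, μ l, ?_⟩
      rw [← Finset.add_sum_erase _ _ (Finset.mem_univ i)] at hs
      rw [eq_neg_of_add_eq_zero_left hs, Matrix.neg_mulVec, Matrix.sum_mulVec, neg_smul, Finset.sum_smul]
      congr 1
      exact Finset.sum_congr rfl fun l hl => h4 l (Finset.ne_of_mem_erase hl)
    · exact ⟨_, h4 i hij⟩
  rcases hi (Submodule.span ℂ {v}) (by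
    intro i w hw
    obtain ⟨a, rfl⟩ := Submodule.mem_span_singleton.1 hw
    obtain ⟨c, hc⟩ := h5 i
    rw [Matrix.mulVec_smul, hc]
    exact Submodule.smul_mem _ _ (Submodule.smul_mem _ _ (Submodule.mem_span_singleton_self v))) with h | h
  · exact hv0 (Submodule.span_singleton_eq_bot.1 h)
  · have := finrank_span_singleton (K := ℂ) hv0
    rw [h, finrank_top, Module.finrank_fin_fun] at this
    omega

lemma tr_of {n : ℕ} (Y : Mt n) (ν : Fin n → ℂ) (h : Y.charpoly = ∏ k, (X - C (ν k))) : Y.trace = ∑ k, ν k := by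
  rw [Matrix.trace_eq_sum_roots_charpoly, h, Finset.prod_eq_multiset_prod]
  have := Polynomial.roots_multiset_prod_X_sub_C (Finset.univ.val.map ν)
  rw [Multiset.map_map] at this
  exact congrArg Multiset.sum this

lemma eig_of {n : ℕ} (Y : Mt n) (ν : Fin n → ℂ) (h : Y.charpoly = ∏ k, (X - C (ν k))) (k : Fin n) :
    ∃ v : Vc n, v ≠ 0 ∧ Y.mulVec v = ν k • v := by
  have h1 : Y.charpoly.IsRoot (ν k) := by
    rw [h, Polynomial.IsRoot, Polynomial.eval_prod]
    exact Finset.prod_eq_zero (Finset.mem_univ k) (by simp)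
  have h2 : (Matrix.scalar (Fin n) (ν k) - Y).det = 0 := by
    rw [← Matrix.eval_charpoly]; exact h1
  obtain ⟨v, hv, h3⟩ := Matrix.exists_mulVec_eq_zero_iff.2 h2
  refine ⟨v, hv, ?_⟩
  rw [Matrix.sub_mulVec, sub_eq_zero, Matrix.scalar_apply, ← Matrix.smul_one_eq_diagonal, Matrix.smul_mulVec, Matrix.one_mulVec] at h3
  exact h3.symm

lemma dd_le {n : ℕ} (ξ : ℕ → ℂ) (Y : Mt n) (hY : Y.charpoly = ∏ k : Fin n, (X - C (ξ k))) :
    (dd Y : ℤ) ≤ n ^ 2 - ∑ k ∈ Finset.range n, mF (fl ξ Y) k ^ 2 := by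
  have h1 := cent_fin (fl_flag ξ Y hY) ξ Y (fl_FC ξ Y) (centSub Y) (fun x hx => hx)
  have h2 := Submodule.finrank_le (centSub Y)
  have h3 : finrank ℂ (Mt n) = n ^ 2 := by rw [Module.finrank_matrix]; simp [sq]
  rw [h3] at h2
  unfold dd
  rw [Nat.cast_sub h2]
  push_cast
  linarith

lemma dd_le' {n : ℕ} (ξ : ℕ → ℂ) (Y : Mt n) (hY : Y.charpoly = ∏ k : Fin n, (X - C (ξ k))) :
    (dd Y : ℤ) ≤ n ^ 2 - n := by
  have h1 := dd_le ξ Y hY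
  have h2 := mF_sum (fl_flag ξ Y hY)
  have h3 : ∑ k ∈ Finset.range n, mF (fl ξ Y) k ≤ ∑ k ∈ Finset.range n, mF (fl ξ Y) k ^ 2 :=
    Finset.sum_le_sum fun k _ => Int.le_self_sq _
  linarith

lemma num_fin {n p : ℕ} (hn : 2 ≤ n) (F : Fin p → ℕ → Submodule ℂ (Vc n)) (hF : ∀ i, IsFlag (F i)) (r : Fin p → ℕ)
    (hr : ∀ i k, mF (F i) k + r i ≤ n) (hrs : n ≤ ∑ i, r i)
    (hd : (n : ℤ) ^ 2 + n ≤ ∑ i, ((n : ℤ) ^ 2 - ∑ k ∈ Finset.range n, mF (F i) k ^ 2))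
    (g : Fin p → Mt n) (hg : ∀ i, IsUnit (g i)) (W : Submodule ℂ (Vc n)) (h1 : 1 ≤ finrank ℂ W) (h2 : finrank ℂ W + 1 ≤ n) :
    (finrank ℂ W : ℤ) * (n - finrank ℂ W) + 1 ≤ ∑ i, ((finrank ℂ W : ℤ) * (n - finrank ℂ W) -
        ∑ k ∈ Finset.range n, aW W (gF (g i) (F i)) k * (mF (gF (g i) (F i)) k - aW W (gF (g i) (F i)) k)) ∧
    (2 ≤ finrank ℂ W → finrank ℂ W + 2 ≤ n → (finrank ℂ W : ℤ) * (n - finrank ℂ W) + 2 ≤ ∑ i, ((finrank ℂ W : ℤ) * (n - finrank ℂ W) -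
        ∑ k ∈ Finset.range n, aW W (gF (g i) (F i)) k * (mF (gF (g i) (F i)) k - aW W (gF (g i) (F i)) k))) := by
  haveI : Nonempty (Fin n) := ⟨⟨0, by omega⟩⟩
  have hG := fun i => gF_flag (hg i) (hF i)
  have key : ∀ i, ∃ (k0 : Fin n) (u v z D : ℤ), CF n (finrank ℂ W) (n - finrank ℂ W)
      ((finrank ℂ W : ℤ) * (n - finrank ℂ W) -
        ∑ k ∈ Finset.range n, aW W (gF (g i) (F i)) k * (mF (gF (g i) (F i)) k - aW W (gF (g i) (F i)) k))
      ((n : ℤ) ^ 2 - ∑ k ∈ Finset.range n, mF (F i) k ^ 2) (n - mF (F i) k0) u v z D := by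
    intro i
    obtain ⟨k0, hk0⟩ := Finite.exists_max (fun k : Fin n => mF (gF (g i) (F i)) k)
    obtain ⟨u, v, z, D, h⟩ := cf_of (K := Fin n) (n : ℤ) (finrank ℂ W) (n - finrank ℂ W) (by omega) (by omega) (by omega) (by ring)
      (fun k => aW W (gF (g i) (F i)) k) (fun k => mF (gF (g i) (F i)) k - aW W (gF (g i) (F i)) k)
      (fun k => aW_nonneg W (hG i) k) (fun k => sub_nonneg.2 (aW_le W (hG i) k))
      (by rw [← Finset.sum_range (fun k => aW W (gF (g i) (F i)) k)]; exact aW_sum W (hG i))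
      (by rw [← Finset.sum_range (fun k => mF (gF (g i) (F i)) k - aW W (gF (g i) (F i)) k), Finset.sum_sub_distrib, aW_sum W (hG i), mF_sum (hG i)])
      k0 (fun k => by simpa using hk0 k)
    refine ⟨k0, u, v, z, D, ?_⟩
    rw [← Finset.sum_range (fun k => aW W (gF (g i) (F i)) k * (mF (gF (g i) (F i)) k - aW W (gF (g i) (F i)) k))] at h
    simp only [add_sub_cancel] at h
    rw [← Finset.sum_range (fun k => mF (gF (g i) (F i)) k ^ 2)] at h
    simp only [mF_gF (hg i)] at h ⊢
    exact h
  choose k0 u v z D h using key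
  have := num (n : ℤ) (finrank ℂ W) (n - finrank ℂ W) (by omega) (by omega) (by ring) _ _ _ u v z D h (by
    have : ((∑ i, r i : ℕ) : ℤ) ≤ ∑ i, ((n : ℤ) - mF (F i) (k0 i)) := by
      push_cast
      exact Finset.sum_le_sum fun i _ => by linarith [hr i (k0 i)]
    omega) hd
  exact ⟨this.1, fun a b => this.2 (by omega) (by omega)⟩

lemma suff {n p : ℕ} (hn : 2 ≤ n) (B : Fin (p + 1) → Mt n) (lam : Fin n → Fin (p + 1) → ℂ)
    (hchar : ∀ j, (B j).charpoly = ∏ k, (X - C (lam k j))) (hdist : Function.Injective fun k => lam k 0)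
    (htrace : ∑ j, ∑ k, lam k j = 0) (hgen : ∀ (j : Fin n) (k : Fin p → Fin n), lam j 0 + ∑ i, lam (k i) i.succ ≠ 0)
    (hκ : 2 * (n : ℤ) ^ 2 - ∑ j, (dd (B j) : ℤ) ≤ 0) (hβ : n ≤ ∑ i ∈ Finset.univ.erase 0, rk (B i)) :
    ∃ A : Fin (p + 1) → Mt n, (∀ j, SameClass (A j) (B j)) ∧ ∑ j, A j = 0 ∧ IrreducibleTuple A := by
  let ξ : Fin (p+1) → ℕ → ℂ := fun j k => if h : k < n then lam ⟨k, h⟩ j else 0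
  have hξ : ∀ j (k : Fin n), ξ j k = lam k j := fun j k => by simp [ξ]
  have hY : ∀ j, (B j).charpoly = ∏ k : Fin n, (X - C (ξ j k)) := fun j => by
    rw [hchar]; exact Finset.prod_congr rfl fun k _ => by rw [hξ]
  have hF : ∀ i : Fin p, IsFlag (fl (ξ i.succ) (B i.succ)) := fun i => fl_flag _ _ (hY _)
  have hr : ∀ (i : Fin p) k, mF (fl (ξ i.succ) (B i.succ)) k + (rk (B i.succ) : ℕ) ≤ n := fun i k => by
    have h1 := fl_mF (ξ i.succ) (B i.succ) k
    have h2 := rk_le (B i.succ) (ξ i.succ k)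
    omega
  have hrs : n ≤ ∑ i : Fin p, rk (B i.succ) := by
    have := Finset.add_sum_erase Finset.univ (fun i => rk (B i)) (Finset.mem_univ 0)
    rw [Fin.sum_univ_succ] at this
    omega
  have hd : (n : ℤ) ^ 2 + n ≤ ∑ i : Fin p, ((n : ℤ) ^ 2 - ∑ k ∈ Finset.range n, mF (fl (ξ i.succ) (B i.succ)) k ^ 2) := by
    rw [Fin.sum_univ_succ] at hκ
    have h1 := dd_le' (ξ 0) (B 0) (hY 0)
    have h2 := Finset.sum_le_sum (s := Finset.univ) fun (i : Fin p) _ => dd_le (ξ i.succ) (B i.succ) (hY i.succ)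
    linarith
  have hnum := num_fin hn _ hF _ hr hrs hd
  have hB : ∀ i : Fin p, FC (ξ i.succ) (fl (ξ i.succ) (B i.succ)) (B i.succ) := fun i => fl_FC _ _
  have e3 := step3 (by omega) (fun i : Fin p => fl (ξ i.succ) (B i.succ)) hF (fun i => ξ i.succ) (fun i => B i.succ) hB (fun k => lam k 0) hdist
    (by
      rw [Fin.sum_univ_succ] at htrace
      rw [← htrace]
      congr 1
      exact Finset.sum_congr rfl fun i _ => tr_of _ _ (hchar _))
    (fun g hg W h0 h1 => Int.lt_iff_add_one_le.2 (hnum g hg W h0 h1).1)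
  obtain ⟨g, C, hs, hI⟩ := step4 (by omega) hF hdist e3
    (fun g C hs => gen_of hF hB (fun j k => by simp only [hξ]; exact hgen j k) hs)
    (fun g hg W h0 h1 => (hnum g hg W (by omega) (by omega)).2 h0 h1)
  obtain ⟨A, hA, hsum, hAI⟩ := step5 hF hdist hs hI
  obtain ⟨S, hS, hYS⟩ := diag_of_eig (B 0) _ hdist (eig_of (B 0) _ (hchar 0))
  have hSd := (Matrix.isUnit_iff_isUnit_det _).1 hS
  refine ⟨Fin.cons (Matrix.diagonal fun k => lam k 0) A, fun j => ?_, ?_, fun W hW => ?_⟩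
  · refine Fin.cases ?_ (fun i => ?_) j
    · refine ⟨S⁻¹, Matrix.isUnit_nonsing_inv_iff.2 hS, ?_⟩
      rw [Matrix.nonsing_inv_nonsing_inv _ hSd, mul_assoc, hYS, ← mul_assoc, Matrix.nonsing_inv_mul _ hSd, one_mul]
      rfl
    · exact hA i
  · rw [Fin.sum_univ_succ]; simp [hsum]
  · exact irr_of hdist hAI W (hW 0) (fun i => hW i.succ)
end

end

/-- Deligne–Simpson problem, additive version: for 2-generic eigenvalues and index of
rigidity `κ ≤ 0`, conditions `(α_n)` and `(β_n)` are necessary and sufficient for the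
existence of an irreducible tuple with zero sum. -/
theorem stmt0 (n p : ℕ) (hn : 2 ≤ n) (hp : 1 ≤ p)
    (B : Fin (p + 1) → Matrix (Fin n) (Fin n) ℂ)
    (lam : Fin n → Fin (p + 1) → ℂ)
    (hchar : ∀ j, (B j).charpoly = ∏ k, (Polynomial.X - Polynomial.C (lam k j)))
    (hdist : Function.Injective fun k => lam k 0)
    (htrace : ∑ j, ∑ k, lam k j = 0)
    (h2gen : ∀ (N : ℕ) (Φ : Fin (p + 1) → Finset (Fin n)),
      1 ≤ N → N ≤ n - 1 → (∀ j, (Φ j).card = N) →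
      (∑ j, ∑ k ∈ Φ j, lam k j) = 0 → 2 ≤ min N (n - N))
    (hκ : 2 * (n : ℤ) ^ 2 - ∑ j, (dd (B j) : ℤ) ≤ 0) :
    (∃ A : Fin (p + 1) → Matrix (Fin n) (Fin n) ℂ,
        (∀ j, SameClass (A j) (B j)) ∧ ∑ j, A j = 0 ∧ IrreducibleTuple A) ↔
      ((2 * n ^ 2 - 2 ≤ ∑ j, dd (B j)) ∧
        ∀ j, n ≤ ∑ i ∈ Finset.univ.erase j, rk (B i)) := by
  constructor
  · rintro ⟨A, hc, hs, hi⟩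
    refine ⟨?_, beta_nec hn hc hs hi⟩
    have : 2 * n ^ 2 ≤ ∑ j, dd (B j) := by
      zify; linarith
    omega
  · rintro ⟨_, hβ⟩
    refine suff hn B lam hchar hdist htrace (fun j k h => ?_) hκ (hβ 0)
    have := h2gen 1 (Fin.cons {j} fun i => {k i}) le_rfl (by omega)
      (fun i => by refine Fin.cases ?_ (fun i => ?_) i <;> simp)
      (by rw [Fin.sum_univ_succ]; simpa using h)
    omega
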